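/- Fix integers r ≥ 3 and 0 ≤ k ≤ r−2, a constant γ ≥ 1, and T > 0. Let (η, u) be a sufficiently smooth solution of (SW) on [0,1]×[0,T] (it suffices that η, u ∈ C¹([0,T]; C^r[0,1])) satisfying 1 + η(x,t) > 0 for all (x,t) ∈ [0,1]×[0,T]. Then there exist h₀ > 0 and a constant C, independent of the partition, such that for every partition of [0,1] that is quasiuniform with constant γ and has h ≤ h₀, the semidiscrete Galerkin problem: (∂_t η_h, φ) + (∂_x u_h, φ) + (∂_x(η_h u_h), φ) = 0 for all φ ∈ S_h, (∂_t u_h, χ) + (∂_x η_h, χ) + (u_h ∂_x u_h, χ) = 0 for all χ ∈ S_{h,0}, with η_h(0) = Pη₀, u_h(0) = P₀u₀, has a unique solution (η_h, u_h) on [0,T] satisfying max_{0≤t≤T} (‖η(·,t) − η_h(t)‖ + ‖u(·,t) − u_h(t)‖) ≤ C h^{r−1}. -/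

import Mathlib

noncomputable section
open Set

/-- The L²(0,1) inner product of two real functions. -/
def ip (f g : ℝ → ℝ) : ℝ := ∫ y in (0:ℝ)..1, f y * g y

/-- The L²(0,1) norm. -/
def nrm (f : ℝ → ℝ) : ℝ := Real.sqrt (∫ y in (0:ℝ)..1, (f y)^2)

/-- `g` is the L²(0,1)-orthogonal projection of `f` onto `S`. -/
def IsL2ProjOn (S : Set (ℝ → ℝ)) (f g : ℝ → ℝ) : Prop :=
  g ∈ S ∧ ∀ χ ∈ S, ip (fun y => f y - g y) χ = 0

/-- The space `S_h` of `C^k` piecewise polynomials of degree ≤ r-1 on the partition `x`. -/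
def Sh (N r k : ℕ) (x : ℕ → ℝ) : Set (ℝ → ℝ) :=
  {φ | ContDiffOn ℝ k φ (Icc (0:ℝ) 1) ∧
    ∀ j < N, ∃ p : Polynomial ℝ, p.natDegree ≤ r - 1 ∧
      ∀ y ∈ Icc (x j) (x (j+1)), φ y = Polynomial.eval y p}

/-- The subspace `S_{h,0}` of functions in `S_h` vanishing at 0 and 1. -/
def Sh0 (N r k : ℕ) (x : ℕ → ℝ) : Set (ℝ → ℝ) :=
  {φ | φ ∈ Sh N r k x ∧ φ 0 = 0 ∧ φ 1 = 0}

/-- `x 0 = 0 < x 1 < ⋯ < x N = 1` is a partition of `[0,1]`. -/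
def IsPartition (N : ℕ) (x : ℕ → ℝ) : Prop :=
  x 0 = 0 ∧ x N = 1 ∧ ∀ i < N, x i < x (i+1)

/-- `h` is the maximal meshlength of the partition `x`. -/
def IsMeshSize (N : ℕ) (x : ℕ → ℝ) (h : ℝ) : Prop :=
  (∀ i < N, x (i+1) - x i ≤ h) ∧ ∃ i < N, x (i+1) - x i = h

/-- The partition is quasiuniform with constant γ : `h ≤ γ · min meshlength`. -/
def QuasiUniform (N : ℕ) (x : ℕ → ℝ) (h γ : ℝ) : Prop :=
  ∀ i < N, h ≤ γ * (x (i+1) - x i)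

/-- `fs j` is the j-th time derivative of `fs 0` on `[0,1]×[0,T]` for `j ≤ m`,
each being r times continuously differentiable in space and jointly continuous:
an encoding of `fs 0 ∈ C^m([0,T]; C^r[0,1])`. -/
def SmoothChain (T : ℝ) (r m : ℕ) (fs : ℕ → ℝ → ℝ → ℝ) : Prop :=
  (∀ j < m, ∀ y ∈ Icc (0:ℝ) 1, ∀ t ∈ Icc (0:ℝ) T,
    HasDerivWithinAt (fun s => fs j y s) (fs (j+1) y t) (Icc (0:ℝ) T) t) ∧
  (∀ j ≤ m, ∀ t ∈ Icc (0:ℝ) T, ContDiffOn ℝ r (fun y => fs j y t) (Icc (0:ℝ) 1)) ∧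
  (∀ j ≤ m, ContinuousOn (fun p : ℝ × ℝ => fs j p.1 p.2) ((Icc (0:ℝ) 1) ×ˢ (Icc (0:ℝ) T)))

/-- `(η,u)` (with time derivatives `ηt`, `ut`) solves the shallow water
system on `[0,1]×[0,T]` with homogeneous boundary conditions for `u`. -/
def SW (T : ℝ) (η u ηt ut : ℝ → ℝ → ℝ) : Prop :=
  (∀ y ∈ Icc (0:ℝ) 1, ∀ t ∈ Icc (0:ℝ) T,
    ηt y t + derivWithin (fun z => u z t) (Icc (0:ℝ) 1) y
      + derivWithin (fun z => η z t * u z t) (Icc (0:ℝ) 1) y = 0 ∧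
    ut y t + derivWithin (fun z => η z t) (Icc (0:ℝ) 1) y
      + u y t * derivWithin (fun z => u z t) (Icc (0:ℝ) 1) y = 0) ∧
  (∀ t ∈ Icc (0:ℝ) T, u 0 t = 0 ∧ u 1 t = 0)

/-- `(ηh, uh)` (with time derivatives `dηh`, `duh`) is a `C¹` in time solution of the
standard Galerkin semidiscretization of the shallow water system in
`Sh N r k x × Sh0 N r k x` on `[0,T]`. -/
def SolvesSWGalerkin (N r k : ℕ) (x : ℕ → ℝ) (T : ℝ)
    (ηh uh dηh duh : ℝ → ℝ → ℝ) : Prop :=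
  (∀ t ∈ Icc (0:ℝ) T, ηh t ∈ Sh N r k x ∧ uh t ∈ Sh0 N r k x ∧
      dηh t ∈ Sh N r k x ∧ duh t ∈ Sh0 N r k x) ∧
  (∀ y ∈ Icc (0:ℝ) 1, ∀ t ∈ Icc (0:ℝ) T,
      HasDerivWithinAt (fun s => ηh s y) (dηh t y) (Icc (0:ℝ) T) t ∧
      HasDerivWithinAt (fun s => uh s y) (duh t y) (Icc (0:ℝ) T) t) ∧
  (∀ y ∈ Icc (0:ℝ) 1, ContinuousOn (fun t => dηh t y) (Icc (0:ℝ) T) ∧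
      ContinuousOn (fun t => duh t y) (Icc (0:ℝ) T)) ∧
  (∀ t ∈ Icc (0:ℝ) T,
      (∀ φ ∈ Sh N r k x,
        ip (dηh t) φ + ip (deriv (uh t)) φ
          + ip (deriv (fun y => ηh t y * uh t y)) φ = 0) ∧
      (∀ χ ∈ Sh0 N r k x,
        ip (duh t) χ + ip (deriv (ηh t)) χ
          + ip (fun y => uh t y * deriv (uh t) y) χ = 0))

/-- iterated forward differences -/
def fd (ε : ℝ) : ℕ → (ℝ → ℝ) → ℝ → ℝ
  | 0, f => f
  | (n+1), f => fun x => fd ε n f (x + ε) - fd ε n f x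

lemma fd_zero (ε : ℝ) (f : ℝ → ℝ) : fd ε 0 f = f := rfl
lemma fd_succ (ε : ℝ) (n : ℕ) (f : ℝ → ℝ) (x : ℝ) :
    fd ε (n+1) f x = fd ε n f (x + ε) - fd ε n f x := rfl

lemma fd_shift (ε : ℝ) (n : ℕ) (f : ℝ → ℝ) (c x : ℝ) :
    fd ε n (fun y => f (y + c)) x = fd ε n f (x + c) := by
  induction n generalizing x with
  | zero => rfl
  | succ n ih => simp only [fd_succ, ih]; ring_nf

lemma fd_lin (ε : ℝ) (n : ℕ) (f g : ℝ → ℝ) (a b x : ℝ) :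
    fd ε n (fun y => a * f y + b * g y) x = a * fd ε n f x + b * fd ε n g x := by
  induction n generalizing x with
  | zero => rfl
  | succ n ih => simp only [fd_succ, ih]; ring

lemma fd_neg (ε : ℝ) (n : ℕ) (f : ℝ → ℝ) (x : ℝ) :
    fd ε n (fun y => - f y) x = - fd ε n f x := by
  induction n generalizing x with
  | zero => rfl
  | succ n ih => simp only [fd_succ, ih]; ring

lemma fd_refl (ε : ℝ) (n : ℕ) (f : ℝ → ℝ) (x : ℝ) :
    fd ε n (fun y => f (-y)) x = (-1)^n * fd ε n f (-x - n * ε) := by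
  induction n generalizing x with
  | zero => simp [fd_zero]
  | succ n ih =>
    simp only [fd_succ, ih]
    push_cast
    have e1 : -(x + ε) - n * ε = -x - (n+1) * ε := by ring
    have e2 : -x - (n+1) * ε + ε = -x - n * ε := by ring
    rw [e1, e2]; ring

lemma fd_mul (ε : ℝ) (n : ℕ) (f g : ℝ → ℝ) (x : ℝ) :
    fd ε n (fun y => f y * g y) x =
      ∑ ij ∈ Finset.HasAntidiagonal.antidiagonal n, (n.choose ij.1 : ℝ) *
        (fd ε ij.1 f x * fd ε ij.2 g (x + ij.1 * ε)) := by
  induction n generalizing x with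
  | zero => simp [fd_zero]
  | succ n ih =>
    rw [Finset.sum_antidiagonal_choose_succ_mul
      (fun i j => fd ε i f x * fd ε j g (x + i * ε)) n, fd_succ, ih, ih,
      ← Finset.sum_sub_distrib, ← Finset.sum_add_distrib]
    refine Finset.sum_congr rfl fun ij hij => ?_
    have hsum : ij.1 + ij.2 = n := Finset.HasAntidiagonal.mem_antidiagonal.mp hij
    have hc : (n.choose ij.2 : ℝ) = n.choose ij.1 := by
      rw [← hsum, Nat.choose_symm_add]
    rw [hc, fd_succ, fd_succ]
    push_cast
    have e1 : x + ε + ij.1 * ε = x + (ij.1 + 1) * ε := by ring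
    have e2 : x + ij.1 * ε + ε = x + (ij.1 + 1) * ε := by ring
    rw [e1, e2]; ring

/-- difference bound -/
def DB (f : ℝ → ℝ) (n : ℕ) (K : ℝ) : Prop := ∀ ε > 0, ∀ x, |fd ε n f x| ≤ K * ε ^ n

lemma DB.mono {f : ℝ → ℝ} {n : ℕ} {K K' : ℝ} (h : DB f n K) (hK : K ≤ K') : DB f n K' :=
  fun ε hε x => (h ε hε x).trans (by gcongr)

lemma fd_hasDeriv (ε : ℝ) (n : ℕ) (f f' : ℝ → ℝ) (h : ∀ x, HasDerivAt f (f' x) x) (x : ℝ) :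
    HasDerivAt (fd ε n f) (fd ε n f' x) x := by
  induction n generalizing x with
  | zero => exact h x
  | succ n ih =>
    have h1 := (ih (x + ε)).comp_add_const x ε
    exact h1.sub (ih x)

lemma fd_cont (ε : ℝ) (n : ℕ) (f : ℝ → ℝ) (h : Continuous f) : Continuous (fd ε n f) := by
  induction n with
  | zero => exact h
  | succ n ih => exact (ih.comp (continuous_id.add continuous_const)).sub ih

lemma fd_per (ε : ℝ) (n : ℕ) (f : ℝ → ℝ) (c : ℝ) (h : ∀ x, f (x + c) = f x) (x : ℝ) :
    fd ε n f (x + c) = fd ε n f x := by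
  rw [← fd_shift]; congr 1; funext y; exact h y

lemma DB.climb {f f' : ℝ → ℝ} {n : ℕ} {K : ℝ} (h : ∀ x, HasDerivAt f (f' x) x)
    (hb : DB f' n K) : DB f (n+1) K := by
  intro ε hε x
  have := Convex.norm_image_sub_le_of_norm_hasDerivWithin_le (f := fd ε n f) (f' := fd ε n f')
    (s := univ) (C := K * ε ^ n) (x := x) (y := x + ε)
    (fun y _ => (fd_hasDeriv ε n f f' h y).hasDerivWithinAt)
    (fun y _ => hb ε hε y) convex_univ trivial trivial
  rw [fd_succ]
  simp only [Real.norm_eq_abs, add_sub_cancel_left, abs_of_pos hε] at this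
  rw [pow_succ, ← mul_assoc]; exact this

/-- local version: on an interval. -/
lemma fd_local (n : ℕ) : ∀ (g : ℕ → ℝ → ℝ) (α β : ℝ),
    (∀ i < n, ∀ x ∈ Icc α β, HasDerivWithinAt (g i) (g (i+1) x) (Icc α β) x) →
    ∀ a δ : ℝ, (∀ x ∈ Icc α β, |g n x - a| ≤ δ) → ∀ ε > 0, ∀ x, α ≤ x → x + n * ε ≤ β →
    |fd ε n (g 0) x - a * ε ^ n| ≤ δ * ε ^ n := by
  have hder : ∀ (n : ℕ) (f f' : ℝ → ℝ) (α β : ℝ),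
      (∀ x ∈ Icc α β, HasDerivWithinAt f (f' x) (Icc α β) x) → ∀ ε > 0, ∀ x γ, α ≤ x →
      x ≤ γ → γ + n * ε ≤ β → HasDerivWithinAt (fd ε n f) (fd ε n f' x) (Icc α γ) x := by
    intro n
    induction n with
    | zero =>
      intro f f' α β h ε hε x γ h1 h2 h3
      simp at h3
      exact (h x ⟨h1, by linarith⟩).mono (Icc_subset_Icc le_rfl h3)
    | succ n ih =>
      intro f f' α β h ε hε x γ h1 h2 h3
      push_cast at h3
      have hA := ih f f' α β h ε hε (x + ε) (γ + ε) (by linarith) (by linarith) (by linarith)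
      have hB := ih f f' α β h ε hε x γ (by linarith) (by linarith) (by nlinarith)
      have hA' : HasDerivWithinAt (fun y => fd ε n f (y + ε)) (fd ε n f' (x + ε))
          (Icc α γ) x := by
        have := hA.comp (h := fun y => y + ε) (h' := 1) (s := Icc α γ) x
          ((hasDerivAt_id x).add_const ε).hasDerivWithinAt
          (fun y hy => ⟨by linarith [hy.1], by linarith [hy.2]⟩)
        exact this.congr_deriv (by simp)
      exact hA'.sub hB
  induction n with
  | zero =>
    intro g α β _ a δ hb ε hε x h1 h2
    simp at h2 ⊢
    exact hb x ⟨h1, h2⟩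
  | succ n ih =>
    intro g α β hg a δ hb ε hε x h1 h2
    push_cast at h2
    have hbd := ih (fun i => g (i+1)) α β (fun i hi => hg (i+1) (by omega)) a δ hb ε hε
    have hd := hder n (g 0) (g 1) α β (hg 0 (by omega)) ε hε
    have := Convex.norm_image_sub_le_of_norm_hasDerivWithin_le
      (f := fun y => fd ε n (g 0) y - a * ε ^ n * y) (f' := fun y => fd ε n (g 1) y - a * ε ^ n)
      (s := Icc x (x + ε)) (C := δ * ε ^ n) (x := x) (y := x + ε)
      (fun y hy => by
        have h3 := (hd y (x + ε) (by linarith [hy.1]) hy.2 (by linarith)).mono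
          (Icc_subset_Icc_left h1)
        have h4 := ((hasDerivAt_id y).const_mul (a * ε ^ n)).hasDerivWithinAt (s := Icc x (x + ε))
        exact (h3.sub h4).congr_deriv (by simp))
      (fun y hy => hbd y (by linarith [hy.1]) (by nlinarith [hy.2])) (convex_Icc _ _)
      (left_mem_Icc.2 (by linarith)) (right_mem_Icc.2 (by linarith))
    simp only [Real.norm_eq_abs, add_sub_cancel_left, abs_of_pos hε] at this
    rw [fd_succ]
    calc _ = |fd ε n (g 0) (x + ε) - a * ε ^ n * (x + ε) - (fd ε n (g 0) x - a * ε ^ n * x)| := by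
          congr 1; ring
      _ ≤ _ := this
      _ = _ := by ring

lemma comm_bound (n : ℕ) (lam g : ℝ → ℝ) (L G : ℕ → ℝ) (hL : ∀ j ≤ n, 1 ≤ j → DB lam j (L j))
    (hG : ∀ j < n, DB g j (G j)) (hL0 : ∀ j, 0 ≤ L j) (B : ℝ)
    (hB : ∀ i j, i + j = n → 1 ≤ i → L i * G j ≤ B) (hB0 : 0 ≤ B) (ε : ℝ) (hε : 0 < ε) (x : ℝ) :
    |fd ε n (fun y => lam y * g y) x - lam x * fd ε n g x| ≤ 2 ^ n * B * ε ^ n := by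
  rw [fd_mul]
  have hmem : (0, n) ∈ Finset.HasAntidiagonal.antidiagonal n := by simp
  rw [← Finset.add_sum_erase _ _ hmem]
  simp only [Nat.choose_zero_right, Nat.cast_one, fd_zero, one_mul, Nat.cast_zero, zero_mul,
    add_zero, add_sub_cancel_left]
  refine (Finset.abs_sum_le_sum_abs _ _).trans ?_
  have hterm : ∀ ij ∈ (Finset.HasAntidiagonal.antidiagonal n).erase (0, n),
      |(n.choose ij.1 : ℝ) * (fd ε ij.1 lam x * fd ε ij.2 g (x + ij.1 * ε))| ≤
        (n.choose ij.1 : ℝ) * (B * ε ^ n) := by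
    intro ij hij
    obtain ⟨hne, hij⟩ := Finset.mem_erase.1 hij
    have hsum : ij.1 + ij.2 = n := Finset.HasAntidiagonal.mem_antidiagonal.mp hij
    have h1 : 1 ≤ ij.1 := by
      rcases Nat.eq_zero_or_pos ij.1 with h | h
      · exact absurd (Prod.ext h (by simp; omega)) hne
      · exact h
    rw [abs_mul, abs_of_nonneg (by positivity : (0:ℝ) ≤ n.choose ij.1), abs_mul]
    refine mul_le_mul_of_nonneg_left ?_ (by positivity)
    calc |fd ε ij.1 lam x| * |fd ε ij.2 g (x + ij.1 * ε)|
        ≤ (L ij.1 * ε ^ ij.1) * (G ij.2 * ε ^ ij.2) := by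
          apply mul_le_mul (hL _ (by omega) h1 ε hε x) (hG _ (by omega) ε hε _) (abs_nonneg _)
          have := hL0 ij.1
          positivity
      _ = (L ij.1 * G ij.2) * ε ^ n := by rw [← hsum, pow_add]; ring
      _ ≤ B * ε ^ n := by gcongr; exact hB _ _ hsum h1
  refine (Finset.sum_le_sum hterm).trans ?_
  have : ∑ ij ∈ (Finset.HasAntidiagonal.antidiagonal n).erase (0, n), (n.choose ij.1 : ℝ) * (B * ε ^ n)
      ≤ ∑ ij ∈ (Finset.HasAntidiagonal.antidiagonal n), (n.choose ij.1 : ℝ) * (B * ε ^ n) :=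
    Finset.sum_le_sum_of_subset_of_nonneg (Finset.erase_subset _ _) (fun _ _ _ => by positivity)
  refine this.trans ?_
  rw [← Finset.sum_mul, Finset.Nat.sum_antidiagonal_eq_sum_range_succ_mk]
  have h2 : (∑ k ∈ Finset.range n.succ, (n.choose k : ℝ)) = 2 ^ n := by
    exact_mod_cast Nat.sum_range_choose n
  simp only
  rw [h2]; linarith

lemma baire_compact {A : ℝ → Set ℝ} (hmono : ∀ K K', K ≤ K' → A K ⊆ A K') {S Z : Set ℝ}
    (hS : IsCompact S) (h : ∀ t ∈ S, ∃ δ > 0, ∃ K, ∀ τ ∈ Z, |τ - t| < δ → τ ∈ A K) :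
    ∃ K, S ∩ Z ⊆ A K := by
  refine hS.induction_on (p := fun S => ∃ K, S ∩ Z ⊆ A K) ⟨0, by simp⟩ ?_ ?_ ?_
  · rintro s t hst ⟨K, hK⟩
    exact ⟨K, (inter_subset_inter_left _ hst).trans hK⟩
  · rintro s t ⟨K, hK⟩ ⟨K', hK'⟩
    refine ⟨max K K', ?_⟩
    rw [union_inter_distrib_right]
    exact union_subset (hK.trans (hmono _ _ (le_max_left _ _)))
      (hK'.trans (hmono _ _ (le_max_right _ _)))
  · intro t ht
    obtain ⟨δ, hδ, K, hK⟩ := h t ht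
    refine ⟨Metric.ball t δ, mem_nhdsWithin_of_mem_nhds (Metric.ball_mem_nhds t hδ), K, ?_⟩
    rintro τ ⟨h1, h2⟩
    exact hK τ h2 (by rwa [Metric.mem_ball, Real.dist_eq] at h1)

lemma baire_gap (T : ℝ) (A : ℝ → Set ℝ) (g ρ : ℝ → ℝ)
    (hmono : ∀ K K', K ≤ K' → A K ⊆ A K') (hcl : ∀ K, IsClosed (Icc 0 T ∩ A K))
    (hcov : ∀ t ∈ Icc 0 T, ∃ K, t ∈ A K) (hρ : ∀ n, 0 < ρ n)
    (gapR : ∀ n β τ, β ∈ Icc 0 T → τ ∈ Icc 0 T → β < τ → τ - β ≤ ρ n → β ∈ A n →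
      (∀ s ∈ Ioo β τ, ∃ K, Icc s τ ⊆ A K) → τ ∈ A (g n))
    (gapL : ∀ n β τ, β ∈ Icc 0 T → τ ∈ Icc 0 T → τ < β → β - τ ≤ ρ n → β ∈ A n →
      (∀ s ∈ Ioo τ β, ∃ K, Icc τ s ⊆ A K) → τ ∈ A (g n)) :
    ∃ K, Icc 0 T ⊆ A K := by
  set good : Set ℝ := {t | ∃ δ > 0, ∃ K, ∀ τ ∈ Icc 0 T, |τ - t| < δ → τ ∈ A K} with hgood
  have hopen : IsOpen good := by
    rw [Metric.isOpen_iff]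
    rintro t ⟨δ, hδ, K, hK⟩
    refine ⟨δ / 2, by positivity, fun s hs => ⟨δ / 2, by positivity, K, fun τ hτ hd => ?_⟩⟩
    rw [Metric.mem_ball, Real.dist_eq] at hs
    refine hK τ hτ ?_
    calc |τ - t| = |(τ - s) + (s - t)| := by ring_nf
      _ ≤ |τ - s| + |s - t| := abs_add_le _ _
      _ < δ := by linarith
  by_cases hB : Icc 0 T ⊆ good
  · obtain ⟨K, hK⟩ := baire_compact (Z := Icc 0 T) hmono isCompact_Icc hB
    exact ⟨K, by simpa using hK⟩
  exfalso
  set B : Set ℝ := Icc 0 T \ good with hBdef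
  have hBne : B.Nonempty := by
    obtain ⟨b, hb, hb'⟩ := not_subset.1 hB; exact ⟨b, hb, hb'⟩
  have hBcl : IsClosed B := isClosed_Icc.sdiff hopen
  haveI : CompleteSpace B := hBcl.completeSpace_coe
  haveI : Nonempty B := hBne.to_subtype
  obtain ⟨n, hn⟩ := nonempty_interior_of_iUnion_of_closed (X := B)
    (f := fun n : ℕ => {b : B | (b : ℝ) ∈ A n}) (by
      intro n
      have : {b : B | (b : ℝ) ∈ A n} = (Subtype.val) ⁻¹' (Icc 0 T ∩ A n) := by
        ext b; simp only [mem_setOf_eq, mem_preimage, mem_inter_iff]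
        exact ⟨fun h => ⟨b.2.1, h⟩, fun h => h.2⟩
      rw [this]
      exact (hcl n).preimage continuous_subtype_val) (by
      ext b
      simp only [mem_iUnion, mem_setOf_eq, mem_univ, iff_true]
      obtain ⟨K, hK⟩ := hcov b b.2.1
      obtain ⟨n, hn⟩ := exists_nat_ge K
      exact ⟨n, hmono _ _ hn hK⟩)
  obtain ⟨b, hb⟩ := hn
  rw [mem_interior_iff_mem_nhds, Metric.mem_nhds_iff] at hb
  obtain ⟨δ, hδ, hball⟩ := hb
  have hBA : ∀ τ ∈ B, |τ - b| < δ → τ ∈ A n := by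
    intro τ hτ hd
    have : (⟨τ, hτ⟩ : B) ∈ Metric.ball b δ := by
      rw [Metric.mem_ball, Subtype.dist_eq, Real.dist_eq]; exact hd
    exact hball this
  refine b.2.2 ⟨min δ (ρ n), lt_min hδ (hρ n), max n (g n), fun τ hτ hd => ?_⟩
  have hd1 := hd.trans_le (min_le_left _ _)
  have hd2 := hd.trans_le (min_le_right _ _)
  by_cases hτB : τ ∈ B
  · exact hmono _ _ (le_max_left _ _) (hBA τ hτB hd1)
  have hτg : τ ∈ good := by by_contra h; exact hτB ⟨hτ, h⟩
  refine hmono _ _ (le_max_right _ _) ?_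
  rcases lt_trichotomy (b : ℝ) τ with hlt | heq | hgt
  · have hc : IsCompact (B ∩ Icc (b : ℝ) τ) := isCompact_Icc.inter_left hBcl
    obtain ⟨β, ⟨hβB, hβI⟩, hβmax⟩ := hc.exists_isGreatest ⟨b, b.2, le_rfl, hlt.le⟩
    rw [abs_of_pos (by linarith)] at hd1 hd2
    have hβτ : β < τ := lt_of_le_of_ne hβI.2 (by rintro rfl; exact hτB hβB)
    refine gapR n β τ hβB.1 hτ hβτ (by linarith [hβI.1]) (hBA β hβB ?_) ?_
    · rw [abs_of_nonneg (by linarith [hβI.1])]; linarith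
    · intro s hs
      obtain ⟨K, hK⟩ := baire_compact (A := A) (Z := Icc 0 T) hmono (isCompact_Icc (a := s) (b := τ)) (by
        intro t ht
        by_contra hcon
        have : t ∈ B := ⟨⟨by linarith [hβB.1.1, hs.1, ht.1], ht.2.trans hτ.2⟩, hcon⟩
        have := hβmax ⟨this, by linarith [hβI.1, hs.1, ht.1], ht.2⟩
        linarith [hs.1, ht.1])
      refine ⟨K, fun t ht => hK ⟨ht, by linarith [hβB.1.1, hs.1, ht.1], ht.2.trans hτ.2⟩⟩
  · exact absurd (heq ▸ b.2) hτB
  · have hc : IsCompact (B ∩ Icc τ (b : ℝ)) := isCompact_Icc.inter_left hBcl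
    obtain ⟨β, ⟨hβB, hβI⟩, hβmax⟩ := hc.exists_isLeast ⟨b, b.2, hgt.le, le_rfl⟩
    rw [abs_of_neg (by linarith)] at hd1 hd2
    have hβτ : τ < β := lt_of_le_of_ne hβI.1 (by rintro rfl; exact hτB hβB)
    refine gapL n β τ hβB.1 hτ hβτ (by linarith [hβI.2]) (hBA β hβB ?_) ?_
    · rw [abs_of_nonpos (by linarith [hβI.2])]; linarith
    · intro s hs
      obtain ⟨K, hK⟩ := baire_compact (A := A) (Z := Icc 0 T) hmono (isCompact_Icc (a := τ) (b := s)) (by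
        intro t ht
        by_contra hcon
        have : t ∈ B := ⟨⟨hτ.1.trans ht.1, by linarith [hβB.1.2, hs.2, ht.2]⟩, hcon⟩
        have := hβmax ⟨this, ht.1, by linarith [hβI.2, hs.2, ht.2]⟩
        linarith [hs.2, ht.2])
      refine ⟨K, fun t ht => hK ⟨ht, hτ.1.trans ht.1, by linarith [hβB.1.2, hs.2, ht.2]⟩⟩

lemma self_improve (S : Set ℝ) (hS : IsClosed S) (a K : ℝ) (hK : K ∈ S)
    (h : ∀ K ∈ S, a + K / 2 ∈ S) : 2 * a ∈ S := by
  have hit : ∀ n : ℕ, 2 * a + (K - 2 * a) * (1 / 2) ^ n ∈ S := by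
    intro n
    induction n with
    | zero => simpa using hK
    | succ n ih =>
      have := h _ ih
      convert this using 1
      ring
  refine hS.mem_of_tendsto (b := Filter.atTop) (f := fun n : ℕ => 2 * a + (K - 2 * a) * (1 / 2) ^ n) ?_
    (Filter.Eventually.of_forall hit)
  have := ((tendsto_pow_atTop_nhds_zero_of_lt_one (r := (1/2 : ℝ)) (by norm_num)
    (by norm_num)).const_mul (K - 2 * a)).const_add (2 * a)
  simpa using this

lemma char_exists (lam : ℝ → ℝ → ℝ) (s t : ℝ) (t0 x0 Λ K : ℝ) (ht0 : t0 ∈ Icc s t) (hΛ : 0 ≤ Λ) (hK : 0 ≤ K)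
    (hLip : ∀ σ ∈ Icc s t, ∀ x y, |lam σ x - lam σ y| ≤ K * |x - y|)
    (hc : ∀ x, ContinuousOn (fun σ => lam σ x) (Icc s t))
    (hb : ∀ σ ∈ Icc s t, ∀ x, |lam σ x| ≤ Λ) :
    ∃ X : ℝ → ℝ, X t0 = x0 ∧ ∀ σ ∈ Icc s t, HasDerivWithinAt X (lam σ (X σ)) (Icc s t) σ := by
  have hpl : IsPicardLindelof lam (tmin := s) (tmax := t) ⟨t0, ht0⟩ x0
      ⟨Λ * (t - s), mul_nonneg hΛ (by linarith [ht0.1, ht0.2])⟩ 0 ⟨Λ, hΛ⟩ ⟨K, hK⟩ := by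
    constructor
    · intro σ hσ
      refine LipschitzOnWith.of_dist_le_mul fun x _ y _ => ?_
      exact hLip σ hσ x y
    · intro x _; exact hc x
    · intro σ hσ x _; exact hb σ hσ x
    · simp only [NNReal.coe_mk, NNReal.coe_zero, sub_zero]
      exact mul_le_mul_of_nonneg_left (max_le (by linarith [ht0.1]) (by linarith [ht0.2])) hΛ
  exact hpl.exists_eq_forall_mem_Icc_hasDerivWithinAt₀

lemma chain_partial (f ft : ℝ → ℝ → ℝ) (a b : ℝ)
    (hft : ContinuousOn (fun p : ℝ × ℝ => ft p.1 p.2) (Icc a b ×ˢ univ))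
    (hd : ∀ t ∈ Icc a b, ∀ x, HasDerivWithinAt (fun s => f s x) (ft t x) (Icc a b) t)
    (X : ℝ → ℝ) (t v w : ℝ) (ht : t ∈ Icc a b) (hX : HasDerivWithinAt X v (Icc a b) t)
    (hx : HasDerivAt (f t) w (X t)) :
    HasDerivWithinAt (fun τ => f τ (X τ)) (ft t (X t) + w * v) (Icc a b) t := by
  have h1 : HasDerivWithinAt (fun τ => f t (X τ)) (w * v) (Icc a b) t :=
    hx.comp_hasDerivWithinAt t hX
  have h2 : HasDerivWithinAt (fun τ => f τ (X τ) - f t (X τ)) (ft t (X t)) (Icc a b) t := by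
    rw [hasDerivWithinAt_iff_isLittleO, Asymptotics.isLittleO_iff]
    intro c hc
    have hcont := hft (t, X t) ⟨ht, trivial⟩
    rw [Metric.continuousWithinAt_iff] at hcont
    obtain ⟨δ, hδ, hδ'⟩ := hcont c hc
    have hXc := hX.continuousWithinAt
    rw [Metric.continuousWithinAt_iff] at hXc
    obtain ⟨δ2, hδ2, hδ2'⟩ := hXc δ hδ
    have : ∀ᶠ τ in nhdsWithin t (Icc a b), τ ∈ Icc a b ∧ dist τ t < min δ δ2 :=
      Filter.eventually_and.2 ⟨self_mem_nhdsWithin, mem_nhdsWithin_of_mem_nhds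
        (Metric.ball_mem_nhds t (lt_min hδ hδ2))⟩
    filter_upwards [this] with τ hτ
    have hXτ := hδ2' hτ.1 (hτ.2.trans_le (min_le_right _ _))
    have hmv := Convex.norm_image_sub_le_of_norm_hasDerivWithin_le
      (f := fun s => f s (X τ) - ft t (X t) * s) (f' := fun s => ft s (X τ) - ft t (X t))
      (s := uIcc t τ) (C := c) (x := t) (y := τ)
      (fun s hs => by
        have hsI : s ∈ Icc a b := (uIcc_subset_Icc ht hτ.1) hs
        have := (hd s hsI (X τ)).mono (uIcc_subset_Icc ht hτ.1)
        have h4 := ((hasDerivAt_id s).const_mul (ft t (X t))).hasDerivWithinAt (s := uIcc t τ)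
        exact (this.sub h4).congr_deriv (by simp))
      (fun s hs => by
        have hsI : s ∈ Icc a b := (uIcc_subset_Icc ht hτ.1) hs
        have hst : dist s t ≤ dist τ t := by
          rw [Real.dist_eq, Real.dist_eq]; exact abs_sub_left_of_mem_uIcc hs
        refine (hδ' (x := (s, X τ)) ⟨hsI, trivial⟩ ?_).le
        rw [Prod.dist_eq]
        exact max_lt (hst.trans_lt (hτ.2.trans_le (min_le_left _ _))) hXτ)
      (convex_uIcc _ _) left_mem_uIcc right_mem_uIcc
    have e : f τ (X τ) - f t (X τ) - (f t (X t) - f t (X t)) - (τ - t) • ft t (X t) =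
      f τ (X τ) - ft t (X t) * τ - (f t (X τ) - ft t (X t) * t) := by
      simp only [smul_eq_mul]; ring
    rw [e]; exact hmv
  exact (h2.add h1).congr_of_eventuallyEq (Filter.Eventually.of_forall fun τ => by simp) (by simp)

/-- the characteristic speed -/
def lamOf (P : ℝ → ℝ → ℝ) (t x : ℝ) : ℝ := (3 * P t x - P t (-x)) / 4

structure Sol (P Pt : ℝ → ℝ → ℝ) (T : ℝ) : Prop where
  c : ContinuousOn (fun p : ℝ × ℝ => P p.1 p.2) (Icc 0 T ×ˢ univ)
  ct : ContinuousOn (fun p : ℝ × ℝ => Pt p.1 p.2) (Icc 0 T ×ˢ univ)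
  d : ∀ t ∈ Icc 0 T, ∀ x, HasDerivWithinAt (fun s => P s x) (Pt t x) (Icc 0 T) t
  eq : ∀ t ∈ Icc 0 T, ∀ x, HasDerivAt (P t) (deriv (P t) x) x ∧
    Pt t x = - lamOf P t x * deriv (P t) x
  dc : ∀ t ∈ Icc 0 T, Continuous (deriv (P t))
  per : ∀ t ∈ Icc 0 T, ∀ x, P t (x + 2) = P t x
  pert : ∀ t ∈ Icc 0 T, ∀ x, Pt t (x + 2) = Pt t x

lemma per_red {f : ℝ → ℝ} (h : ∀ x, f (x + 2) = f x) (x : ℝ) : ∃ y ∈ Icc (0:ℝ) 2, f x = f y := by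
  have hp : Function.Periodic f 2 := h
  obtain ⟨y, hy, e⟩ := hp.exists_mem_Ico₀ (by norm_num) x
  exact ⟨y, ⟨hy.1, hy.2.le⟩, e⟩

lemma bdd_of_per {f : ℝ → ℝ → ℝ} {T : ℝ}
    (hc : ContinuousOn (fun p : ℝ × ℝ => f p.1 p.2) (Icc 0 T ×ˢ univ))
    (hp : ∀ t ∈ Icc 0 T, ∀ x, f t (x + 2) = f t x) :
    ∃ B, 0 ≤ B ∧ ∀ t ∈ Icc 0 T, ∀ x, |f t x| ≤ B := by
  have hcomp : IsCompact (Icc 0 T ×ˢ Icc (0:ℝ) 2) := isCompact_Icc.prod isCompact_Icc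
  obtain ⟨C, hC⟩ := hcomp.exists_bound_of_continuousOn (f := fun p : ℝ × ℝ => f p.1 p.2)
    (hc.mono (prod_mono_right (subset_univ _)))
  refine ⟨max C 0, le_max_right _ _, fun t ht x => ?_⟩
  obtain ⟨y, hy, e⟩ := per_red (hp t ht) x
  rw [e]
  exact (hC (t, y) ⟨ht, hy⟩).trans (le_max_left _ _)

lemma Sol.rev {P Pt : ℝ → ℝ → ℝ} {T : ℝ} (h : Sol P Pt T) :
    Sol (fun t x => - P (T - t) x) (fun t x => Pt (T - t) x) T := by
  have hmem : ∀ t ∈ Icc 0 T, T - t ∈ Icc 0 T := fun t ht => ⟨by linarith [ht.2], by linarith [ht.1]⟩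
  have hmap : MapsTo (fun p : ℝ × ℝ => (T - p.1, p.2)) (Icc 0 T ×ˢ univ) (Icc 0 T ×ˢ univ) :=
    fun p hp => ⟨hmem _ hp.1, trivial⟩
  have hcm : ContinuousOn (fun p : ℝ × ℝ => (T - p.1, p.2)) (Icc 0 T ×ˢ univ) := by fun_prop
  have hder : ∀ t, deriv (fun x => - P (T - t) x) = fun x => - deriv (P (T - t)) x := by
    intro t; funext x; exact deriv.fun_neg
  constructor
  · exact (h.c.comp hcm hmap).neg
  · exact h.ct.comp hcm hmap
  · intro t ht x
    have h1 := (h.d (T - t) (hmem t ht) x).comp (h := fun s => T - s) (h' := -1) (s := Icc 0 T) t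
      (((hasDerivAt_id t).const_sub T).hasDerivWithinAt) (fun s hs => hmem s hs)
    exact h1.neg.congr_deriv (by simp)
  · intro t ht x
    obtain ⟨h1, h2⟩ := h.eq (T - t) (hmem t ht) x
    rw [hder]
    refine ⟨h1.neg, ?_⟩
    rw [h2]; simp only [lamOf]; ring
  · intro t ht
    rw [hder]; exact (h.dc _ (hmem t ht)).neg
  · intro t ht x; simp only [h.per _ (hmem t ht) x]
  · intro t ht x; simp only [h.pert _ (hmem t ht) x]

lemma Sol.cx {P Pt : ℝ → ℝ → ℝ} {T : ℝ} (h : Sol P Pt T) (x : ℝ) :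
    ContinuousOn (fun s => P s x) (Icc 0 T) := fun t ht => (h.d t ht x).continuousWithinAt

/-- Lipschitz with error -/
def AE (P : ℝ → ℝ → ℝ) (e K t : ℝ) : Prop := ∀ x y, |P t x - P t y| ≤ K * (|x - y| + e)

lemma AE.mono {P : ℝ → ℝ → ℝ} {e K K' t : ℝ} (h : AE P e K t) (he : 0 ≤ e) (hK : K ≤ K') : AE P e K' t :=
  fun x y => (h x y).trans (by gcongr)

lemma AE.lam {P : ℝ → ℝ → ℝ} {e K t : ℝ} (h : AE P e K t) (x y : ℝ) :
    |lamOf P t x - lamOf P t y| ≤ K * (|x - y| + e) := by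
  have h1 := h x y
  have h2 := h (-x) (-y)
  have e1 : |(-x) - (-y)| = |x - y| := by rw [← abs_neg]; ring_nf
  rw [e1] at h2
  rw [abs_le] at h1 h2 ⊢
  unfold lamOf
  constructor <;> linarith [h1.1, h1.2, h2.1, h2.2]

lemma AE_of_DB {P : ℝ → ℝ → ℝ} {K t : ℝ} (h : DB (P t) 1 K) : AE P 0 K t := by
  have key : ∀ x y, x < y → |P t y - P t x| ≤ K * (y - x) := by
    intro x y hxy
    have := h (y - x) (by linarith) x
    simpa [fd_succ, fd_zero] using this
  intro x y
  rw [add_zero]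
  rcases lt_trichotomy x y with hl | rfl | hl
  · rw [abs_sub_comm, abs_sub_comm x, abs_of_pos (sub_pos.2 hl)]; exact key x y hl
  · simp
  · rw [abs_of_pos (sub_pos.2 hl)]; exact key y x hl

lemma DB_of_AE {P : ℝ → ℝ → ℝ} {K t : ℝ} (h : AE P 0 K t) : DB (P t) 1 K := by
  intro ε hε x
  have := h (x + ε) x
  simpa [fd_succ, fd_zero, abs_of_pos hε] using this

lemma Sol.char {P Pt : ℝ → ℝ → ℝ} {T : ℝ} (h : Sol P Pt T) {s t K : ℝ} (hst : Icc s t ⊆ Icc 0 T)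
    (hK : 0 ≤ K) (hL : ∀ σ ∈ Icc s t, AE P 0 K σ) {t0 : ℝ} (ht0 : t0 ∈ Icc s t) (x0 : ℝ) :
    ∃ X : ℝ → ℝ, X t0 = x0 ∧ ∀ σ ∈ Icc s t,
      HasDerivWithinAt X (lamOf P σ (X σ)) (Icc s t) σ := by
  obtain ⟨B, hB0, hB⟩ := bdd_of_per h.c h.per
  refine char_exists (lamOf P) s t t0 x0 B K ht0 hB0 hK ?_ ?_ ?_
  · intro σ hσ x y; simpa using (hL σ hσ).lam x y
  · intro x
    exact (((h.cx x).mono hst).const_mul 3 |>.sub ((h.cx (-x)).mono hst)).div_const 4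
  · intro σ hσ x
    have h1 := abs_le.1 (hB σ (hst hσ) x)
    have h2 := abs_le.1 (hB σ (hst hσ) (-x))
    unfold lamOf
    rw [abs_le]; constructor <;> linarith [h1.1, h1.2, h2.1, h2.2]

/-- estimate along characteristics -/
lemma along (lam f ft fx : ℝ → ℝ → ℝ) (s t : ℝ)
    (hft : ContinuousOn (fun p : ℝ × ℝ => ft p.1 p.2) (Icc s t ×ˢ univ))
    (hd : ∀ σ ∈ Icc s t, ∀ x, HasDerivWithinAt (fun τ => f τ x) (ft σ x) (Icc s t) σ)
    (hx : ∀ σ ∈ Icc s t, ∀ x, HasDerivAt (f σ) (fx σ x) x) (D : ℝ)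
    (hD : ∀ σ ∈ Icc s t, ∀ x, |ft σ x + lam σ x * fx σ x| ≤ D) (X : ℝ → ℝ)
    (hX : ∀ σ ∈ Icc s t, HasDerivWithinAt X (lam σ (X σ)) (Icc s t) σ)
    (a b : ℝ) (ha : a ∈ Icc s t) (hb : b ∈ Icc s t) :
    |f b (X b) - f a (X a)| ≤ D * |b - a| := by
  refine Convex.norm_image_sub_le_of_norm_hasDerivWithin_le
    (f := fun τ => f τ (X τ)) (f' := fun τ => ft τ (X τ) + fx τ (X τ) * lam τ (X τ)) (s := Icc s t)
    (fun σ hσ => chain_partial f ft s t hft hd X σ _ _ hσ (hX σ hσ) (hx σ hσ _))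
    (fun σ hσ => ?_) (convex_Icc _ _) ha hb
  rw [Real.norm_eq_abs, mul_comm]; exact hD σ hσ _

lemma Sol.const {P Pt : ℝ → ℝ → ℝ} {T : ℝ} (h : Sol P Pt T) {s t : ℝ} (hst : Icc s t ⊆ Icc 0 T)
    (X : ℝ → ℝ) (hX : ∀ σ ∈ Icc s t, HasDerivWithinAt X (lamOf P σ (X σ)) (Icc s t) σ)
    (a b : ℝ) (ha : a ∈ Icc s t) (hb : b ∈ Icc s t) : P b (X b) = P a (X a) := by
  have := along (lamOf P) P Pt (fun t => deriv (P t)) s t (h.ct.mono (prod_mono_left hst))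
    (fun σ hσ x => (h.d σ (hst hσ) x).mono hst) (fun σ hσ x => (h.eq σ (hst hσ) x).1) 0
    (fun σ hσ x => by rw [(h.eq σ (hst hσ) x).2]; simp) X hX a b ha hb
  rw [zero_mul] at this
  linarith [abs_nonpos_iff.1 this]

lemma stepA_prop {P Pt : ℝ → ℝ → ℝ} {T : ℝ} (h : Sol P Pt T) {s t K1 K K0 e : ℝ} (hs : 0 ≤ s) (hst : s ≤ t)
    (ht : t ≤ T) (hK1 : 0 ≤ K1) (hL : ∀ σ ∈ Icc s t, AE P 0 K1 σ) (he : 0 ≤ e) (hK : 0 < K)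
    (hK0 : 0 ≤ K0) (hA : ∀ σ ∈ Icc s t, AE P e K σ) (h0 : AE P e K0 s) :
    AE P e (K0 * Real.exp (K * (t - s))) t := by
  intro x y
  have hsub : Icc s t ⊆ Icc 0 T := Icc_subset_Icc hs ht
  obtain ⟨X, hXt, hX⟩ := h.char hsub hK1 hL (right_mem_Icc.2 hst) x
  obtain ⟨Y, hYt, hY⟩ := h.char hsub hK1 hL (right_mem_Icc.2 hst) y
  have hPX := h.const hsub X hX s t (left_mem_Icc.2 hst) (right_mem_Icc.2 hst)
  have hPY := h.const hsub Y hY s t (left_mem_Icc.2 hst) (right_mem_Icc.2 hst)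
  rw [hXt] at hPX; rw [hYt] at hPY
  rw [hPX, hPY]
  have hrev : ∀ σ ∈ Icc s t, s + t - σ ∈ Icc s t := fun σ hσ => ⟨by linarith [hσ.2], by linarith [hσ.1]⟩
  have hder : ∀ σ ∈ Icc s t, HasDerivWithinAt (fun τ => X (s + t - τ) - Y (s + t - τ))
      (-(lamOf P (s + t - σ) (X (s + t - σ)) - lamOf P (s + t - σ) (Y (s + t - σ)))) (Icc s t) σ := by
    intro σ hσ
    have h1 := ((hX _ (hrev σ hσ)).sub (hY _ (hrev σ hσ))).comp (h := fun τ => s + t - τ) (h' := -1)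
      (s := Icc s t) σ (((hasDerivAt_id σ).const_sub (s + t)).hasDerivWithinAt) hrev
    exact h1.congr_deriv (by simp)
  have hg := norm_le_gronwallBound_of_norm_deriv_right_le
    (f := fun τ => X (s + t - τ) - Y (s + t - τ)) (δ := |x - y|) (K := K) (ε := K * e) (a := s) (b := t)
    (fun σ hσ => (hder σ hσ).continuousWithinAt)
    (fun σ hσ => (hder σ ⟨hσ.1, hσ.2.le⟩).mono_of_mem_nhdsWithin (Icc_mem_nhdsGE_of_mem hσ))
    (by simp [hXt, hYt]) (fun σ hσ => by
      rw [norm_neg, Real.norm_eq_abs]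
      refine ((hA _ (hrev σ ⟨hσ.1, hσ.2.le⟩)).lam _ _).trans ?_
      rw [Real.norm_eq_abs]; linarith) t (right_mem_Icc.2 hst)
  rw [gronwallBound_of_K_ne_0 hK.ne', Real.norm_eq_abs, mul_div_cancel_left₀ _ hK.ne'] at hg
  simp only [add_sub_cancel_right] at hg
  refine (h0 _ _).trans ?_
  rw [mul_assoc]
  refine mul_le_mul_of_nonneg_left ?_ hK0
  linarith

lemma stepA_boot {P Pt : ℝ → ℝ → ℝ} {T : ℝ} (h : Sol P Pt T) {s t K1 n e : ℝ} (hs : 0 ≤ s) (hst : s ≤ t)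
    (ht : t ≤ T) (hK1 : 0 ≤ K1) (hL : ∀ σ ∈ Icc s t, AE P 0 K1 σ) (he : 0 ≤ e) (hn : 0 < n)
    (h0 : AE P e n s) (hρ : n * Real.exp ((n + 2) * (t - s)) ≤ n + 1) : AE P e (n + 1) t := by
  set g : ℝ → ℝ := fun σ => n * Real.exp ((n + 2) * (σ - s)) with hg
  have hgle : ∀ σ ∈ Icc s t, g σ ≤ n + 1 := fun σ hσ => by
    refine le_trans ?_ hρ
    simp only [hg]; gcongr; exact hσ.2
  have hgpos : ∀ σ, 0 < g σ := fun σ => by simp only [hg]; positivity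
  have hsub : Icc s t ⊆ Icc 0 T := Icc_subset_Icc hs ht
  have key : Icc s t ⊆ {σ | AE P e (g σ) σ} := by
    refine IsClosed.Icc_subset_of_forall_mem_nhdsWithin ?_ ?_ ?_
    · have : {σ | AE P e (g σ) σ} ∩ Icc s t =
        ⋂ x, ⋂ y, {σ ∈ Icc s t | |P σ x - P σ y| ≤ g σ * (|x - y| + e)} := by
        ext σ
        simp only [mem_inter_iff, mem_setOf_eq, mem_iInter, AE]
        exact ⟨fun hh x y => ⟨hh.2, hh.1 x y⟩, fun hh => ⟨fun x y => (hh x y).2, (hh 0 0).1⟩⟩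
      rw [this]
      refine isClosed_iInter fun x => isClosed_iInter fun y => ?_
      refine isClosed_Icc.isClosed_le ?_ ?_
      · exact (((h.cx x).mono hsub).sub ((h.cx y).mono hsub)).abs
      · simp only [hg]; fun_prop
    · simp only [mem_setOf_eq, hg]; simpa using h0
    · rintro τ ⟨hτ, hτI⟩
      simp only [mem_setOf_eq] at hτ
      set δ := Real.log ((n + 2) / (n + 1)) / (K1 + 1) with hδ
      have hδ0 : 0 < δ := div_pos (Real.log_pos (by rw [lt_div_iff₀ (by linarith)]; linarith)) (by linarith)
      refine Filter.mem_of_superset (Ioo_mem_nhdsGT (lt_min hτI.2 (by linarith : τ < τ + δ))) ?_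
      intro σ hσ
      have hσt : σ < t := hσ.2.trans_le (min_le_left _ _)
      have hσδ : σ < τ + δ := hσ.2.trans_le (min_le_right _ _)
      have hLs : ∀ σ' ∈ Icc τ σ, AE P 0 K1 σ' := fun σ' hσ' =>
        hL σ' ⟨hτI.1.trans hσ'.1, by linarith [hσ'.2]⟩
      have hA1 : ∀ σ' ∈ Icc τ σ, AE P e (K1 + 1) σ' := fun σ' hσ' x y =>
        (hLs σ' hσ' x y).trans (by
          have := abs_nonneg (x - y)
          nlinarith)
      have hA2 : ∀ σ' ∈ Icc τ σ, AE P e (n + 2) σ' := by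
        intro σ' hσ'
        have := stepA_prop h (s := τ) (t := σ') (K1 := K1) (K := K1 + 1) (e := e)
          (by linarith [hτI.1]) hσ'.1 (by linarith [hσ'.2]) hK1
          (fun z hz => hLs z ⟨hz.1, hz.2.trans hσ'.2⟩) he (by linarith) (hgpos τ).le
          (fun z hz => hA1 z ⟨hz.1, hz.2.trans hσ'.2⟩) hτ
        refine this.mono he ?_
        have h1 : Real.exp ((K1 + 1) * (σ' - τ)) ≤ (n + 2) / (n + 1) := by
          rw [← Real.le_log_iff_exp_le (by positivity), mul_comm, ← le_div_iff₀ (by linarith)]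
          linarith [hσ'.2]
        calc g τ * Real.exp ((K1 + 1) * (σ' - τ)) ≤ (n + 1) * ((n + 2) / (n + 1)) := by
              apply mul_le_mul (hgle τ ⟨hτI.1, hτI.2.le⟩) h1 (Real.exp_pos _).le (by linarith)
          _ = n + 2 := by field_simp
      have := stepA_prop h (s := τ) (t := σ) (K1 := K1) (K := n + 2) (e := e)
          (by linarith [hτI.1]) hσ.1.le (by linarith) hK1 hLs he (by linarith) (hgpos τ).le hA2 hτ
      have e1 : g τ * Real.exp ((n + 2) * (σ - τ)) = g σ := by
        simp only [hg]; rw [mul_assoc, ← Real.exp_add]; ring_nf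
      rw [e1] at this
      exact this
  exact (key (right_mem_Icc.2 hst)).mono he hρ

lemma stepA_gap {P Pt : ℝ → ℝ → ℝ} {T : ℝ} (h : Sol P Pt T) {n β τ : ℝ} (hn : 0 < n)
    (hβ : 0 ≤ β) (hτ : τ ≤ T) (hlt : β < τ) (hρ : n * Real.exp ((n + 2) * (τ - β)) ≤ n + 1)
    (h0 : AE P 0 n β) (hs : ∀ s ∈ Ioo β τ, ∃ K, ∀ σ ∈ Icc s τ, AE P 0 K σ) : AE P 0 (n + 1) τ := by
  obtain ⟨B, hB0, hB⟩ := bdd_of_per h.ct h.pert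
  have key : ∀ s ∈ Ioo β τ, AE P (2 * B * (s - β) / n) (n + 1) τ := by
    intro s hsI
    obtain ⟨K, hK⟩ := hs s hsI
    have he : 0 ≤ 2 * B * (s - β) / n := by
      have : 0 ≤ s - β := by linarith [hsI.1]
      positivity
    refine stepA_boot h (K1 := max K 0) (by linarith [hsI.1]) hsI.2.le hτ (le_max_right _ _)
      (fun σ hσ => (hK σ hσ).mono le_rfl (le_max_left _ _)) he hn ?_ ?_
    · intro x y
      have hlip : ∀ z, |P s z - P β z| ≤ B * (s - β) := by
        intro z
        have := Convex.norm_image_sub_le_of_norm_hasDerivWithin_le (f := fun σ => P σ z) (f' := fun σ => Pt σ z)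
          (s := Icc 0 T) (fun σ hσ => h.d σ hσ z) (fun σ hσ => hB σ hσ z) (convex_Icc _ _)
          (⟨hβ, by linarith⟩ : β ∈ Icc 0 T) (⟨by linarith [hsI.1], by linarith [hsI.2]⟩ : s ∈ Icc 0 T)
        simpa [abs_of_pos (sub_pos.2 hsI.1)] using this
      have h1 := hlip x
      have h2 := hlip y
      have h3 := h0 x y
      have e1 : n * (|x - y| + 2 * B * (s - β) / n) = n * |x - y| + 2 * (B * (s - β)) := by
        field_simp
      rw [e1]
      rw [add_zero] at h3
      rw [abs_le] at h1 h2 h3 ⊢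
      constructor <;> linarith [h1.1, h1.2, h2.1, h2.2, h3.1, h3.2]
    · refine le_trans ?_ hρ
      have := hsI.1
      gcongr
  intro x y
  have ht : Filter.Tendsto (fun s => (n + 1) * (|x - y| + 2 * B * (s - β) / n)) (nhdsWithin β (Ioi β))
      (nhds ((n + 1) * (|x - y| + 2 * B * (β - β) / n))) := by
    apply Filter.Tendsto.mono_left _ nhdsWithin_le_nhds
    apply Continuous.tendsto
    fun_prop
  rw [sub_self, mul_zero, zero_div] at ht
  refine ge_of_tendsto ht ?_
  filter_upwards [Ioo_mem_nhdsGT hlt] with s hsI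
  exact key s hsI x y

lemma deriv_per {f : ℝ → ℝ} (h : ∀ x, f (x + 2) = f x) (x : ℝ) : deriv f (x + 2) = deriv f x := by
  rw [← deriv_comp_add_const f 2 x]
  congr 1; funext y; exact h y

lemma stepA {P Pt : ℝ → ℝ → ℝ} {T : ℝ} (h : Sol P Pt T) :
    ∃ K, 0 ≤ K ∧ ∀ t ∈ Icc 0 T, DB (P t) 1 K := by
  set q : ℝ → ℝ := fun n => max n 1 with hq
  have hq0 : ∀ n, 0 < q n := fun n => lt_max_of_lt_right one_pos
  have hex : ∀ n d : ℝ, d ≤ Real.log ((q n + 1) / q n) / (q n + 2) →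
      q n * Real.exp ((q n + 2) * d) ≤ q n + 1 := by
    intro n d hd
    have := hq0 n
    rw [le_div_iff₀ (by linarith), mul_comm, Real.le_log_iff_exp_le (by positivity)] at hd
    rwa [← le_div_iff₀' this]
  have hrev := h.rev
  obtain ⟨K, hK⟩ := baire_gap T (fun K => {t | AE P 0 K t}) (fun n => q n + 1)
    (fun n => Real.log ((q n + 1) / q n) / (q n + 2)) (fun K K' hK t ht => AE.mono ht le_rfl hK)
    (by
      intro K
      have : Icc 0 T ∩ {σ | AE P 0 K σ} =
        ⋂ x, ⋂ y, {σ ∈ Icc 0 T | |P σ x - P σ y| ≤ K * (|x - y| + 0)} := by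
        ext σ
        simp only [mem_inter_iff, mem_setOf_eq, mem_iInter, AE]
        exact ⟨fun hh x y => ⟨hh.1, hh.2 x y⟩, fun hh => ⟨(hh 0 0).1, fun x y => (hh x y).2⟩⟩
      rw [this]
      refine isClosed_iInter fun x => isClosed_iInter fun y => ?_
      exact isClosed_Icc.isClosed_le ((h.cx x).sub (h.cx y)).abs continuousOn_const)
    (by
      intro t ht
      obtain ⟨C, hC⟩ := (isCompact_Icc (a := (0:ℝ)) (b := 2)).exists_bound_of_continuousOn
        (h.dc t ht).continuousOn
      refine ⟨C, fun x y => ?_⟩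
      rw [add_zero]
      exact Convex.norm_image_sub_le_of_norm_hasDerivWithin_le (f := P t) (f' := deriv (P t)) (s := univ)
        (fun z _ => (h.eq t ht z).1.hasDerivWithinAt) (fun z _ => by
          obtain ⟨w, hw, e⟩ := per_red (deriv_per (h.per t ht)) z
          rw [e]; exact hC w hw) convex_univ trivial trivial)
    (fun n => div_pos (Real.log_pos (by rw [lt_div_iff₀ (hq0 n)]; linarith)) (by linarith [hq0 n]))
    (by
      intro n β τ hβ hτ hlt hd hA hs
      exact stepA_gap h (hq0 n) hβ.1 hτ.2 hlt (hex n _ hd) (AE.mono hA le_rfl (le_max_left _ _)) hs)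
    (by
      intro n β τ hβ hτ hlt hd hA hs
      have hAE : ∀ σ K, AE (fun t x => - P (T - t) x) 0 K (T - σ) ↔ AE P 0 K σ := by
        intro σ K
        simp only [AE]
        refine forall_congr' fun x => forall_congr' fun y => ?_
        rw [sub_sub_cancel, ← abs_neg]; ring_nf
      have := stepA_gap hrev (β := T - β) (τ := T - τ) (hq0 n) (by linarith [hβ.2]) (by linarith [hτ.1])
        (by linarith) (hex n _ (by linarith)) ((hAE _ _).2 (AE.mono hA le_rfl (le_max_left _ _))) (by
          intro s hsI
          obtain ⟨K, hK⟩ := hs (T - s) ⟨by linarith [hsI.2], by linarith [hsI.1]⟩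
          refine ⟨K, fun σ hσ => ?_⟩
          have := hK (⟨by linarith [hσ.2], by linarith [hσ.1]⟩ : T - σ ∈ Icc τ (T - s))
          have := (hAE (T - σ) K).2 this
          rwa [sub_sub_cancel] at this)
      exact (hAE _ _).1 this)
  exact ⟨max K 0, le_max_right _ _, fun t ht => (DB_of_AE (hK ht)).mono (le_max_left _ _)⟩

lemma off_countable_le {f f' : ℝ → ℝ} {a b K : ℝ} (hab : a ≤ b) {s : Set ℝ} (hs : s.Countable)
    (hc : ContinuousOn f (Icc a b)) (hd : ∀ x ∈ Ioo a b \ s, HasDerivAt f (f' x) x)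
    (hK : ∀ x ∈ Ioo a b \ s, |f' x| ≤ K) (hK0 : 0 ≤ K) : |f b - f a| ≤ K * (b - a) := by
  set g : ℝ → ℝ := fun x => (Ioo a b \ s).indicator (deriv f) x with hg
  have hm : Measurable g := (measurable_deriv f).indicator (measurableSet_Ioo.diff hs.measurableSet)
  have hb : ∀ x, ‖g x‖ ≤ K := by
    intro x
    simp only [hg, indicator]
    split_ifs with hx
    · rw [(hd x hx).deriv]; exact hK x hx
    · simpa using hK0
  have hinteg : IntervalIntegrable g MeasureTheory.volume a b :=
    (intervalIntegrable_const (c := K)).mono_fun hm.aestronglyMeasurable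
      (Filter.Eventually.of_forall fun x => by
        rw [Real.norm_of_nonneg hK0]; exact hb x)
  have := MeasureTheory.integral_eq_of_hasDerivAt_off_countable_of_le f g hab hs hc
    (fun x hx => by
      have := hd x hx
      simp only [hg, indicator_of_mem hx]; exact this.differentiableAt.hasDerivAt) hinteg
  rw [← this, ← abs_of_nonneg (sub_nonneg.2 hab)]
  exact intervalIntegral.norm_integral_le_of_norm_le_const fun x _ => hb x

lemma lip_off_countable {f f' : ℝ → ℝ} {K : ℝ} {s : Set ℝ} (hs : s.Countable)
    (hc : Continuous f) (hd : ∀ x ∉ s, HasDerivAt f (f' x) x)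
    (hK : ∀ x ∉ s, |f' x| ≤ K) (hK0 : 0 ≤ K) (x y : ℝ) : |f x - f y| ≤ K * |x - y| := by
  rcases le_total x y with h | h
  · rw [abs_sub_comm, abs_sub_comm x, abs_of_nonneg (sub_nonneg.2 h)]
    exact off_countable_le h hs hc.continuousOn (fun z hz => hd z hz.2) (fun z hz => hK z hz.2) hK0
  · rw [abs_of_nonneg (sub_nonneg.2 h)]
    exact off_countable_le h hs hc.continuousOn (fun z hz => hd z hz.2) (fun z hz => hK z hz.2) hK0

lemma idw_hasDeriv {f : ℝ → ℝ} {α β : ℝ} (hab : α < β) {n i : ℕ} (hf : ContDiffOn ℝ n f (Icc α β))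
    (hi : i < n) {x : ℝ} (hx : x ∈ Icc α β) :
    HasDerivWithinAt (iteratedDerivWithin i f (Icc α β))
      (iteratedDerivWithin (i+1) f (Icc α β) x) (Icc α β) x := by
  have h := hf.differentiableOn_iteratedDerivWithin (m := i) (by exact_mod_cast hi)
    (uniqueDiffOn_Icc hab) x hx
  rw [iteratedDerivWithin_succ]
  exact h.hasDerivWithinAt

lemma fd_unif {f : ℝ → ℝ} {α β : ℝ} (hab : α < β) {n : ℕ} (hf : ContDiffOn ℝ n f (Icc α β))
    {δ : ℝ} (hδ : 0 < δ) : ∃ ρ > 0, (∀ x ∈ Icc α β, ∀ y ∈ Icc α β, |x - y| < ρ →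
      |iteratedDerivWithin n f (Icc α β) x - iteratedDerivWithin n f (Icc α β) y| ≤ δ) ∧
      ∀ ε > 0, n * ε < ρ → ∀ x, α ≤ x → x + n * ε ≤ β →
      |fd ε n f x - iteratedDerivWithin n f (Icc α β) x * ε ^ n| ≤ δ * ε ^ n := by
  have hc := hf.continuousOn_iteratedDerivWithin (m := n) le_rfl (uniqueDiffOn_Icc hab)
  have hu := isCompact_Icc.uniformContinuousOn_of_continuous hc
  rw [Metric.uniformContinuousOn_iff] at hu
  obtain ⟨ρ, hρ, hu⟩ := hu δ hδ
  refine ⟨ρ, hρ, fun x hx y hy hxy => (hu x hx y hy hxy).le, fun ε hε hn x h1 h2 => ?_⟩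
  have hnε : (0:ℝ) ≤ n * ε := by positivity
  have := fd_local n (fun i => iteratedDerivWithin i f (Icc α β)) x (x + n * ε)
    (fun i hi z hz => (idw_hasDeriv hab hf hi (⟨h1.trans hz.1, hz.2.trans h2⟩)).mono
      (Icc_subset_Icc h1 h2)) (iteratedDerivWithin n f (Icc α β) x) δ (fun z hz => by
        refine (hu z ⟨h1.trans hz.1, hz.2.trans h2⟩ x ⟨h1, by linarith⟩ ?_).le
        rw [Real.dist_eq, abs_of_nonneg (by linarith [hz.1])]; linarith [hz.2]) ε hε x le_rfl le_rfl
  simpa using this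

/-- pointwise derivative bound from difference bound -/
lemma idw_le_of_DB {f : ℝ → ℝ} {α β : ℝ} (hab : α < β) {n : ℕ} (hf : ContDiffOn ℝ n f (Icc α β))
    {K : ℝ} (hK : DB f n K) {x : ℝ} (hx : x ∈ Ico α β) :
    |iteratedDerivWithin n f (Icc α β) x| ≤ K := by
  refine le_of_forall_pos_le_add fun δ hδ => ?_
  obtain ⟨ρ, hρ, -, h⟩ := fd_unif hab hf hδ
  set ε := min (ρ / (n + 1)) ((β - x) / (n + 1)) with hε
  have hx2 := sub_pos.2 hx.2
  have hε0 : 0 < ε := lt_min (by positivity) (by positivity)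
  have h1 : (n + 1) * ε ≤ ρ := by
    have := min_le_left (ρ / (n + 1)) ((β - x) / (n + 1))
    rw [← hε, le_div_iff₀ (by positivity)] at this; linarith
  have h2 : (n + 1) * ε ≤ β - x := by
    have := min_le_right (ρ / (n + 1)) ((β - x) / (n + 1))
    rw [← hε, le_div_iff₀ (by positivity)] at this; linarith
  have h3 := h ε hε0 (by linarith) x hx.1 (by linarith)
  have h4 := hK ε hε0 x
  have hp : 0 < ε ^ n := by positivity
  have h5 : |iteratedDerivWithin n f (Icc α β) x * ε ^ n| ≤ (K + δ) * ε ^ n := by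
    rw [abs_le] at h3 h4 ⊢
    constructor <;> linarith [h3.1, h3.2, h4.1, h4.2]
  rw [abs_mul, abs_of_pos hp] at h5
  exact le_of_mul_le_mul_right h5 hp

def Pc (f : ℝ → ℝ) (n : ℕ) : Prop := ∀ j : ℤ, ContDiffOn ℝ n f (Icc (j:ℝ) (j+1))

lemma Pc.of_le {f : ℝ → ℝ} {n m : ℕ} (h : Pc f n) (hm : m ≤ n) : Pc f m :=
  fun j => (h j).of_le (by exact_mod_cast hm)

lemma not_int {x : ℝ} (hx : x ∉ range ((↑) : ℤ → ℝ)) : x ∈ Ioo (⌊x⌋ : ℝ) (⌊x⌋ + 1) := by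
  refine ⟨lt_of_le_of_ne (Int.floor_le x) fun h => hx ⟨_, h⟩, Int.lt_floor_add_one x⟩

lemma Pc.at {f : ℝ → ℝ} {n : ℕ} (h : Pc f n) {j : ℤ} {x : ℝ} (hx : x ∈ Ioo (j:ℝ) (j+1)) :
    ContDiffAt ℝ n f x := (h j).contDiffAt (Icc_mem_nhds hx.1 hx.2)

lemma Pc.idw {f : ℝ → ℝ} {n : ℕ} (h : Pc f n) {j : ℤ} {x : ℝ} (hx : x ∈ Ioo (j:ℝ) (j+1)) :
    iteratedDeriv n f x = iteratedDerivWithin n f (Icc (j:ℝ) (j+1)) x :=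
  (iteratedDerivWithin_eq_iteratedDeriv (uniqueDiffOn_Icc (by linarith [hx.1, hx.2])) (h.at hx)
    ⟨hx.1.le, hx.2.le⟩).symm

lemma Pc.hd {f : ℝ → ℝ} {n : ℕ} (h : Pc f (n+1)) {x : ℝ} (hx : x ∉ range ((↑) : ℤ → ℝ)) :
    HasDerivAt (iteratedDeriv n f) (iteratedDeriv (n+1) f x) x := by
  have hx' := not_int hx
  have h1 := idw_hasDeriv (by linarith) (h ⌊x⌋) (Nat.lt_succ_self n) (⟨hx'.1.le, hx'.2.le⟩)
  have h2 := h1.hasDerivAt (Icc_mem_nhds hx'.1 hx'.2)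
  rw [h.idw hx']
  refine h2.congr_of_eventuallyEq ?_
  filter_upwards [Ioo_mem_nhds hx'.1 hx'.2] with y hy
  exact (h.of_le (Nat.le_succ n)).idw hy

lemma lip_of_bound {f : ℝ → ℝ} {n : ℕ} (h1 : ContDiff ℝ n f) (h2 : Pc f (n+1)) {K : ℝ} (hK0 : 0 ≤ K)
    (hK : ∀ x ∉ range ((↑) : ℤ → ℝ), |iteratedDeriv (n+1) f x| ≤ K) (x y : ℝ) :
    |iteratedDeriv n f x - iteratedDeriv n f y| ≤ K * |x - y| :=
  lip_off_countable (countable_range _) (h1.continuous_iteratedDeriv' n) (fun _ hx => h2.hd hx) hK hK0 x y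

lemma DB_of_lip {f : ℝ → ℝ} {n : ℕ} (h1 : ContDiff ℝ n f) {K : ℝ}
    (hL : ∀ x y, |iteratedDeriv n f x - iteratedDeriv n f y| ≤ K * |x - y|) :
    ∀ i ≤ n, DB (iteratedDeriv (n - i) f) (i + 1) K := by
  intro i
  induction i with
  | zero =>
    intro _ ε hε x
    have := hL (x + ε) x
    simpa [fd_succ, fd_zero, abs_of_pos hε] using this
  | succ i ih =>
    intro hi
    have h := ih (by omega)
    refine DB.climb (f' := iteratedDeriv (n - i) f) (fun x => ?_) h
    have e : n - i = (n - (i+1)) + 1 := by omega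
    rw [e, iteratedDeriv_succ]
    exact (h1.differentiable_iteratedDeriv (n - (i+1))
      (by exact_mod_cast (by omega : n - (i+1) < n)) x).hasDerivAt

lemma DB.nonneg {f : ℝ → ℝ} {n : ℕ} {K : ℝ} (h : DB f n K) : 0 ≤ K := by
  have := h 1 one_pos 0
  simp only [one_pow, mul_one] at this
  exact (abs_nonneg _).trans this

lemma deriv_DB {f : ℝ → ℝ} {n : ℕ} (h0 : ContDiff ℝ 1 f) (h1 : ContDiff ℝ n f) (h2 : Pc f (n+1)) {K : ℝ}
    (hK : DB f (n+1) K) : DB (deriv f) n K := by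
  have hL := lip_of_bound h1 h2 hK.nonneg (fun x hx => by
    have hx' := not_int hx
    rw [h2.idw hx']
    exact idw_le_of_DB (by linarith) (h2 _) hK ⟨hx'.1.le, hx'.2⟩)
  rcases n with _ | n
  · intro ε hε x
    simp only [fd_zero, pow_zero, mul_one]
    have := norm_deriv_le_of_lip' (f := f) (x₀ := x) (C := K) hK.nonneg
      (Filter.Eventually.of_forall fun y => by simpa using hL y x)
    simpa using this
  · have := DB_of_lip h1 hL n (by omega)
    rwa [show n + 1 - n = 1 by omega, iteratedDeriv_one] at this

lemma exists_DB {f : ℝ → ℝ} {n : ℕ} (h1 : ContDiff ℝ n f) (h2 : Pc f (n+1))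
    (hp : ∀ x, f (x + 2) = f x) : ∃ K, DB f (n+1) K := by
  have hb : ∀ j : ℤ, ∃ C, ∀ x ∈ Ioo (j:ℝ) (j+1), |iteratedDeriv (n+1) f x| ≤ C := by
    intro j
    have hc := (h2 j).continuousOn_iteratedDerivWithin (m := n+1) le_rfl (uniqueDiffOn_Icc (by linarith))
    obtain ⟨C, hC⟩ := isCompact_Icc.exists_bound_of_continuousOn hc
    exact ⟨C, fun x hx => by rw [h2.idw hx]; exact hC x ⟨hx.1.le, hx.2.le⟩⟩
  obtain ⟨C0, hC0⟩ := hb 0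
  obtain ⟨C1, hC1⟩ := hb 1
  simp only [Int.cast_zero, Int.cast_one, zero_add] at hC0 hC1
  set K := max (max (max C0 C1) (max |iteratedDeriv (n+1) f 0| |iteratedDeriv (n+1) f 1|))
    (max 0 |iteratedDeriv (n+1) f 2|) with hK
  have hall : ∀ x, |iteratedDeriv (n+1) f x| ≤ K := by
    intro x
    have hper : ∀ x, iteratedDeriv (n+1) f (x + 2) = iteratedDeriv (n+1) f x := by
      intro x
      have : iteratedDeriv (n+1) (fun z => f (z + 2)) = fun t => iteratedDeriv (n+1) f (t + 2) :=
        iteratedDeriv_comp_add_const ..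
      rw [show (fun z => f (z + 2)) = f from funext hp] at this
      exact (congrFun this x).symm
    obtain ⟨y, hy, e⟩ := per_red hper x
    rw [e]
    rcases eq_or_lt_of_le hy.1 with h | h
    · rw [← h]; simp [hK]
    rcases lt_trichotomy y 1 with h' | h' | h'
    · exact (hC0 y ⟨h, h'⟩).trans (by simp [hK])
    · rw [h']; simp [hK]
    rcases eq_or_lt_of_le hy.2 with h3 | h3
    · rw [h3]; simp [hK]
    · exact (hC1 y ⟨h', by linarith⟩).trans (by simp [hK])
  have hL := lip_of_bound h1 h2 (K := K) (by simp [hK]) (fun x _ => hall x)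
  have := DB_of_lip h1 hL n le_rfl
  rw [Nat.sub_self, iteratedDeriv_zero] at this
  exact ⟨K, this⟩

/-- gluing -/
lemma glue {f : ℝ → ℝ} {n : ℕ} (h1 : ContDiff ℝ n f) (h2 : Pc f (n+1))
    (hm : ∀ j : ℤ, iteratedDerivWithin (n+1) f (Icc (j:ℝ) (j+1)) (j+1) =
      iteratedDerivWithin (n+1) f (Icc ((j:ℝ)+1) (j+1+1)) (j+1)) : ContDiff ℝ (n+1 : ℕ) f := by
  set G : ℝ → ℝ := fun x => iteratedDerivWithin (n+1) f (Icc (⌊x⌋:ℝ) (⌊x⌋+1)) x with hG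
  have hGj : ∀ j : ℤ, ∀ x ∈ Icc (j:ℝ) (j+1), G x = iteratedDerivWithin (n+1) f (Icc (j:ℝ) (j+1)) x := by
    intro j x hx
    rcases eq_or_lt_of_le hx.2 with h | h
    · have hfl : ⌊x⌋ = j + 1 := by rw [h]; exact_mod_cast Int.floor_intCast (j+1)
      simp only [hG, hfl]; push_cast
      rw [h, hm]
    · have hfl : ⌊x⌋ = j := Int.floor_eq_iff.2 ⟨hx.1, h⟩
      simp only [hG, hfl]
  have hgj : ∀ j : ℤ, ∀ x ∈ Icc (j:ℝ) (j+1),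
      HasDerivWithinAt (iteratedDeriv n f) (G x) (Icc (j:ℝ) (j+1)) x := by
    intro j x hx
    rw [hGj j x hx]
    refine (idw_hasDeriv (by linarith) (h2 j) (Nat.lt_succ_self n) hx).congr (fun y hy => ?_) ?_
    · exact (iteratedDerivWithin_eq_iteratedDeriv (uniqueDiffOn_Icc (by linarith)) h1.contDiffAt hy).symm
    · exact (iteratedDerivWithin_eq_iteratedDeriv (uniqueDiffOn_Icc (by linarith)) h1.contDiffAt hx).symm
  have hGc : ∀ j : ℤ, ContinuousOn G (Icc (j:ℝ) (j+1)) := fun j =>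
    ((h2 j).continuousOn_iteratedDerivWithin (m := n+1) le_rfl (uniqueDiffOn_Icc (by linarith))).congr
      (hGj j)
  have hboth : ∀ x, HasDerivAt (iteratedDeriv n f) (G x) x ∧ ContinuousAt G x := by
    intro x
    by_cases hx : x ∈ range ((↑) : ℤ → ℝ)
    · obtain ⟨j, rfl⟩ := hx
      have e1 : ((j - 1 : ℤ) : ℝ) = (j:ℝ) - 1 := by push_cast; ring
      have ha := hgj (j-1) j (by rw [e1]; constructor <;> linarith)
      have hb := hgj j j (by constructor <;> linarith)
      have hca := hGc (j-1) j (by rw [e1]; constructor <;> linarith)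
      have hcb := hGc j j (by constructor <;> linarith)
      have hn : Icc ((j - 1 : ℤ) : ℝ) ((j - 1 : ℤ) + 1) ∪ Icc (j:ℝ) (j+1) ∈ nhds (j:ℝ) := by
        refine Filter.mem_of_superset (Icc_mem_nhds (a := (j:ℝ) - 1) (b := j + 1) (by linarith) (by linarith)) ?_
        intro y hy
        rw [e1]
        rcases le_total y j with h | h
        · exact Or.inl ⟨hy.1, by linarith⟩
        · exact Or.inr ⟨h, hy.2⟩
      exact ⟨(ha.union hb).hasDerivAt hn, (hca.union hcb).continuousAt hn⟩
    · have hx' := not_int hx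
      have hn := Icc_mem_nhds hx'.1 hx'.2
      exact ⟨(hgj _ x ⟨hx'.1.le, hx'.2.le⟩).hasDerivAt hn, (hGc _ x ⟨hx'.1.le, hx'.2.le⟩).continuousAt hn⟩
  rw [contDiff_nat_succ_iff_contDiff_one_iteratedDeriv]
  refine ⟨h1, contDiff_one_iff_deriv.2 ⟨fun x => (hboth x).1.differentiableAt, ?_⟩⟩
  have : deriv (iteratedDeriv n f) = G := funext fun x => (hboth x).1.deriv
  rw [this]
  exact continuous_iff_continuousAt.2 fun x => (hboth x).2

/-- linear propagation -/
lemma lin_gap (T C : ℝ) (hC : 0 < C) (A : ℝ → Set ℝ)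
    (hcl : ∀ K, IsClosed (Icc 0 T ∩ A K))
    (hclK : ∀ t, IsClosed {K | t ∈ A K}) (hneg : ∀ K, ∀ t ∈ A K, 0 ≤ K)
    (hmono : ∀ K K', K ≤ K' → A K ⊆ A K')
    (hcov : ∀ t ∈ Icc 0 T, ∃ K, t ∈ A K)
    (prop : ∀ s t K K0, Icc s t ⊆ Icc 0 T → Icc s t ⊆ A K → ∀ a ∈ Icc s t, ∀ b ∈ Icc s t,
      a ∈ A K0 → b ∈ A (K0 + C * (1 + K) * |b - a|))
    (n β τ : ℝ) (hβ : β ∈ Icc 0 T) (hτ : τ ∈ Icc 0 T) (hlt : β < τ) (hρ : τ - β ≤ 1 / (2 * C))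
    (h0 : β ∈ A n) (hs : ∀ s ∈ Ioo β τ, ∃ K, Icc s τ ⊆ A K) : τ ∈ A (2 * (n + 1 / 2)) := by
  have hclS : ∀ a b, IsClosed {K | Icc a b ⊆ A K} := by
    intro a b
    have : {K | Icc a b ⊆ A K} = ⋂ t ∈ Icc a b, {K | t ∈ A K} := by
      ext K; simp [subset_def]
    rw [this]
    exact isClosed_biInter fun t _ => hclK t
  have hlen : ∀ d : ℝ, d ≤ τ - β → ∀ K, 0 ≤ K → C * (1 + K) * d ≤ 1 / 2 + K / 2 := by
    intro d hd K hK
    have h1 : C * d ≤ 1 / 2 := by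
      have : d ≤ 1 / (2 * C) := hd.trans hρ
      rw [le_div_iff₀ (by positivity)] at this; linarith
    nlinarith
  obtain ⟨Kτ, hKτ⟩ := hcov τ hτ
  have h1 : ∀ s ∈ Ioo β τ, Icc s τ ⊆ A (2 * (Kτ + 1 / 2)) := by
    intro s hsI
    obtain ⟨K, hK⟩ := hs s hsI
    refine self_improve {K | Icc s τ ⊆ A K} (hclS _ _) (Kτ + 1/2) K hK ?_
    intro K hK b hb
    have := prop s τ K Kτ (Icc_subset_Icc (by linarith [hβ.1, hsI.1]) hτ.2) hK τ (right_mem_Icc.2 hsI.2.le) b hb hKτ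
    refine hmono _ _ ?_ this
    have := hlen |b - τ| (by rw [abs_of_nonpos (by linarith [hb.2])]; linarith [hb.1, hsI.1]) K (hneg K b (hK hb))
    linarith
  have h2 : Icc β τ ⊆ A (max n (2 * (Kτ + 1 / 2))) := by
    intro z hz
    rcases eq_or_lt_of_le hz.1 with h | h
    · rw [← h]; exact hmono _ _ (le_max_left _ _) h0
    · exact hmono _ _ (le_max_right _ _) (h1 ((β + z) / 2) ⟨by linarith, by linarith [hz.2]⟩ ⟨by linarith, hz.2⟩)
  have h3 := self_improve {K | Icc β τ ⊆ A K} (hclS _ _) (n + 1/2) _ h2 (by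
    intro K hK b hb
    have := prop β τ K n (Icc_subset_Icc hβ.1 hτ.2) hK β (left_mem_Icc.2 hlt.le) b hb h0
    refine hmono _ _ ?_ this
    have := hlen |b - β| (by rw [abs_of_nonneg (by linarith [hb.1])]; linarith [hb.2]) K (hneg K b (hK hb))
    linarith)
  exact h3 (right_mem_Icc.2 hlt.le)

lemma lin_baire (T C : ℝ) (hC : 0 < C) (A : ℝ → Set ℝ)
    (hcl : ∀ K, IsClosed (Icc 0 T ∩ A K))
    (hclK : ∀ t, IsClosed {K | t ∈ A K}) (hneg : ∀ K, ∀ t ∈ A K, 0 ≤ K)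
    (hmono : ∀ K K', K ≤ K' → A K ⊆ A K')
    (hcov : ∀ t ∈ Icc 0 T, ∃ K, t ∈ A K)
    (prop : ∀ s t K K0, Icc s t ⊆ Icc 0 T → Icc s t ⊆ A K → ∀ a ∈ Icc s t, ∀ b ∈ Icc s t,
      a ∈ A K0 → b ∈ A (K0 + C * (1 + K) * |b - a|)) : ∃ K, Icc 0 T ⊆ A K := by
  refine baire_gap T A (fun n => 2 * (n + 1/2)) (fun _ => 1 / (2 * C)) hmono hcl hcov
    (fun _ => by positivity) ?_ ?_
  · intro n β τ hβ hτ hlt hρ h0 hs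
    exact lin_gap T C hC A hcl hclK hneg hmono hcov prop n β τ hβ hτ hlt hρ h0 hs
  · intro n β τ hβ hτ hlt hρ h0 hs
    have hmem : ∀ t ∈ Icc 0 T, T - t ∈ Icc 0 T := fun t ht => ⟨by linarith [ht.2], by linarith [ht.1]⟩
    have := lin_gap T C hC (fun K => {t | T - t ∈ A K}) (by
      intro K
      have : Icc 0 T ∩ {t | T - t ∈ A K} = (fun t => T - t) ⁻¹' (Icc 0 T ∩ A K) := by
        ext t
        simp only [mem_inter_iff, mem_setOf_eq, mem_preimage, mem_Icc]
        constructor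
        · rintro ⟨h1, h2⟩; exact ⟨⟨by linarith [h1.2], by linarith [h1.1]⟩, h2⟩
        · rintro ⟨h1, h2⟩; exact ⟨⟨by linarith [h1.2], by linarith [h1.1]⟩, h2⟩
      rw [this]
      exact (hcl K).preimage (by fun_prop)) (fun t => hclK (T - t)) (fun K t ht => hneg K _ ht)
      (fun K K' h t ht => hmono K K' h ht) (fun t ht => hcov _ (hmem t ht)) (by
        intro s t K K0 hsub hA a ha b hb haK
        have := prop (T - t) (T - s) K K0 (by
          intro z hz
          have := hmem _ (hsub (⟨by linarith [hz.2], by linarith [hz.1]⟩ : T - z ∈ Icc s t))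
          rwa [sub_sub_cancel] at this) (by
          intro z hz
          have := hA (⟨by linarith [hz.2], by linarith [hz.1]⟩ : T - z ∈ Icc s t)
          simp only [mem_setOf_eq] at this
          rwa [sub_sub_cancel] at this) (T - a) ⟨by linarith [ha.2], by linarith [ha.1]⟩ (T - b)
          ⟨by linarith [hb.2], by linarith [hb.1]⟩ haK
        rw [show T - b - (T - a) = -(b - a) by ring, abs_neg] at this
        exact this) n (T - β) (T - τ) (hmem _ hβ) (hmem _ hτ) (by linarith) (by linarith)
      (by simpa using h0) (by
        intro s hsI
        obtain ⟨K, hK⟩ := hs (T - s) ⟨by linarith [hsI.2], by linarith [hsI.1]⟩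
        refine ⟨K, fun z hz => hK ⟨by linarith [hz.2], by linarith [hz.1]⟩⟩)
    simpa using this

lemma fd_time {P Pt : ℝ → ℝ → ℝ} {S : Set ℝ} {σ : ℝ}
    (h : ∀ x, HasDerivWithinAt (fun τ => P τ x) (Pt σ x) S σ) (ε : ℝ) (n : ℕ) (x : ℝ) :
    HasDerivWithinAt (fun τ => fd ε n (P τ) x) (fd ε n (Pt σ) x) S σ := by
  induction n generalizing x with
  | zero => exact h x
  | succ n ih => exact (ih (x + ε)).sub (ih x)

lemma fd_joint {P : ℝ → ℝ → ℝ} {S : Set ℝ}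
    (h : ContinuousOn (fun p : ℝ × ℝ => P p.1 p.2) (S ×ˢ univ)) (ε : ℝ) (n : ℕ) :
    ContinuousOn (fun p : ℝ × ℝ => fd ε n (P p.1) p.2) (S ×ˢ univ) := by
  induction n with
  | zero => exact h
  | succ n ih =>
    refine ContinuousOn.sub ?_ ih
    have hm : ContinuousOn (fun p : ℝ × ℝ => (p.1, p.2 + ε)) (S ×ˢ univ) := by fun_prop
    exact ih.comp hm (fun p hp => ⟨hp.1, trivial⟩)

lemma DB.lam {P : ℝ → ℝ → ℝ} {t K : ℝ} {j : ℕ} (h : DB (P t) j K) : DB (lamOf P t) j K := by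
  intro ε hε x
  have e : lamOf P t = fun y => (3/4) * P t y + (-(1/4)) * (fun z => P t (-z)) y := by
    funext y; simp only [lamOf]; ring
  rw [e, fd_lin, fd_refl]
  have h1 := h ε hε x
  have h2 := h ε hε (-x - j * ε)
  have h3 : |(-1:ℝ)^j * fd ε j (P t) (-x - j * ε)| ≤ K * ε ^ j := by
    rw [abs_mul, abs_pow]; simpa using h2
  rw [abs_le] at h1 h3 ⊢
  constructor <;> linarith [h1.1, h1.2, h3.1, h3.2]

lemma Rb {P Pt : ℝ → ℝ → ℝ} {T : ℝ} (h : Sol P Pt T) {σ : ℝ} (hσ : σ ∈ Icc 0 T) {m : ℕ}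
    (L G : ℕ → ℝ) (hL : ∀ j ≤ m, 1 ≤ j → DB (P σ) j (L j))
    (hG : ∀ j < m, DB (deriv (P σ)) j (G j)) (hL0 : ∀ j, 0 ≤ L j) (B : ℝ)
    (hB : ∀ i j, i + j = m → 1 ≤ i → L i * G j ≤ B) (hB0 : 0 ≤ B) (ε : ℝ) (hε : 0 < ε) (x : ℝ) :
    |fd ε m (Pt σ) x + lamOf P σ x * fd ε m (deriv (P σ)) x| ≤ 2 ^ m * B * ε ^ m := by
  have := comm_bound m (lamOf P σ) (deriv (P σ)) L G (fun j hj h1 => (hL j hj h1).lam) hG hL0 B hB hB0 ε hε x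
  have e : Pt σ = fun y => - (fun z => lamOf P σ z * deriv (P σ) z) y := by
    funext y; rw [(h.eq σ hσ y).2]; ring
  rw [e, fd_neg, ← abs_neg]
  rw [show -(-fd ε m (fun z => lamOf P σ z * deriv (P σ) z) x + lamOf P σ x * fd ε m (deriv (P σ)) x)
    = fd ε m (fun z => lamOf P σ z * deriv (P σ) z) x - lamOf P σ x * fd ε m (deriv (P σ)) x by ring]
  exact this

lemma stepB {P Pt : ℝ → ℝ → ℝ} {T : ℝ} (h : Sol P Pt T) {n : ℕ} (hn : 1 ≤ n) {κ : ℝ} (hκ : 0 ≤ κ)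
    (hD : ∀ t ∈ Icc 0 T, ∀ j, 1 ≤ j → j ≤ n → DB (P t) j κ)
    (hC : ∀ t ∈ Icc 0 T, ContDiff ℝ n (P t)) (hP : ∀ t ∈ Icc 0 T, Pc (P t) (n+1)) :
    ∃ K, ∀ t ∈ Icc 0 T, DB (P t) (n+1) K := by
  have key : ∀ σ ∈ Icc 0 T, ∀ K, DB (P σ) (n+1) K → ∀ ε > 0, ∀ x,
      |fd ε (n+1) (Pt σ) x + lamOf P σ x * fd ε (n+1) (deriv (P σ)) x|
        ≤ 2 ^ (n+1) * ((κ * κ + κ) * (1 + K)) * ε ^ (n+1) := by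
    intro σ hσ K hK ε hε x
    have hK0 := hK.nonneg
    have hall : ∀ j, 1 ≤ j → j ≤ n + 1 → DB (P σ) j (if j ≤ n then κ else K) := by
      intro j h1 h2
      split_ifs with hj
      · exact hD σ hσ j h1 hj
      · rw [show j = n + 1 by omega]; exact hK
    refine Rb h hσ (fun i => if i ≤ n then κ else K) (fun j => if j + 1 ≤ n then κ else K)
      (fun j h1 h2 => hall j h2 h1) ?_ ?_ _ ?_ (by positivity) ε hε x
    · intro j hj
      exact deriv_DB ((hC σ hσ).of_le (by exact_mod_cast hn)) ((hC σ hσ).of_le (by exact_mod_cast (by omega)))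
        ((hP σ hσ).of_le (by omega)) (hall (j+1) (by omega) (by omega))
    · intro j; split_ifs <;> assumption
    · intro i j hij hi
      split_ifs <;> first | omega | nlinarith [mul_nonneg hκ hK0, mul_nonneg (mul_nonneg hκ hκ) hK0, mul_nonneg hκ hκ]
  suffices hs : ∃ K, Icc 0 T ⊆ {t | DB (P t) (n+1) K} by
    obtain ⟨K, hK⟩ := hs
    exact ⟨K, fun t ht => hK ht⟩
  refine lin_baire T (2 ^ (n+1) * (κ * κ + κ) + 1) (by positivity)
    (fun K => {t | DB (P t) (n+1) K}) ?_ ?_ (fun K t ht => ht.nonneg) (fun K K' hKK t ht => ht.mono hKK)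
    (fun t ht => exists_DB (hC t ht) (hP t ht) (h.per t ht)) ?_
  · intro K
    have : Icc 0 T ∩ {t | DB (P t) (n+1) K} =
        Icc 0 T ∩ ⋂ (ε : ℝ) (_ : 0 < ε) (x : ℝ), {t ∈ Icc 0 T | |fd ε (n+1) (P t) x| ≤ K * ε^(n+1)} := by
      ext t
      simp only [mem_inter_iff, mem_setOf_eq, mem_iInter, DB]
      constructor
      · rintro ⟨h1, h2⟩; exact ⟨h1, fun ε hε x => ⟨h1, h2 ε hε x⟩⟩
      · rintro ⟨h1, h2⟩; exact ⟨h1, fun ε hε x => (h2 ε hε x).2⟩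
    rw [this]
    refine isClosed_Icc.inter (isClosed_iInter fun ε => isClosed_iInter fun hε => isClosed_iInter fun x => ?_)
    refine isClosed_Icc.isClosed_le ?_ continuousOn_const
    exact ContinuousOn.abs fun t ht => (fd_time (h.d t ht) ε (n+1) x).continuousWithinAt
  · intro t
    have : {K | t ∈ {t | DB (P t) (n+1) K}} = ⋂ (ε : ℝ) (_ : 0 < ε) (x : ℝ), {K | |fd ε (n+1) (P t) x| ≤ K * ε^(n+1)} := by
      ext K; simp only [mem_setOf_eq, mem_iInter, DB, gt_iff_lt]
    rw [this]
    refine isClosed_iInter fun ε => isClosed_iInter fun hε => isClosed_iInter fun x => ?_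
    exact isClosed_le continuous_const (by fun_prop)
  · intro s t K K0 hst hA a ha b hb haK ε hε x
    have hK0 : 0 ≤ K := DB.nonneg (hA ha)
    obtain ⟨X, hX0, hX⟩ := h.char hst hκ (fun σ hσ => AE_of_DB (hD σ (hst hσ) 1 le_rfl hn)) hb x
    have := along (lamOf P) (fun τ => fd ε (n+1) (P τ)) (fun τ => fd ε (n+1) (Pt τ))
      (fun τ => fd ε (n+1) (deriv (P τ))) s t
      (fd_joint (h.ct.mono (prod_mono_left hst)) ε (n+1))
      (fun σ hσ x => (fd_time (h.d σ (hst hσ)) ε (n+1) x).mono hst)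
      (fun σ hσ x => fd_hasDeriv ε (n+1) _ _ (fun y => (h.eq σ (hst hσ) y).1) x) _
      (fun σ hσ x => key σ (hst hσ) K (hA hσ) ε hε x) X hX a b ha hb
    rw [hX0] at this
    have h2 := haK ε hε (X a)
    have h3 : 2 ^ (n + 1) * ((κ * κ + κ) * (1 + K)) * ε ^ (n + 1) * |b - a| ≤
      (2 ^ (n + 1) * (κ * κ + κ) + 1) * (1 + K) * |b - a| * ε^(n+1) := by
      have : 0 ≤ (1 + K) * |b - a| * ε^(n+1) := by positivity
      nlinarith
    have h4 := abs_sub_abs_le_abs_sub (fd ε (n+1) (P b) x) (fd ε (n+1) (P a) (X a))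
    nlinarith

lemma abs_sub_eq_zero_iff_of_small {a b : ℝ} (h : ∀ δ > 0, |a - b| ≤ 7 * δ) : a = b := by
  by_contra hne
  have h0 : 0 < |a - b| := abs_pos.2 (sub_ne_zero.2 hne)
  have := h (|a - b| / 8) (by positivity)
  linarith

lemma fd_pair {f : ℝ → ℝ} {α β δ ρ ε x : ℝ} {m : ℕ} {g : ℝ → ℝ}
    (h1 : ∀ x ∈ Icc α β, ∀ y ∈ Icc α β, |x - y| < ρ → |g x - g y| ≤ δ)
    (h2 : ∀ ε > 0, m * ε < ρ → ∀ x, α ≤ x → x + m * ε ≤ β → |fd ε m f x - g x * ε ^ m| ≤ δ * ε ^ m)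
    (hε : 0 < ε) (hm : m * ε < ρ) (hx : α ≤ x) (hx' : x + 2 * (m * ε) ≤ β) :
    |fd ε m f (x + m * ε) - fd ε m f x| ≤ 3 * δ * ε ^ m := by
  have hm0 : 0 ≤ m * ε := by positivity
  have a1 := h2 ε hε hm x hx (by linarith)
  have a2 := h2 ε hε hm (x + m * ε) (by linarith) (by linarith)
  have a3 := h1 (x + m * ε) ⟨by linarith, by linarith⟩ x ⟨by linarith, by linarith⟩ (by
    rw [add_sub_cancel_left, abs_of_nonneg hm0]; exact hm)
  have hp : 0 < ε ^ m := by positivity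
  rw [abs_le] at *
  constructor <;> nlinarith [a1.1, a1.2, a2.1, a2.2, mul_le_mul_of_nonneg_right a3.1 hp.le, mul_le_mul_of_nonneg_right a3.2 hp.le]

lemma stepJ_H {P Pt : ℝ → ℝ → ℝ} {T : ℝ} (h : Sol P Pt T) {n : ℕ} (hn : 1 ≤ n) {κ : ℝ} (hκ : 0 ≤ κ)
    (hD : ∀ t ∈ Icc 0 T, ∀ j, 1 ≤ j → j ≤ n + 1 → DB (P t) j κ)
    (hC : ∀ t ∈ Icc 0 T, ContDiff ℝ n (P t)) (hP : ∀ t ∈ Icc 0 T, Pc (P t) (n+1))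
    (X : ℝ → ℝ) (hX : ∀ σ ∈ Icc 0 T, HasDerivWithinAt X (lamOf P σ (X σ)) (Icc 0 T) σ)
    (a b : ℝ) (ha : a ∈ Icc 0 T) (hb : b ∈ Icc 0 T) (ε : ℝ) (hε : 0 < ε) :
    |(fd ε (n+1) (P b) (X b + (n+1:ℕ) * ε) - fd ε (n+1) (P b) (X b)) -
      (fd ε (n+1) (P a) (X a + (n+1:ℕ) * ε) - fd ε (n+1) (P a) (X a))| ≤
      (2 * (2^(n+1) * (κ * κ)) + 2 * κ * κ * (n+1:ℕ)) * ε^(n+1) * |b - a| := by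
  set m := n + 1 with hm
  have hdD : ∀ σ ∈ Icc 0 T, ∀ j < m, DB (deriv (P σ)) j κ := fun σ hσ j hj =>
    deriv_DB ((hC σ hσ).of_le (by exact_mod_cast hn)) ((hC σ hσ).of_le (by exact_mod_cast (by omega)))
        ((hP σ hσ).of_le (by omega)) (hD σ hσ (j+1) (by omega) (by omega))
  have key : ∀ σ ∈ Icc 0 T, ∀ x, |fd ε m (Pt σ) x + lamOf P σ x * fd ε m (deriv (P σ)) x|
        ≤ 2 ^ m * (κ * κ) * ε ^ m := fun σ hσ x =>
    Rb h hσ (fun _ => κ) (fun _ => κ) (fun j h1 h2 => hD σ hσ j h2 h1) (hdD σ hσ) (fun _ => hκ) _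
      (fun _ _ _ _ => le_rfl) (by positivity) ε hε x
  have hm0 : (0:ℝ) ≤ m * ε := by positivity
  refine along (lamOf P) (fun τ x => fd ε m (P τ) (x + m * ε) - fd ε m (P τ) x)
    (fun τ x => fd ε m (Pt τ) (x + m * ε) - fd ε m (Pt τ) x)
    (fun τ x => fd ε m (deriv (P τ)) (x + m * ε) - fd ε m (deriv (P τ)) x) 0 T ?_ ?_ ?_ _ ?_ X hX a b ha hb
  · have h0 := fd_joint h.ct ε m
    have hcm : ContinuousOn (fun p : ℝ × ℝ => (p.1, p.2 + m * ε)) (Icc 0 T ×ˢ univ) := by fun_prop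
    exact (h0.comp hcm (fun p hp => ⟨hp.1, trivial⟩)).sub h0
  · intro σ hσ x
    exact (fd_time (h.d σ hσ) ε m _).sub (fd_time (h.d σ hσ) ε m _)
  · intro σ hσ x
    have := fd_hasDeriv ε m _ _ (fun y => (h.eq σ hσ y).1)
    exact ((this (x + m * ε)).comp_add_const x (m * ε)).sub (this x)
  · intro σ hσ x
    have k1 := key σ hσ x
    have k2 := key σ hσ (x + m * ε)
    have k3 := (AE_of_DB (hD σ hσ 1 le_rfl (by omega))).lam (x + m * ε) x
    rw [add_sub_cancel_left, abs_of_nonneg hm0, add_zero] at k3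
    have k4 : |fd ε m (deriv (P σ)) (x + m * ε)| ≤ 2 * κ * ε ^ n := by
      rw [hm, fd_succ]
      have e1 := hdD σ hσ n (by omega) ε hε (x + m * ε)
      have e2 := hdD σ hσ n (by omega) ε hε (x + m * ε + ε)
      refine (abs_sub _ _).trans ?_
      linarith
    have k5 : |(lamOf P σ (x + m * ε) - lamOf P σ x) * fd ε m (deriv (P σ)) (x + m * ε)| ≤
        2 * κ * κ * m * ε^m := by
      rw [abs_mul]
      calc _ ≤ (κ * (m * ε)) * (2 * κ * ε^n) := mul_le_mul k3 k4 (abs_nonneg _) (by positivity)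
        _ = _ := by rw [hm, pow_succ]; ring
    rw [abs_le] at *
    constructor <;> nlinarith [k1.1, k1.2, k2.1, k2.2, k5.1, k5.2]

set_option maxHeartbeats 1000000 in
lemma stepJ {P Pt : ℝ → ℝ → ℝ} {T : ℝ} (hT : 0 < T) (h : Sol P Pt T) {n : ℕ} (hn : 1 ≤ n) {κ : ℝ} (hκ : 0 ≤ κ)
    (hD : ∀ t ∈ Icc 0 T, ∀ j, 1 ≤ j → j ≤ n + 1 → DB (P t) j κ)
    (hC : ∀ t ∈ Icc 0 T, ContDiff ℝ n (P t)) (hP : ∀ t ∈ Icc 0 T, Pc (P t) (n+1))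
    (hne : ∀ t ∈ Icc 0 T, ∀ j : ℤ, lamOf P t j ≠ 0) :
    ∀ t ∈ Icc 0 T, ContDiff ℝ (n+1 : ℕ) (P t) := by
  intro t ht
  refine glue (hC t ht) (hP t ht) fun j => ?_
  set m := n + 1 with hm
  set c : ℝ := (j:ℝ) + 1 with hc
  have hP' : ∀ t ∈ Icc 0 T, ContDiffOn ℝ m (P t) (Icc c (c+1)) := by
    intro t ht; have := hP t ht (j+1); push_cast at this; exact this
  have hc0 : lamOf P t c ≠ 0 := by have := hne t ht (j+1); push_cast at this; exact this
  set c0 := lamOf P t c with hc0d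
  have hc0p : 0 < |c0| := abs_pos.2 hc0
  obtain ⟨Λ0, hΛ0, hB⟩ := bdd_of_per h.c h.per
  set Λ := Λ0 + 1 with hΛ
  have hΛp : 0 < Λ := by positivity
  have hlam : ∀ σ ∈ Icc 0 T, ∀ x, |lamOf P σ x| ≤ Λ := by
    intro σ hσ x
    have h1 := abs_le.1 (hB σ hσ x)
    have h2 := abs_le.1 (hB σ hσ (-x))
    unfold lamOf
    rw [abs_le]; constructor <;> linarith [h1.1, h1.2, h2.1, h2.2]
  have hlc : ContinuousOn (fun p : ℝ × ℝ => lamOf P p.1 p.2) (Icc 0 T ×ˢ univ) := by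
    have hcm : ContinuousOn (fun p : ℝ × ℝ => (p.1, -p.2)) (Icc 0 T ×ˢ univ) := by fun_prop
    exact ((h.c.const_smul (3:ℝ)).sub (h.c.comp hcm (fun p hp => ⟨hp.1, trivial⟩))).div_const 4
  obtain ⟨ρ0, hρ0, hlc0⟩ := Metric.continuousOn_iff.1 hlc (t, c) ⟨ht, trivial⟩ (|c0|/2) (by positivity)
  set D : ℝ := 2 * (2^m * (κ * κ)) + 2 * κ * κ * m with hDd
  have hD0 : 0 ≤ D := by positivity
  have hmp : (0:ℝ) < m := by rw [hm]; positivity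
  refine (abs_sub_eq_zero_iff_of_small ?_)
  intro δ hδ
  -- choose τ
  obtain ⟨d, hd, hd1, hd2, hd3, hd4⟩ : ∃ d > 0, d ≤ T / 2 ∧ D * d ≤ δ ∧ Λ * d ≤ ρ0 / 2 ∧ Λ * d ≤ 1/8 := by
    refine ⟨min (min (T/2) (δ / (D+1))) (min (ρ0 / (2 * Λ)) (1 / (8 * Λ))), by positivity, ?_, ?_, ?_, ?_⟩
    · exact (min_le_left _ _).trans (min_le_left _ _)
    · calc _ ≤ D * (δ / (D+1)) := mul_le_mul_of_nonneg_left ((min_le_left _ _).trans (min_le_right _ _)) hD0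
        _ ≤ δ := by rw [mul_div_assoc', div_le_iff₀ (by positivity)]; nlinarith
    · calc _ ≤ Λ * (ρ0 / (2*Λ)) := mul_le_mul_of_nonneg_left ((min_le_right _ _).trans (min_le_left _ _)) hΛp.le
        _ ≤ _ := by field_simp; rfl
    · calc _ ≤ Λ * (1 / (8*Λ)) := mul_le_mul_of_nonneg_left ((min_le_right _ _).trans (min_le_right _ _)) hΛp.le
        _ ≤ _ := by field_simp; rfl
  have hdρ : d < ρ0 := by
    have : 1 * d ≤ Λ * d := mul_le_mul_of_nonneg_right (by linarith) hd.le
    linarith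
  obtain ⟨τ, hτ, hτd⟩ : ∃ τ ∈ Icc 0 T, |τ - t| = d := by
    rcases le_total t (T/2) with h1 | h1
    · exact ⟨t + d, ⟨by linarith [ht.1], by linarith⟩, by rw [add_sub_cancel_left, abs_of_pos hd]⟩
    · exact ⟨t - d, ⟨by linarith, by linarith [ht.2]⟩, by rw [sub_sub_cancel_left, abs_neg, abs_of_pos hd]⟩
  obtain ⟨ρ1, hρ1, u1, v1⟩ := fd_unif (by linarith : (j:ℝ) < c) (hP t ht j) hδ
  obtain ⟨ρ2, hρ2, u2, v2⟩ := fd_unif (by linarith : c < c + 1) (hP' t ht) hδ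
  obtain ⟨ρ3, hρ3, u3, v3⟩ := fd_unif (by linarith : (j:ℝ) < c) (hP τ hτ j) hδ
  obtain ⟨ρ4, hρ4, u4, v4⟩ := fd_unif (by linarith : c < c + 1) (hP' τ hτ) hδ
  obtain ⟨ε, hε, e1, e2, e3, e4, e5, e6, e7⟩ : ∃ ε > 0, m * ε < ρ1 ∧ m * ε < ρ2 ∧ m * ε < ρ3 ∧ m * ε < ρ4 ∧
      m * ε ≤ |c0| * d / 2 ∧ m * ε < ρ0/2 ∧ m * ε ≤ 1/8 := by
    set w := min (min (min ρ1 ρ2) (min ρ3 ρ4)) (min (|c0| * d / 2) (min (ρ0/2) (1/8))) with hw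
    have hwp : 0 < w := by positivity
    have hl : w ≤ ρ1 ∧ w ≤ ρ2 ∧ w ≤ ρ3 ∧ w ≤ ρ4 ∧ w ≤ |c0| * d / 2 ∧ w ≤ ρ0/2 ∧ w ≤ 1/8 := by
      have := le_refl w
      conv at this => rhs; rw [hw]
      simp only [le_min_iff] at this
      tauto
    have he : m * (w / (2 * m)) = w / 2 := by field_simp
    refine ⟨w / (2 * m), by positivity, ?_⟩
    rw [he]
    obtain ⟨a1, a2, a3, a4, a5, a6, a7⟩ := hl
    refine ⟨?_, ?_, ?_, ?_, ?_, ?_, ?_⟩ <;> linarith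
  have hmε : 0 < m * ε := by positivity
  obtain ⟨X, hX0, hX⟩ := h.char (Subset.refl (Icc 0 T)) hκ
    (fun σ hσ => AE_of_DB (hD σ hσ 1 le_rfl (by omega))) ht (c - m * ε)
  have hH := stepJ_H h hn hκ hD hC hP X hX t τ ht hτ ε hε
  rw [hX0, sub_add_cancel, hτd] at hH
  -- location of X τ
  have hXl : ∀ σ ∈ Icc 0 T, |X σ - X t| ≤ Λ * |σ - t| := fun σ hσ =>
    Convex.norm_image_sub_le_of_norm_hasDerivWithin_le (fun z hz => hX z hz)
      (fun z hz => hlam z hz _) (convex_Icc 0 T) ht hσ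
  have hsub : uIcc t τ ⊆ Icc 0 T := ordConnected_Icc.uIcc_subset ht hτ
  have hXc : |(X τ - c0 * τ) - (X t - c0 * t)| ≤ |c0| / 2 * |τ - t| := by
    refine Convex.norm_image_sub_le_of_norm_hasDerivWithin_le (f := fun z => X z - c0 * z)
      (f' := fun z => lamOf P z (X z) - c0) (s := uIcc t τ)
      (fun z hz => ?_) (fun z hz => ?_) (convex_uIcc _ _) left_mem_uIcc right_mem_uIcc
    · exact (((hX z (hsub hz)).mono hsub).sub ((hasDerivWithinAt_id z _).const_mul c0)).congr_deriv (by simp)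
    · have hzt : |z - t| ≤ d := by
        rw [← hτd, abs_sub_comm z, abs_sub_comm τ]
        rw [abs_sub_comm t, abs_sub_comm t]; exact abs_sub_left_of_mem_uIcc hz
      have h1 := hXl z (hsub hz)
      rw [hX0] at h1
      have h2 : |X z - c| ≤ Λ * d + m * ε := by
        have : Λ * |z - t| ≤ Λ * d := mul_le_mul_of_nonneg_left hzt hΛp.le
        rw [abs_le] at h1 ⊢; constructor <;> linarith [h1.1, h1.2]
      have := hlc0 (z, X z) ⟨hsub hz, trivial⟩ (by
        rw [Prod.dist_eq, max_lt_iff]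
        simp only [Real.dist_eq]
        exact ⟨by linarith, by linarith⟩)
      exact this.le
  rw [hτd, hX0] at hXc
  have hXτ := hXl τ hτ
  rw [hτd, hX0] at hXτ
  have hfin : |fd ε m (P τ) (X τ + m * ε) - fd ε m (P τ) (X τ)| ≤ 3 * δ * ε^m := by
    have hX' := abs_le.1 hXc
    have hX'' := abs_le.1 hXτ
    have hw : |c0 * (τ - t)| = |c0| * d := by rw [abs_mul, hτd]
    rcases le_total 0 (c0 * (τ - t)) with hs | hs
    · rw [abs_of_nonneg hs] at hw
      exact fd_pair u4 v4 hε e4 (by linarith [hX'.1]) (by linarith [hX''.2])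
    · rw [abs_of_nonpos hs] at hw
      exact fd_pair u3 v3 hε e3 (by linarith [hX''.1]) (by linarith [hX'.2])
  have b1 := v2 ε hε e2 c le_rfl (by linarith)
  have b2 := v1 ε hε e1 (c - m * ε) (by linarith) (by linarith)
  have b3 := u1 (c - m * ε) ⟨by linarith, by linarith⟩ c ⟨by linarith, by linarith⟩ (by
    rw [sub_sub_cancel_left, abs_neg, abs_of_pos hmε]; exact e1)
  have hp : 0 < ε ^ m := by positivity
  have hH2 : D * ε ^ m * d ≤ δ * ε^m := by nlinarith
  set A := iteratedDerivWithin m (P t) (Icc (j:ℝ) c) c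
  set B := iteratedDerivWithin m (P t) (Icc c (c+1)) c
  refine le_of_mul_le_mul_right (a := ε^m) ?_ hp
  rw [← abs_of_pos hp, ← abs_mul, abs_of_pos hp]
  have hH3 := hH.trans hH2
  have b4 := mul_le_mul_of_nonneg_right (abs_le.1 b3).1 hp.le
  have b5 := mul_le_mul_of_nonneg_right (abs_le.1 b3).2 hp.le
  rw [abs_le] at hH3 hfin b1 b2 ⊢
  constructor <;> nlinarith [hH3.1, hH3.2, hfin.1, hfin.2, b1.1, b1.2, b2.1, b2.2]

lemma Sol.c1 {P Pt : ℝ → ℝ → ℝ} {T : ℝ} (h : Sol P Pt T) {t : ℝ} (ht : t ∈ Icc 0 T) : ContDiff ℝ 1 (P t) := by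
  rw [contDiff_one_iff_deriv]
  exact ⟨fun x => (h.eq t ht x).1.differentiableAt, h.dc t ht⟩

lemma reg_ind {P Pt : ℝ → ℝ → ℝ} {T : ℝ} (hT : 0 < T) (h : Sol P Pt T) {r : ℕ}
    (hP : ∀ t ∈ Icc 0 T, Pc (P t) r) (hne : ∀ t ∈ Icc 0 T, ∀ j : ℤ, lamOf P t j ≠ 0) :
    ∀ m, m + 1 ≤ r → (∀ t ∈ Icc 0 T, ContDiff ℝ m (P t)) ∧
      ∃ κ, 0 ≤ κ ∧ ∀ t ∈ Icc 0 T, ∀ j, 1 ≤ j → j ≤ m + 1 → DB (P t) j κ := by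
  intro m
  induction m with
  | zero =>
    intro _
    obtain ⟨K, hK0, hK⟩ := stepA h
    refine ⟨fun t ht => (h.c1 ht).of_le (by norm_num), K, hK0, fun t ht j h1 h2 => ?_⟩
    rw [show j = 1 by omega]; exact hK t ht
  | succ m ih =>
    intro hm
    obtain ⟨hC, κ, hκ, hD⟩ := ih (by omega)
    have hC' : ∀ t ∈ Icc 0 T, ContDiff ℝ (m+1 : ℕ) (P t) := by
      rcases Nat.eq_zero_or_pos m with rfl | hpos
      · intro t ht; exact_mod_cast h.c1 ht
      · exact stepJ hT h hpos hκ hD hC (fun t ht => (hP t ht).of_le (by omega)) hne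
    obtain ⟨K, hK⟩ := stepB h (n := m+1) (by omega) hκ hD hC' (fun t ht => (hP t ht).of_le (by omega))
    refine ⟨hC', max κ K, hκ.trans (le_max_left _ _), fun t ht j h1 h2 => ?_⟩
    rcases Nat.lt_or_ge (m+1) j with hj | hj
    · rw [show j = m + 1 + 1 by omega]; exact (hK t ht).mono (le_max_right _ _)
    · exact (hD t ht j h1 hj).mono (le_max_left _ _)

lemma idw_le_closed {f : ℝ → ℝ} {α β : ℝ} (hab : α < β) {n : ℕ} (hf : ContDiffOn ℝ n f (Icc α β))
    {K : ℝ} (hK : DB f n K) {x : ℝ} (hx : x ∈ Icc α β) :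
    |iteratedDerivWithin n f (Icc α β) x| ≤ K := by
  have hc := hf.continuousOn_iteratedDerivWithin (m := n) le_rfl (uniqueDiffOn_Icc hab)
  have hcl := isClosed_Icc.isClosed_le hc.abs (continuousOn_const (c := K))
  have hsub : Ico α β ⊆ {x ∈ Icc α β | |iteratedDerivWithin n f (Icc α β) x| ≤ K} :=
    fun z hz => ⟨⟨hz.1, hz.2.le⟩, idw_le_of_DB hab hf hK hz⟩
  have := closure_minimal hsub hcl
  rw [closure_Ico hab.ne] at this
  exact (this hx).2

lemma DB.refl {f : ℝ → ℝ} {n : ℕ} {K : ℝ} (h : DB f n K) : DB (fun x => - f (-x)) n K := by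
  intro ε hε x
  rw [fd_neg, fd_refl, abs_neg, abs_mul, abs_pow]
  simpa using h ε hε (-x - n * ε)

/-- folding -/
def fold (a b : ℝ → ℝ) (x : ℝ) : ℝ :=
  if 0 ≤ toIcoMod (two_pos (α := ℝ)) (-1) x then a (toIcoMod (two_pos (α := ℝ)) (-1) x)
  else b (- toIcoMod (two_pos (α := ℝ)) (-1) x)

lemma fold_per (a b : ℝ → ℝ) (x : ℝ) : fold a b (x + 2) = fold a b x := by
  simp only [fold, toIcoMod_add_right]

lemma tim {i : ℤ} {x : ℝ} (hx : x ∈ Ico (2 * i - 1 : ℝ) (2 * i + 1)) :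
    toIcoMod (two_pos (α := ℝ)) (-1) x = x - 2 * i := by
  rw [toIcoMod_eq_iff]
  refine ⟨⟨by linarith [hx.1], by linarith [hx.2]⟩, i, ?_⟩
  simp; ring

lemma fold_even {a b : ℝ → ℝ} (h1 : a 1 = b 1) {i : ℤ} {x : ℝ} (hx : x ∈ Icc (2 * i : ℝ) (2 * i + 1)) :
    fold a b x = a (x - 2 * i) := by
  rcases eq_or_lt_of_le hx.2 with h | h
  · have := tim (i := i + 1) (x := x) (by push_cast; exact ⟨by linarith, by linarith⟩)
    simp only [fold, this]; push_cast
    rw [if_neg (by linarith), show -(x - 2 * ((i:ℝ) + 1)) = 1 by linarith, show x - 2 * (i:ℝ) = 1 by linarith, h1]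
  · have := tim (i := i) (x := x) ⟨by linarith [hx.1], by linarith⟩
    simp only [fold, this]
    rw [if_pos (by linarith [hx.1])]

lemma fold_odd {a b : ℝ → ℝ} (h0 : a 0 = b 0) {i : ℤ} {x : ℝ} (hx : x ∈ Icc (2 * i - 1: ℝ) (2 * i)) :
    fold a b x = b (2 * i - x) := by
  have := tim (i := i) (x := x) ⟨hx.1, by linarith [hx.2]⟩
  simp only [fold, this]
  rcases eq_or_lt_of_le hx.2 with h | h
  · rw [if_pos (by linarith), show (x - 2 * (i:ℝ)) = 0 by linarith, show 2 * (i:ℝ) - x = 0 by linarith, h0]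
  · rw [if_neg (by linarith)]; congr 1; ring

/-- case split on intervals -/
lemma int_cases (j : ℤ) : (∃ i : ℤ, (j:ℝ) = 2 * i) ∨ (∃ i : ℤ, (j:ℝ) = 2 * i - 1) := by
  rcases Int.even_or_odd' j with ⟨k, hk | hk⟩
  · left; exact ⟨k, by rw [hk]; push_cast; ring⟩
  · right; exact ⟨k + 1, by rw [hk]; push_cast; ring⟩

lemma fold_Pc {a b : ℝ → ℝ} {n : ℕ} (h0 : a 0 = b 0) (h1 : a 1 = b 1) (ha : ContDiffOn ℝ n a (Icc 0 1))
    (hb : ContDiffOn ℝ n b (Icc 0 1)) : Pc (fold a b) n := by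
  intro j
  rcases int_cases j with ⟨i, hi⟩ | ⟨i, hi⟩
  · rw [hi]
    have : ContDiffOn ℝ n (fun x => a (x - 2 * i)) (Icc (2 * i : ℝ) (2 * i + 1)) :=
      ha.comp (g := a) (by fun_prop) (fun x hx => ⟨by linarith [hx.1], by linarith [hx.2]⟩)
    exact this.congr fun x hx => fold_even h1 hx
  · rw [hi, sub_add_cancel]
    have : ContDiffOn ℝ n (fun x => b (2 * i - x)) (Icc (2 * i - 1 : ℝ) (2 * i)) :=
      hb.comp (g := b) (by fun_prop) (fun x hx => ⟨by linarith [hx.2], by linarith [hx.1]⟩)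
    exact this.congr fun x hx => fold_odd h0 hx

lemma fold_hd {a b a' b' c : ℝ → ℝ} (h0 : a 0 = b 0) (h1 : a 1 = b 1) (h0' : a' 0 = c 0) (h1' : a' 1 = c 1)
    (hc : ∀ x, c x = - b' x)
    (ha : ∀ x ∈ Icc (0:ℝ) 1, HasDerivWithinAt a (a' x) (Icc 0 1) x)
    (hb : ∀ x ∈ Icc (0:ℝ) 1, HasDerivWithinAt b (b' x) (Icc 0 1) x) (x : ℝ) :
    HasDerivAt (fold a b) (fold a' c x) x := by
  have key : ∀ j : ℤ, ∀ x ∈ Icc (j:ℝ) (j+1), HasDerivWithinAt (fold a b) (fold a' c x) (Icc (j:ℝ) (j+1)) x := by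
    intro j
    rcases int_cases j with ⟨i, hi⟩ | ⟨i, hi⟩
    · rw [hi]
      intro x hx
      have := (ha (x - 2 * i) ⟨by linarith [hx.1], by linarith [hx.2]⟩).comp x (h := fun x => x - 2 * i)
        (s := Icc (2 * i : ℝ) (2 * i + 1)) (h' := 1) ((hasDerivWithinAt_id x _).sub_const _)
        (fun z hz => ⟨by linarith [hz.1], by linarith [hz.2]⟩)
      rw [mul_one] at this
      rw [fold_even h1' hx]
      exact this.congr (fun z hz => fold_even h1 hz) (fold_even h1 hx)
    · rw [hi, sub_add_cancel]
      intro x hx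
      have := (hb (2 * i - x) ⟨by linarith [hx.2], by linarith [hx.1]⟩).comp x (h := fun x => 2 * i - x)
        (s := Icc (2 * i - 1: ℝ) (2 * i)) (h' := -1) ((hasDerivWithinAt_id x _).const_sub _)
        (fun z hz => ⟨by linarith [hz.2], by linarith [hz.1]⟩)
      rw [fold_odd h0' hx, hc]
      exact (this.congr (fun z hz => fold_odd h0 hz) (fold_odd h0 hx)).congr_deriv (by ring)
  have k1 := key ⌊x⌋ x ⟨Int.floor_le x, (Int.lt_floor_add_one x).le⟩
  rcases eq_or_lt_of_le (Int.floor_le x) with h | h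
  · have k2 := key (⌊x⌋ - 1) x ⟨by push_cast; linarith, by push_cast; linarith⟩
    push_cast at k2
    rw [sub_add_cancel] at k2
    have := k2.union k1
    rw [Icc_union_Icc_eq_Icc (by linarith) (by linarith)] at this
    exact this.hasDerivAt (Icc_mem_nhds (by linarith) (by linarith))
  · exact k1.hasDerivAt (Icc_mem_nhds h (Int.lt_floor_add_one x))

lemma fold_joint {a b : ℝ → ℝ → ℝ} {S : Set ℝ} (hS : IsClosed S) (h0 : ∀ t ∈ S, a t 0 = b t 0)
    (h1 : ∀ t ∈ S, a t 1 = b t 1)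
    (ha : ContinuousOn (fun p : ℝ × ℝ => a p.1 p.2) (S ×ˢ Icc 0 1))
    (hb : ContinuousOn (fun p : ℝ × ℝ => b p.1 p.2) (S ×ˢ Icc 0 1)) :
    ContinuousOn (fun p : ℝ × ℝ => fold (a p.1) (b p.1) p.2) (S ×ˢ univ) := by
  have key : ∀ j : ℤ, ContinuousOn (fun p : ℝ × ℝ => fold (a p.1) (b p.1) p.2) (S ×ˢ Icc (j:ℝ) (j+1)) := by
    intro j
    rcases int_cases j with ⟨i, hi⟩ | ⟨i, hi⟩
    · rw [hi]
      have hm : ContinuousOn (fun p : ℝ × ℝ => (p.1, p.2 - 2 * (i:ℝ))) (S ×ˢ Icc (2 * i : ℝ) (2 * i + 1)) := by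
        fun_prop
      exact (ha.comp hm (fun p hp => ⟨hp.1, by linarith [hp.2.1], by linarith [hp.2.2]⟩)).congr
        (fun p hp => fold_even (h1 _ hp.1) hp.2)
    · rw [hi, sub_add_cancel]
      have hm : ContinuousOn (fun p : ℝ × ℝ => (p.1, 2 * (i:ℝ) - p.2)) (S ×ˢ Icc (2 * i - 1: ℝ) (2 * i)) := by
        fun_prop
      exact (hb.comp hm (fun p hp => ⟨hp.1, by linarith [hp.2.2], by linarith [hp.2.1]⟩)).congr
        (fun p hp => fold_odd (h0 _ hp.1) hp.2)
  rintro ⟨t, x⟩ ⟨ht, -⟩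
  have k1 := key ⌊x⌋
  have k2 := key (⌊x⌋ - 1)
  push_cast at k2
  rw [sub_add_cancel] at k2
  have := k2.union_of_isClosed k1 (hS.prod isClosed_Icc) (hS.prod isClosed_Icc)
  rw [← prod_union, Icc_union_Icc_eq_Icc (by linarith) (by linarith)] at this
  refine (this (t, x) ⟨ht, by linarith [Int.floor_le x], (Int.lt_floor_add_one x).le⟩).mono_of_mem_nhdsWithin ?_
  rw [nhdsWithin_prod_eq, nhdsWithin_univ]
  refine Filter.prod_mem_prod self_mem_nhdsWithin (Icc_mem_nhds (by linarith [Int.floor_le x]) (Int.lt_floor_add_one x))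

lemma fold_cont {a b : ℝ → ℝ} (h0 : a 0 = b 0) (h1 : a 1 = b 1) (ha : ContinuousOn a (Icc 0 1))
    (hb : ContinuousOn b (Icc 0 1)) : Continuous (fold a b) := by
  have := fold_joint (a := fun _ => a) (b := fun _ => b) (S := univ) isClosed_univ (fun _ _ => h0) (fun _ _ => h1)
    (ha.comp continuousOn_snd fun p hp => hp.2) (hb.comp continuousOn_snd fun p hp => hp.2)
  rw [univ_prod_univ, continuousOn_univ] at this
  exact this.comp (g := fun p : ℝ × ℝ => fold a b p.2) (f := fun x => ((0:ℝ), x)) (by fun_prop)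

/-- Data of folded Riemann invariants. -/
lemma fold_sol {T : ℝ} {p q pt qt px qx : ℝ → ℝ → ℝ}
    (hp : ContinuousOn (fun z : ℝ × ℝ => p z.1 z.2) (Icc 0 T ×ˢ Icc 0 1))
    (hq : ContinuousOn (fun z : ℝ × ℝ => q z.1 z.2) (Icc 0 T ×ˢ Icc 0 1))
    (hpt : ContinuousOn (fun z : ℝ × ℝ => pt z.1 z.2) (Icc 0 T ×ˢ Icc 0 1))
    (hqt : ContinuousOn (fun z : ℝ × ℝ => qt z.1 z.2) (Icc 0 T ×ˢ Icc 0 1))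
    (hpx : ∀ t ∈ Icc 0 T, ContinuousOn (px t) (Icc 0 1)) (hqx : ∀ t ∈ Icc 0 T, ContinuousOn (qx t) (Icc 0 1))
    (dpt : ∀ t ∈ Icc 0 T, ∀ y ∈ Icc (0:ℝ) 1, HasDerivWithinAt (fun s => p s y) (pt t y) (Icc 0 T) t)
    (dqt : ∀ t ∈ Icc 0 T, ∀ y ∈ Icc (0:ℝ) 1, HasDerivWithinAt (fun s => q s y) (qt t y) (Icc 0 T) t)
    (dpx : ∀ t ∈ Icc 0 T, ∀ y ∈ Icc (0:ℝ) 1, HasDerivWithinAt (p t) (px t y) (Icc 0 1) y)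
    (dqx : ∀ t ∈ Icc 0 T, ∀ y ∈ Icc (0:ℝ) 1, HasDerivWithinAt (q t) (qx t y) (Icc 0 1) y)
    (ep : ∀ t ∈ Icc 0 T, ∀ y ∈ Icc (0:ℝ) 1, pt t y = - ((3 * p t y + q t y)/4) * px t y)
    (eq : ∀ t ∈ Icc 0 T, ∀ y ∈ Icc (0:ℝ) 1, qt t y = - ((3 * q t y + p t y)/4) * qx t y)
    (hb : ∀ t ∈ Icc 0 T, ∀ y, y = 0 ∨ y = 1 → p t y = - q t y ∧ pt t y = - qt t y ∧ px t y = qx t y ∧ 0 < p t y)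
    :
    Sol (fun t => fold (p t) (fun y => - q t y)) (fun t => fold (pt t) (fun y => - qt t y)) T ∧
    ∀ t ∈ Icc 0 T, ∀ j : ℤ, lamOf (fun t => fold (p t) (fun y => - q t y)) t j ≠ 0 := by
  have hdx : ∀ t ∈ Icc 0 T, ∀ x, HasDerivAt (fold (p t) (fun y => - q t y)) (fold (px t) (qx t) x) x := by
    intro t ht x
    exact fold_hd (hb t ht 0 (Or.inl rfl)).1 (hb t ht 1 (Or.inr rfl)).1 (hb t ht 0 (Or.inl rfl)).2.2.1
      (hb t ht 1 (Or.inr rfl)).2.2.1 (b' := fun y => - qx t y) (fun x => by ring) (dpx t ht) (fun y hy => (dqx t ht y hy).neg) x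
  have hder : ∀ t ∈ Icc 0 T, deriv (fold (p t) (fun y => - q t y)) = fold (px t) (qx t) :=
    fun t ht => funext fun x => (hdx t ht x).deriv
  have hflo : ∀ x : ℝ, x ∈ Icc (⌊x⌋:ℝ) (⌊x⌋+1) := fun x => ⟨Int.floor_le x, (Int.lt_floor_add_one x).le⟩
  have lev : ∀ t ∈ Icc 0 T, ∀ i : ℤ, ∀ x ∈ Icc (2 * i : ℝ) (2 * i + 1),
      lamOf (fun t => fold (p t) (fun y => - q t y)) t x = (3 * p t (x - 2*i) + q t (x-2*i))/4 := by
    intro t ht i x hx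
    unfold lamOf; dsimp only
    rw [fold_even (hb t ht 1 (Or.inr rfl)).1 hx, fold_odd (i := -i) (hb t ht 0 (Or.inl rfl)).1
      (by push_cast; exact ⟨by linarith [hx.2], by linarith [hx.1]⟩)]
    push_cast; rw [show 2 * -(i:ℝ) - -x = x - 2*i by ring]; ring
  have lod : ∀ t ∈ Icc 0 T, ∀ i : ℤ, ∀ x ∈ Icc (2 * i - 1: ℝ) (2 * i),
      lamOf (fun t => fold (p t) (fun y => - q t y)) t x = -(3 * q t (2*i-x) + p t (2*i-x))/4 := by
    intro t ht i x hx
    unfold lamOf; dsimp only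
    rw [fold_odd (hb t ht 0 (Or.inl rfl)).1 hx, fold_even (i := -i) (hb t ht 1 (Or.inr rfl)).1
      (by push_cast; exact ⟨by linarith [hx.2], by linarith [hx.1]⟩)]
    push_cast; rw [show -x - 2 * -(i:ℝ) = 2*i-x by ring]; ring
  constructor
  · constructor
    · exact fold_joint (a := p) (b := fun t y => - q t y) isClosed_Icc (fun t ht => (hb t ht 0 (Or.inl rfl)).1) (fun t ht => (hb t ht 1 (Or.inr rfl)).1) hp hq.neg
    · exact fold_joint (a := pt) (b := fun t y => - qt t y) isClosed_Icc (fun t ht => (hb t ht 0 (Or.inl rfl)).2.1) (fun t ht => (hb t ht 1 (Or.inr rfl)).2.1) hpt hqt.neg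
    · intro t ht x
      have hx := hflo x
      rcases int_cases ⌊x⌋ with ⟨i, hi⟩ | ⟨i, hi⟩
      · rw [hi] at hx
        rw [fold_even (hb t ht 1 (Or.inr rfl)).2.1 hx]
        exact (dpt t ht _ ⟨by linarith [hx.1], by linarith [hx.2]⟩).congr
          (fun s hs => fold_even (hb s hs 1 (Or.inr rfl)).1 hx) (fold_even (hb t ht 1 (Or.inr rfl)).1 hx)
      · rw [hi, sub_add_cancel] at hx
        rw [fold_odd (hb t ht 0 (Or.inl rfl)).2.1 hx]
        exact (dqt t ht _ ⟨by linarith [hx.2], by linarith [hx.1]⟩).neg.congr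
          (fun s hs => fold_odd (hb s hs 0 (Or.inl rfl)).1 hx) (fold_odd (hb t ht 0 (Or.inl rfl)).1 hx)
    · intro t ht x
      rw [hder t ht]
      refine ⟨hdx t ht x, ?_⟩
      have hx := hflo x
      rcases int_cases ⌊x⌋ with ⟨i, hi⟩ | ⟨i, hi⟩
      · rw [hi] at hx
        rw [lev t ht i x hx, fold_even (hb t ht 1 (Or.inr rfl)).2.1 hx, fold_even (hb t ht 1 (Or.inr rfl)).2.2.1 hx,
          ep t ht _ ⟨by linarith [hx.1], by linarith [hx.2]⟩]
      · rw [hi, sub_add_cancel] at hx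
        rw [lod t ht i x hx, fold_odd (hb t ht 0 (Or.inl rfl)).2.1 hx, fold_odd (hb t ht 0 (Or.inl rfl)).2.2.1 hx,
          eq t ht _ ⟨by linarith [hx.2], by linarith [hx.1]⟩]
        ring
    · intro t ht
      rw [hder t ht]
      exact fold_cont (hb t ht 0 (Or.inl rfl)).2.2.1 (hb t ht 1 (Or.inr rfl)).2.2.1 (hpx t ht) (hqx t ht)
    · intro t ht x; exact fold_per _ _ x
    · intro t ht x; exact fold_per _ _ x
  · intro t ht j
    rcases int_cases j with ⟨i, hi⟩ | ⟨i, hi⟩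
    · rw [hi, lev t ht i _ ⟨by linarith, by linarith⟩]
      have := hb t ht 0 (Or.inl rfl)
      rw [sub_self]; linarith [this.1, this.2.2.2]
    · rw [hi, lod t ht i _ ⟨by linarith, by linarith⟩]
      have := hb t ht 1 (Or.inr rfl)
      rw [show 2 * (i:ℝ) - (2 * i - 1) = 1 by ring]; linarith [this.1, this.2.2.2]

lemma idw_mul_le {f g : ℝ → ℝ} {r : ℕ} {M N : ℝ} (hM : 0 ≤ M) (hN : 0 ≤ N) (hf : ContDiffOn ℝ r f (Icc 0 1)) (hg : ContDiffOn ℝ r g (Icc 0 1))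
    (h1 : ∀ i ≤ r, ∀ y ∈ Icc (0:ℝ) 1, |iteratedDerivWithin i f (Icc 0 1) y| ≤ M)
    (h2 : ∀ i ≤ r, ∀ y ∈ Icc (0:ℝ) 1, |iteratedDerivWithin i g (Icc 0 1) y| ≤ N) :
    ∀ i ≤ r, ∀ y ∈ Icc (0:ℝ) 1, |iteratedDerivWithin i (fun y => f y * g y) (Icc 0 1) y| ≤ 2^r * (M * N) := by
  intro i hi y hy
  have := norm_iteratedFDerivWithin_mul_le (𝕜 := ℝ) hf hg (uniqueDiffOn_Icc one_pos) hy (n := i) (by exact_mod_cast hi)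
  simp only [norm_iteratedFDerivWithin_eq_norm_iteratedDerivWithin, Real.norm_eq_abs] at this
  refine this.trans ?_
  calc _ ≤ ∑ j ∈ Finset.range (i+1), (i.choose j : ℝ) * (M * N) := by
        refine Finset.sum_le_sum fun j hj => ?_
        have hj' : j ≤ i := by simpa [Nat.lt_succ_iff] using hj
        rw [mul_assoc]
        refine mul_le_mul_of_nonneg_left ?_ (by positivity)
        exact mul_le_mul (h1 j (by omega) y hy) (h2 _ (by omega) y hy) (abs_nonneg _) hM
    _ = 2^i * (M * N) := by
        rw [← Finset.sum_mul]; congr 1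
        exact_mod_cast Nat.sum_range_choose i
    _ ≤ _ := by
        refine mul_le_mul_of_nonneg_right ?_ (by positivity)
        exact pow_le_pow_right₀ (by norm_num) hi

lemma idw_lin_le {f g : ℝ → ℝ} {r : ℕ} {M N a b : ℝ} (hf : ContDiffOn ℝ r f (Icc 0 1)) (hg : ContDiffOn ℝ r g (Icc 0 1))
    (h1 : ∀ i ≤ r, ∀ y ∈ Icc (0:ℝ) 1, |iteratedDerivWithin i f (Icc 0 1) y| ≤ M)
    (h2 : ∀ i ≤ r, ∀ y ∈ Icc (0:ℝ) 1, |iteratedDerivWithin i g (Icc 0 1) y| ≤ N) :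
    ∀ i ≤ r, ∀ y ∈ Icc (0:ℝ) 1, |iteratedDerivWithin i (fun y => a * f y + b * g y) (Icc 0 1) y| ≤ |a| * M + |b| * N := by
  intro i hi y hy
  have hf' : ContDiffWithinAt ℝ i f (Icc 0 1) y := (hf.of_le (by exact_mod_cast hi)) y hy
  have hg' : ContDiffWithinAt ℝ i g (Icc 0 1) y := (hg.of_le (by exact_mod_cast hi)) y hy
  have hu := uniqueDiffOn_Icc (one_pos (α := ℝ))
  rw [iteratedDerivWithin_fun_add hy hu (contDiffWithinAt_const.mul hf') (contDiffWithinAt_const.mul hg'),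
    iteratedDerivWithin_const_mul hy hu a hf', iteratedDerivWithin_const_mul hy hu b hg']
  refine (abs_add_le _ _).trans ?_
  rw [abs_mul, abs_mul]
  exact add_le_add (mul_le_mul_of_nonneg_left (h1 i hi y hy) (abs_nonneg _)) (mul_le_mul_of_nonneg_left (h2 i hi y hy) (abs_nonneg _))

theorem reg_final (r : ℕ) (hr : 1 ≤ r) (T : ℝ) (hT : 0 < T)
    (ηs us : ℕ → ℝ → ℝ → ℝ)
    (hηsm : SmoothChain T r 1 ηs) (husm : SmoothChain T r 1 us)
    (hsol : SW T (ηs 0) (us 0) (ηs 1) (us 1))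
    (hpos : ∀ y ∈ Icc (0:ℝ) 1, ∀ t ∈ Icc (0:ℝ) T, 0 < 1 + ηs 0 y t) :
    ∃ M, 0 ≤ M ∧ ∀ t ∈ Icc 0 T, ∀ i ≤ r, ∀ y ∈ Icc (0:ℝ) 1,
      |iteratedDerivWithin i (fun z => ηs 0 z t) (Icc 0 1) y| ≤ M ∧
      |iteratedDerivWithin i (fun z => us 0 z t) (Icc 0 1) y| ≤ M := by
  obtain ⟨ηd, ηsp, ηj⟩ := hηsm
  obtain ⟨ud, usp, uj⟩ := husm
  obtain ⟨hpde, hbc⟩ := hsol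
  set c : ℝ → ℝ → ℝ := fun t y => Real.sqrt (1 + ηs 0 y t) with hc
  have hu := uniqueDiffOn_Icc (one_pos (α := ℝ))
  set ηx : ℝ → ℝ → ℝ := fun t y => derivWithin (fun z => ηs 0 z t) (Icc 0 1) y with hηx
  set ux : ℝ → ℝ → ℝ := fun t y => derivWithin (fun z => us 0 z t) (Icc 0 1) y with hux
  have dη : ∀ t ∈ Icc 0 T, ∀ y ∈ Icc (0:ℝ) 1, HasDerivWithinAt (fun z => ηs 0 z t) (ηx t y) (Icc 0 1) y :=
    fun t ht y hy => ((ηsp 0 (by norm_num) t ht).differentiableOn (by norm_cast; omega) y hy).hasDerivWithinAt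
  have du : ∀ t ∈ Icc 0 T, ∀ y ∈ Icc (0:ℝ) 1, HasDerivWithinAt (fun z => us 0 z t) (ux t y) (Icc 0 1) y :=
    fun t ht y hy => ((usp 0 (by norm_num) t ht).differentiableOn (by norm_cast; omega) y hy).hasDerivWithinAt
  have cη : ∀ t ∈ Icc 0 T, ContinuousOn (ηx t) (Icc 0 1) := fun t ht =>
    (ηsp 0 (by norm_num) t ht).continuousOn_derivWithin hu (by norm_cast)
  have cu : ∀ t ∈ Icc 0 T, ContinuousOn (ux t) (Icc 0 1) := fun t ht =>
    (usp 0 (by norm_num) t ht).continuousOn_derivWithin hu (by norm_cast)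
  have cpos : ∀ t ∈ Icc 0 T, ∀ y ∈ Icc (0:ℝ) 1, 0 < c t y := fun t ht y hy => Real.sqrt_pos.2 (hpos y hy t ht)
  have csq : ∀ t ∈ Icc 0 T, ∀ y ∈ Icc (0:ℝ) 1, c t y * c t y = 1 + ηs 0 y t := fun t ht y hy =>
    Real.mul_self_sqrt (hpos y hy t ht).le
  have e1 : ∀ t ∈ Icc 0 T, ∀ y ∈ Icc (0:ℝ) 1, ηs 1 y t = - ((1 + ηs 0 y t) * ux t y + us 0 y t * ηx t y) := by
    intro t ht y hy
    have := (hpde y hy t ht).1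
    have h2 : derivWithin (fun z => ηs 0 z t * us 0 z t) (Icc 0 1) y = ηx t y * us 0 y t + ηs 0 y t * ux t y :=
      ((dη t ht y hy).mul (du t ht y hy)).derivWithin (hu y hy)
    rw [h2] at this
    simp only [hux, hηx] at *; linarith
  have e2 : ∀ t ∈ Icc 0 T, ∀ y ∈ Icc (0:ℝ) 1, us 1 y t = - (ηx t y + us 0 y t * ux t y) := by
    intro t ht y hy
    have := (hpde y hy t ht).2
    simp only [hux, hηx]; linarith
  -- swap continuity
  have swapc : ∀ f : ℝ → ℝ → ℝ, ContinuousOn (fun p : ℝ × ℝ => f p.1 p.2) ((Icc (0:ℝ) 1) ×ˢ (Icc (0:ℝ) T)) →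
      ContinuousOn (fun p : ℝ × ℝ => f p.2 p.1) ((Icc (0:ℝ) T) ×ˢ (Icc (0:ℝ) 1)) := fun f hf =>
    hf.comp continuous_swap.continuousOn (fun p hp => ⟨hp.2, hp.1⟩)
  have Jη := swapc _ (ηj 0 (by norm_num))
  have Jηt := swapc _ (ηj 1 (by norm_num))
  have Ju := swapc _ (uj 0 (by norm_num))
  have Jut := swapc _ (uj 1 (by norm_num))
  have Jc : ContinuousOn (fun p : ℝ × ℝ => c p.1 p.2) ((Icc (0:ℝ) T) ×ˢ (Icc (0:ℝ) 1)) :=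
    (continuousOn_const.add Jη).sqrt
  have Jq : ContinuousOn (fun p : ℝ × ℝ => ηs 1 p.2 p.1 / c p.1 p.2) ((Icc (0:ℝ) T) ×ˢ (Icc (0:ℝ) 1)) :=
    Jηt.div Jc (fun p hp => (cpos _ hp.1 _ hp.2).ne')
  have dct : ∀ t ∈ Icc 0 T, ∀ y ∈ Icc (0:ℝ) 1, HasDerivWithinAt (fun s => 2 * c s y) (ηs 1 y t / c t y) (Icc 0 T) t := by
    intro t ht y hy
    have := (((ηd 0 (by norm_num) y hy t ht).const_add 1).sqrt (hpos y hy t ht).ne').const_mul 2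
    refine this.congr_deriv ?_
    have := cpos t ht y hy
    simp only [hc] at *; field_simp
  have dcx : ∀ t ∈ Icc 0 T, ∀ y ∈ Icc (0:ℝ) 1, HasDerivWithinAt (fun z => 2 * c t z) (ηx t y / c t y) (Icc 0 1) y := by
    intro t ht y hy
    have := (((dη t ht y hy).const_add 1).sqrt (hpos y hy t ht).ne').const_mul 2
    refine this.congr_deriv ?_
    have := cpos t ht y hy
    simp only [hc] at *; field_simp
  have Cc : ∀ t ∈ Icc 0 T, ContDiffOn ℝ r (c t) (Icc 0 1) := fun t ht =>
    (contDiffOn_const.add (ηsp 0 (by norm_num) t ht)).sqrt (fun y hy => (hpos y hy t ht).ne')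
  have ccx : ∀ t ∈ Icc 0 T, ContinuousOn (fun y => ηx t y / c t y) (Icc 0 1) := fun t ht =>
    (cη t ht).div (Cc t ht).continuousOn (fun y hy => (cpos t ht y hy).ne')
  obtain ⟨hS, hne⟩ := fold_sol (T := T) (p := fun t y => us 0 y t + 2 * c t y) (q := fun t y => us 0 y t - 2 * c t y)
    (pt := fun t y => us 1 y t + ηs 1 y t / c t y) (qt := fun t y => us 1 y t - ηs 1 y t / c t y)
    (px := fun t y => ux t y + ηx t y / c t y) (qx := fun t y => ux t y - ηx t y / c t y)
    (Ju.add (continuousOn_const.mul Jc)) (Ju.sub (continuousOn_const.mul Jc)) (Jut.add Jq) (Jut.sub Jq)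
    (fun t ht => (cu t ht).add (ccx t ht)) (fun t ht => (cu t ht).sub (ccx t ht))
    (fun t ht y hy => (ud 0 (by norm_num) y hy t ht).add (dct t ht y hy))
    (fun t ht y hy => (ud 0 (by norm_num) y hy t ht).sub (dct t ht y hy))
    (fun t ht y hy => (du t ht y hy).add (dcx t ht y hy))
    (fun t ht y hy => (du t ht y hy).sub (dcx t ht y hy))
    (by
      intro t ht y hy
      have h1 := (cpos t ht y hy).ne'
      have h2 := csq t ht y hy

      rw [e1 t ht y hy, e2 t ht y hy, ← h2]
      field_simp; ring)
    (by
      intro t ht y hy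
      have h1 := (cpos t ht y hy).ne'
      have h2 := csq t ht y hy

      rw [e1 t ht y hy, e2 t ht y hy, ← h2]
      field_simp; ring)
    (by
      intro t ht y hy
      have hyI : y ∈ Icc (0:ℝ) 1 := by rcases hy with rfl | rfl <;> simp
      have hu0 : ∀ s ∈ Icc 0 T, us 0 y s = 0 := by
        intro s hs; rcases hy with rfl | rfl
        exacts [(hbc s hs).1, (hbc s hs).2]
      have hut : us 1 y t = 0 := by
        have h1 := ud 0 (by norm_num) y hyI t ht
        have h2 : HasDerivWithinAt (fun s => us 0 y s) 0 (Icc 0 T) t :=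
          (hasDerivWithinAt_const t (Icc 0 T) (0:ℝ)).congr (fun s hs => hu0 s hs) (hu0 t ht)
        exact (uniqueDiffOn_Icc hT t ht).eq_deriv _ h1 h2
      have hx0 : ηx t y = 0 := by
        have := e2 t ht y hyI
        rw [hut, hu0 t ht] at this; linarith
      have := cpos t ht y hyI

      rw [hu0 t ht, hut, hx0]
      refine ⟨by ring, by ring, by ring, by linarith⟩)
  have hb1 : ∀ t ∈ Icc 0 T, us 0 0 t + 2 * c t 0 = - (us 0 0 t - 2 * c t 0) := fun t ht => by
    rw [(hbc t ht).1]; ring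
  have hb2 : ∀ t ∈ Icc 0 T, us 0 1 t + 2 * c t 1 = - (us 0 1 t - 2 * c t 1) := fun t ht => by
    rw [(hbc t ht).2]; ring
  have Cp : ∀ t ∈ Icc 0 T, ContDiffOn ℝ r (fun y => us 0 y t + 2 * c t y) (Icc 0 1) := fun t ht =>
    (usp 0 (by norm_num) t ht).add (contDiffOn_const.mul (Cc t ht))
  have Cq : ∀ t ∈ Icc 0 T, ContDiffOn ℝ r (fun y => us 0 y t - 2 * c t y) (Icc 0 1) := fun t ht =>
    (usp 0 (by norm_num) t ht).sub (contDiffOn_const.mul (Cc t ht))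
  obtain ⟨-, κ, hκ, hD⟩ := reg_ind hT hS (r := r) (fun t ht => fold_Pc (hb1 t ht) (hb2 t ht) (Cp t ht) (Cq t ht).neg)
    hne (r - 1) (by omega)
  obtain ⟨B, hB0, hB⟩ := bdd_of_per hS.c hS.per
  set M := max κ B with hMdef
  have hM0 : 0 ≤ M := hκ.trans (le_max_left _ _)
  have hDB : ∀ t ∈ Icc 0 T, ∀ i ≤ r, DB (fold (fun y => us 0 y t + 2 * c t y) (fun y => - (us 0 y t - 2 * c t y))) i M := by
    intro t ht i hi
    rcases Nat.eq_zero_or_pos i with rfl | hp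
    · intro ε hε x
      rw [fd_zero, pow_zero, mul_one]
      exact (hB t ht x).trans (le_max_right _ _)
    · exact (hD t ht i hp (by omega)).mono (le_max_left _ _)
  have bp : ∀ t ∈ Icc 0 T, ∀ i ≤ r, ∀ y ∈ Icc (0:ℝ) 1,
      |iteratedDerivWithin i (fun y => us 0 y t + 2 * c t y) (Icc 0 1) y| ≤ M := by
    intro t ht i hi y hy
    have hcg : EqOn (fun y => us 0 y t + 2 * c t y)
        (fold (fun y => us 0 y t + 2 * c t y) (fun y => - (us 0 y t - 2 * c t y))) (Icc 0 1) := by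
      intro z hz
      rw [fold_even (i := 0) (hb2 t ht) (by simpa using hz)]; simp
    rw [iteratedDerivWithin_congr hcg hy]
    refine idw_le_closed one_pos ?_ (hDB t ht i hi) hy
    exact ((Cp t ht).of_le (by exact_mod_cast hi)).congr (fun z hz => (hcg hz).symm)
  have bq : ∀ t ∈ Icc 0 T, ∀ i ≤ r, ∀ y ∈ Icc (0:ℝ) 1,
      |iteratedDerivWithin i (fun y => us 0 y t - 2 * c t y) (Icc 0 1) y| ≤ M := by
    intro t ht i hi y hy
    have hcg : EqOn (fun y => us 0 y t - 2 * c t y)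
        (fun x => - fold (fun y => us 0 y t + 2 * c t y) (fun y => - (us 0 y t - 2 * c t y)) (-x)) (Icc 0 1) := by
      intro z hz
      dsimp only
      rw [fold_odd (i := 0) (hb1 t ht) (by simp; exact ⟨hz.2, hz.1⟩)]; simp
    rw [iteratedDerivWithin_congr hcg hy]
    refine idw_le_closed one_pos ?_ (hDB t ht i hi).refl hy
    exact ((Cq t ht).of_le (by exact_mod_cast hi)).congr (fun z hz => (hcg hz).symm)
  refine ⟨(M + 2^r * (M * M)) + 1, by positivity, fun t ht i hi y hy => ⟨?_, ?_⟩⟩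
  · have hz1 := idw_lin_le (a := 1/4) (b := -(1/4)) (Cp t ht) (Cq t ht) (bp t ht) (bq t ht)
    have C1 : ContDiffOn ℝ r (fun y => (1/4) * (us 0 y t + 2 * c t y) + (-(1/4)) * (us 0 y t - 2 * c t y)) (Icc 0 1) :=
      (contDiffOn_const.mul (Cp t ht)).add (contDiffOn_const.mul (Cq t ht))
    have hz2 : ∀ i ≤ r, ∀ y ∈ Icc (0:ℝ) 1, |iteratedDerivWithin i (fun y => (1/4) * (us 0 y t + 2 * c t y) + (-(1/4)) * (us 0 y t - 2 * c t y)) (Icc 0 1) y| ≤ M := by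
      intro i hi y hy
      refine (hz1 i hi y hy).trans ?_
      rw [abs_neg, abs_of_pos (by norm_num : (0:ℝ) < 1/4)]; linarith
    have hz3 := idw_mul_le hM0 hM0 C1 C1 hz2 hz2
    have h1 : ∀ i ≤ r, ∀ y ∈ Icc (0:ℝ) 1, |iteratedDerivWithin i (fun _ => (1:ℝ)) (Icc 0 1) y| ≤ 1 := by
      intro i hi y hy
      rw [iteratedDerivWithin_const]
      split_ifs <;> simp
    have hz4 := idw_lin_le (a := 1) (b := -1) (C1.mul C1) contDiffOn_const hz3 h1 i hi y hy
    rw [show |(1:ℝ)| * (2^r * (M * M)) + |(-1:ℝ)| * 1 = 2^r * (M * M) + 1 by simp] at hz4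
    have hcg : EqOn (fun z => ηs 0 z t) (fun y => 1 * (((1/4) * (us 0 y t + 2 * c t y) + (-(1/4)) * (us 0 y t - 2 * c t y)) *
      ((1/4) * (us 0 y t + 2 * c t y) + (-(1/4)) * (us 0 y t - 2 * c t y))) + (-1) * 1) (Icc 0 1) := by
      intro z hz
      have := csq t ht z hz
      dsimp only; nlinarith
    rw [iteratedDerivWithin_congr hcg hy]
    exact hz4.trans (by linarith)
  · have hz1 := idw_lin_le (a := 1/2) (b := 1/2) (Cp t ht) (Cq t ht) (bp t ht) (bq t ht) i hi y hy
    have hcg : EqOn (fun z => us 0 z t) (fun y => (1/2) * (us 0 y t + 2 * c t y) + (1/2) * (us 0 y t - 2 * c t y)) (Icc 0 1) := by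
      intro z hz; dsimp only; ring
    rw [iteratedDerivWithin_congr hcg hy]
    refine hz1.trans ?_
    rw [abs_of_pos (by norm_num : (0:ℝ) < 1/2)]
    have : 0 ≤ 2^r * (M * M) := by positivity
    linarith

/-- Lebesgue measure on the unit interval. -/
abbrev mu : MeasureTheory.Measure ℝ := MeasureTheory.volume.restrict (Ioc (0:ℝ) 1)

/-- essentially bounded functions on the unit interval -/
@[fun_prop]
def Bd (f : ℝ → ℝ) : Prop :=
  MeasureTheory.AEStronglyMeasurable f mu ∧ ∃ C : ℝ, ∀ᵐ y ∂mu, |f y| ≤ C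

@[fun_prop]
theorem Bd.const (c : ℝ) : Bd (fun _ => c) :=
  ⟨by fun_prop, |c|, Filter.Eventually.of_forall fun _ => le_rfl⟩

@[fun_prop]
theorem Bd.add {f g : ℝ → ℝ} (hf : Bd f) (hg : Bd g) : Bd (fun y => f y + g y) := by
  obtain ⟨hf1, C, hC⟩ := hf
  obtain ⟨hg1, D, hD⟩ := hg
  refine ⟨hf1.add hg1, C + D, ?_⟩
  filter_upwards [hC, hD] with y h1 h2
  exact (abs_add_le _ _).trans (add_le_add h1 h2)

@[fun_prop]
theorem Bd.neg {f : ℝ → ℝ} (hf : Bd f) : Bd (fun y => - f y) := by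
  obtain ⟨hf1, C, hC⟩ := hf
  refine ⟨hf1.neg, C, ?_⟩
  filter_upwards [hC] with y h1
  rwa [abs_neg]

@[fun_prop]
theorem Bd.sub {f g : ℝ → ℝ} (hf : Bd f) (hg : Bd g) : Bd (fun y => f y - g y) := by
  simpa [sub_eq_add_neg] using hf.add hg.neg

@[fun_prop]
theorem Bd.mul {f g : ℝ → ℝ} (hf : Bd f) (hg : Bd g) : Bd (fun y => f y * g y) := by
  obtain ⟨hf1, C, hC⟩ := hf
  obtain ⟨hg1, D, hD⟩ := hg
  refine ⟨hf1.mul hg1, C * D, ?_⟩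
  filter_upwards [hC, hD] with y h1 h2
  rw [abs_mul]
  exact mul_le_mul h1 h2 (abs_nonneg _) ((abs_nonneg _).trans h1)

@[fun_prop]
theorem Bd.pow {f : ℝ → ℝ} (hf : Bd f) (n : ℕ) : Bd (fun y => f y ^ n) := by
  induction n with
  | zero => simpa using Bd.const 1
  | succ n ih => simpa [pow_succ] using ih.mul hf

@[fun_prop]
theorem Bd.sum {ι : Type} (s : Finset ι) {f : ι → ℝ → ℝ} (hf : ∀ i, Bd (f i)) :
    Bd (fun y => ∑ i ∈ s, f i y) := by
  classical
  induction s using Finset.induction_on with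
  | empty => simpa using Bd.const 0
  | insert a s ha ih => 
    simp only [Finset.sum_insert ha]
    exact (hf a).add ih

theorem Bd.congr {f g : ℝ → ℝ} (hf : Bd f) (h : f =ᵐ[mu] g) : Bd g := by
  obtain ⟨hf1, C, hC⟩ := hf
  refine ⟨hf1.congr h, C, ?_⟩
  filter_upwards [hC, h] with y h1 h2
  rwa [← h2]

theorem Bd.integrable {f : ℝ → ℝ} (hf : Bd f) : MeasureTheory.Integrable f mu := by
  obtain ⟨hf1, C, hC⟩ := hf
  exact MeasureTheory.Integrable.of_bound hf1 C (by simpa using hC)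

theorem Bd.ii {f : ℝ → ℝ} (hf : Bd f) : IntervalIntegrable f MeasureTheory.volume 0 1 := by
  rw [intervalIntegrable_iff_integrableOn_Ioc_of_le zero_le_one]
  exact hf.integrable

theorem Bd.ii' {f : ℝ → ℝ} (hf : Bd f) {a b : ℝ} (ha : 0 ≤ a) (ha1 : a ≤ 1) (hb : 0 ≤ b)
    (hb1 : b ≤ 1) :
    IntervalIntegrable f MeasureTheory.volume a b := by
  refine hf.ii.mono_set ?_
  rw [uIcc_of_le (zero_le_one : (0:ℝ) ≤ 1)]
  exact uIcc_subset_Icc ⟨ha, ha1⟩ ⟨hb, hb1⟩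

theorem Bd.of_cont {f : ℝ → ℝ} (hf : ContinuousOn f (Icc 0 1)) : Bd f := by
  refine ⟨(hf.mono Ioc_subset_Icc_self).aestronglyMeasurable measurableSet_Ioc, ?_⟩
  obtain ⟨C, hC⟩ := isCompact_Icc.exists_bound_of_continuousOn hf
  refine ⟨C, ?_⟩
  refine (MeasureTheory.ae_restrict_iff' measurableSet_Ioc).2 (Filter.Eventually.of_forall ?_)
  intro y hy
  exact hC y (Ioc_subset_Icc_self hy)

theorem ae_mu_of {p : ℝ → Prop} (h : ∀ y ∈ Icc (0:ℝ) 1, p y) : ∀ᵐ y ∂mu, p y :=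
  (MeasureTheory.ae_restrict_iff' measurableSet_Ioc).2
    (Filter.Eventually.of_forall fun y hy => h y (Ioc_subset_Icc_self hy))

theorem ae_mu_off {p : ℝ → Prop} {s : Set ℝ} (hs : s.Countable) (h : ∀ y ∈ Ioo (0:ℝ) 1 \ s, p y) :
    ∀ᵐ y ∂mu, p y := by
  refine (MeasureTheory.ae_restrict_iff' measurableSet_Ioc).2 ?_
  have h1 := (hs.union (countable_singleton (1:ℝ))).ae_notMem MeasureTheory.volume
  filter_upwards [h1] with y hy hy2
  simp only [mem_union, mem_singleton_iff, not_or] at hy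
  exact h y ⟨⟨hy2.1, lt_of_le_of_ne hy2.2 hy.2⟩, hy.1⟩

theorem int01 (f : ℝ → ℝ) : ∫ y in (0:ℝ)..1, f y = ∫ y, f y ∂mu :=
  intervalIntegral.integral_of_le zero_le_one

theorem ip_eq (f g : ℝ → ℝ) : ip f g = ∫ y, f y * g y ∂mu := int01 _

theorem ip_comm (f g : ℝ → ℝ) : ip f g = ip g f := by
  simp only [ip, mul_comm]

theorem ip_congr {f g f' g' : ℝ → ℝ} (h : f =ᵐ[mu] f') (h' : g =ᵐ[mu] g') : ip f g = ip f' g' := by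
  rw [ip_eq, ip_eq]
  apply MeasureTheory.integral_congr_ae
  filter_upwards [h, h'] with y h1 h2
  rw [h1, h2]

theorem ip_add {f g φ : ℝ → ℝ} (hf : Bd f) (hg : Bd g) (hφ : Bd φ) :
    ip (fun y => f y + g y) φ = ip f φ + ip g φ := by
  simp only [ip_eq]
  rw [← MeasureTheory.integral_add (hf.mul hφ).integrable (hg.mul hφ).integrable]
  simp only [add_mul]

theorem ip_sub {f g φ : ℝ → ℝ} (hf : Bd f) (hg : Bd g) (hφ : Bd φ) :
    ip (fun y => f y - g y) φ = ip f φ - ip g φ := by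
  simp only [ip_eq]
  rw [← MeasureTheory.integral_sub (hf.mul hφ).integrable (hg.mul hφ).integrable]
  simp only [sub_mul]

theorem ip_smul (c : ℝ) (f φ : ℝ → ℝ) : ip (fun y => c * f y) φ = c * ip f φ := by
  simp only [ip_eq]
  rw [← MeasureTheory.integral_const_mul]
  simp only [mul_assoc]

theorem ip_smul_r (c : ℝ) (f φ : ℝ → ℝ) : ip f (fun y => c * φ y) = c * ip f φ := by
  rw [ip_comm, ip_smul, ip_comm]

theorem ip_add_r {f g φ : ℝ → ℝ} (hf : Bd f) (hg : Bd g) (hφ : Bd φ) :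
    ip φ (fun y => f y + g y) = ip φ f + ip φ g := by
  rw [ip_comm, ip_add hf hg hφ, ip_comm f, ip_comm g]

theorem ip_sub_r {f g φ : ℝ → ℝ} (hf : Bd f) (hg : Bd g) (hφ : Bd φ) :
    ip φ (fun y => f y - g y) = ip φ f - ip φ g := by
  rw [ip_comm, ip_sub hf hg hφ, ip_comm f, ip_comm g]

theorem ip_sum {ι : Type} (s : Finset ι) {f : ι → ℝ → ℝ} {φ : ℝ → ℝ} (hf : ∀ i, Bd (f i))
    (hφ : Bd φ) : ip (fun y => ∑ i ∈ s, f i y) φ = ∑ i ∈ s, ip (f i) φ := by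
  simp only [ip_eq]
  rw [← MeasureTheory.integral_finset_sum s (fun i _ => ((hf i).mul hφ).integrable)]
  simp only [Finset.sum_mul]

theorem ip_self_nonneg (f : ℝ → ℝ) : 0 ≤ ip f f := by
  rw [ip_eq]
  exact MeasureTheory.integral_nonneg fun y => mul_self_nonneg _

theorem nrm_nonneg (f : ℝ → ℝ) : 0 ≤ nrm f := Real.sqrt_nonneg _

theorem nrm_sq (f : ℝ → ℝ) : nrm f ^ 2 = ip f f := by
  have h : ∫ y in (0:ℝ)..1, (f y)^2 = ip f f := by simp only [ip, sq]
  rw [nrm, h, Real.sq_sqrt (ip_self_nonneg f)]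

theorem nrm_sq_int (f : ℝ → ℝ) : nrm f ^ 2 = ∫ y, f y ^ 2 ∂mu := by
  rw [nrm_sq, ip_eq]; simp only [sq]

theorem nrm_congr {f g : ℝ → ℝ} (h : f =ᵐ[mu] g) : nrm f = nrm g := by
  rw [← abs_of_nonneg (nrm_nonneg f), ← abs_of_nonneg (nrm_nonneg g)]
  apply (sq_eq_sq_iff_abs_eq_abs _ _).1
  rw [nrm_sq, nrm_sq, ip_congr h h]

/-- Cauchy-Schwarz for a general measure -/
theorem cs_meas {μ : MeasureTheory.Measure ℝ} {f g : ℝ → ℝ}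
    (hf : MeasureTheory.Integrable (fun y => f y ^ 2) μ)
    (hg : MeasureTheory.Integrable (fun y => g y ^ 2) μ)
    (hfg : MeasureTheory.Integrable (fun y => f y * g y) μ) :
    (∫ y, f y * g y ∂μ) ^ 2 ≤ (∫ y, f y ^ 2 ∂μ) * ∫ y, g y ^ 2 ∂μ := by
  have h : ∀ x : ℝ, 0 ≤ (∫ y, f y ^ 2 ∂μ) * (x * x) + (2 * ∫ y, f y * g y ∂μ) * x
      + ∫ y, g y ^ 2 ∂μ := by
    intro x
    have h1 : 0 ≤ ∫ y, (x * x) * (f y ^ 2) + (2 * x) * (f y * g y) + g y ^ 2 ∂μ := by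
      apply MeasureTheory.integral_nonneg
      intro y
      have : (x * x) * (f y ^ 2) + (2 * x) * (f y * g y) + g y ^ 2 = (x * f y + g y) ^ 2 := by ring
      simp only [this]
      exact sq_nonneg _
    have hi : MeasureTheory.Integrable (fun y => (x * x) * (f y ^ 2) + (2 * x) * (f y * g y)) μ :=
      (hf.const_mul _).add (hfg.const_mul _)
    rw [MeasureTheory.integral_add hi hg,
      MeasureTheory.integral_add (hf.const_mul _) (hfg.const_mul _),
      MeasureTheory.integral_const_mul, MeasureTheory.integral_const_mul] at h1
    linarith
  have := discrim_le_zero h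
  unfold discrim at this
  nlinarith

theorem ip_cs {f g : ℝ → ℝ} (hf : Bd f) (hg : Bd g) : |ip f g| ≤ nrm f * nrm g := by
  apply abs_le_of_sq_le_sq _ (mul_nonneg (nrm_nonneg _) (nrm_nonneg _))
  rw [mul_pow, nrm_sq_int, nrm_sq_int, ip_eq]
  exact cs_meas (hf.pow 2).integrable (hg.pow 2).integrable (hf.mul hg).integrable

theorem nrm_add_le {f g : ℝ → ℝ} (hf : Bd f) (hg : Bd g) :
    nrm (fun y => f y + g y) ≤ nrm f + nrm g := by
  apply le_of_sq_le_sq _ (add_nonneg (nrm_nonneg _) (nrm_nonneg _))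
  rw [nrm_sq, ip_add hf hg (hf.add hg), ip_add_r hf hg hf, ip_add_r hf hg hg, ← nrm_sq, ← nrm_sq,
    ip_comm g f]
  nlinarith [le_abs_self (ip f g), ip_cs hf hg]

theorem nrm_smul (c : ℝ) (f : ℝ → ℝ) : nrm (fun y => c * f y) = |c| * nrm f := by
  apply (pow_left_inj₀ (nrm_nonneg _) (mul_nonneg (abs_nonneg _) (nrm_nonneg _)) two_ne_zero).1
  rw [nrm_sq, ip_smul, ip_smul_r, mul_pow, sq_abs, nrm_sq]; ring

theorem nrm_neg (f : ℝ → ℝ) : nrm (fun y => - f y) = nrm f := by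
  simpa using nrm_smul (-1) f

theorem nrm_sub_comm (f g : ℝ → ℝ) : nrm (fun y => f y - g y) = nrm (fun y => g y - f y) := by
  rw [← nrm_neg]; simp

theorem nrm_sub_le {f g : ℝ → ℝ} (hf : Bd f) (hg : Bd g) :
    nrm (fun y => f y - g y) ≤ nrm f + nrm g := by
  simpa [sub_eq_add_neg, nrm_neg] using nrm_add_le hf hg.neg

theorem nrm_sub_le3 {f g k : ℝ → ℝ} (hf : Bd f) (hg : Bd g) (hk : Bd k) :
    nrm (fun y => f y - k y) ≤ nrm (fun y => f y - g y) + nrm (fun y => g y - k y) := by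
  have := nrm_add_le (hf.sub hg) (hg.sub hk)
  simpa using this

theorem nrm_mono {f g : ℝ → ℝ} (hf : Bd f) (hg : Bd g) (h : ∀ᵐ y ∂mu, |f y| ≤ |g y|) :
    nrm f ≤ nrm g := by
  apply le_of_sq_le_sq _ (nrm_nonneg _)
  rw [nrm_sq_int, nrm_sq_int]
  apply MeasureTheory.integral_mono_ae (hf.pow 2).integrable (hg.pow 2).integrable
  filter_upwards [h] with y hy
  exact sq_le_sq.2 hy

theorem nrm_const (c : ℝ) : nrm (fun _ => c) = |c| := by
  apply (pow_left_inj₀ (nrm_nonneg _) (abs_nonneg _) two_ne_zero).1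
  rw [nrm_sq, ip]; simp [sq]

theorem nrm_le_of_bound {f : ℝ → ℝ} (hf : Bd f) {C : ℝ} (hC : 0 ≤ C) (h : ∀ᵐ y ∂mu, |f y| ≤ C) :
    nrm f ≤ C := by
  rw [← abs_of_nonneg hC, ← nrm_const]
  apply nrm_mono hf (Bd.const C)
  rwa [abs_of_nonneg hC]

theorem nrm_mul_le {f g : ℝ → ℝ} (hf : Bd f) (hg : Bd g) {C : ℝ} (hC : 0 ≤ C)
    (h : ∀ᵐ y ∂mu, |f y| ≤ C) : nrm (fun y => f y * g y) ≤ C * nrm g := by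
  rw [← abs_of_nonneg hC, ← nrm_smul]
  apply nrm_mono (hf.mul hg) ((Bd.const C).mul hg)
  filter_upwards [h] with y hy
  rw [abs_mul, abs_mul, abs_of_nonneg hC]
  exact mul_le_mul_of_nonneg_right hy (abs_nonneg _)

/-- piecewise differentiable continuous functions with bounded derivative -/
def PW (f f' : ℝ → ℝ) : Prop :=
  ContinuousOn f (Icc 0 1) ∧ Bd f' ∧
    ∃ s : Set ℝ, s.Countable ∧ ∀ y ∈ Ioo (0:ℝ) 1 \ s, HasDerivAt f (f' y) y

theorem PW.bd {f f' : ℝ → ℝ} (h : PW f f') : Bd f := Bd.of_cont h.1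
theorem PW.bd' {f f' : ℝ → ℝ} (h : PW f f') : Bd f' := h.2.1

theorem PW.const (c : ℝ) : PW (fun _ => c) (fun _ => 0) :=
  ⟨continuousOn_const, Bd.const 0, ∅, countable_empty, fun y _ => hasDerivAt_const y c⟩

theorem PW.add {f f' g g' : ℝ → ℝ} (hf : PW f f') (hg : PW g g') :
    PW (fun y => f y + g y) (fun y => f' y + g' y) := by
  obtain ⟨h1, h2, s, hs, h3⟩ := hf
  obtain ⟨k1, k2, t, ht, k3⟩ := hg
  refine ⟨h1.add k1, h2.add k2, s ∪ t, hs.union ht, fun y hy => ?_⟩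
  exact (h3 y ⟨hy.1, fun h => hy.2 (Or.inl h)⟩).add (k3 y ⟨hy.1, fun h => hy.2 (Or.inr h)⟩)

theorem PW.mul {f f' g g' : ℝ → ℝ} (hf : PW f f') (hg : PW g g') :
    PW (fun y => f y * g y) (fun y => f' y * g y + f y * g' y) := by
  have hb := hf.bd
  have hb' := hg.bd
  obtain ⟨h1, h2, s, hs, h3⟩ := hf
  obtain ⟨k1, k2, t, ht, k3⟩ := hg
  refine ⟨h1.mul k1, by fun_prop, s ∪ t, hs.union ht, fun y hy => ?_⟩
  exact (h3 y ⟨hy.1, fun h => hy.2 (Or.inl h)⟩).mul (k3 y ⟨hy.1, fun h => hy.2 (Or.inr h)⟩)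

theorem PW.neg {f f' : ℝ → ℝ} (hf : PW f f') :
    PW (fun y => - f y) (fun y => - f' y) := by
  obtain ⟨h1, h2, s, hs, h3⟩ := hf
  exact ⟨h1.neg, h2.neg, s, hs, fun y hy => (h3 y hy).neg⟩

theorem PW.sub {f f' g g' : ℝ → ℝ} (hf : PW f f') (hg : PW g g') :
    PW (fun y => f y - g y) (fun y => f' y - g' y) := by
  simpa [sub_eq_add_neg] using hf.add hg.neg

theorem PW.smul {f f' : ℝ → ℝ} (c : ℝ) (hf : PW f f') :
    PW (fun y => c * f y) (fun y => c * f' y) := by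
  simpa using (PW.const c).mul hf

theorem PW.sum {ι : Type} (s : Finset ι) {f f' : ι → ℝ → ℝ} (hf : ∀ i, PW (f i) (f' i)) :
    PW (fun y => ∑ i ∈ s, f i y) (fun y => ∑ i ∈ s, f' i y) := by
  classical
  induction s using Finset.induction_on with
  | empty => simpa using PW.const 0
  | insert a s ha ih =>
    simp only [Finset.sum_insert ha]
    exact (hf a).add ih

theorem PW.congr {f f' g : ℝ → ℝ} (hf : PW f f') (h : ∀ y ∈ Icc (0:ℝ) 1, g y = f y) : PW g f' := by
  obtain ⟨h1, h2, s, hs, h3⟩ := hf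
  refine ⟨h1.congr h, h2, s, hs, fun y hy => (h3 y hy).congr_of_eventuallyEq ?_⟩
  filter_upwards [Ioo_mem_nhds hy.1.1 hy.1.2] with z hz
  exact h z (Ioo_subset_Icc_self hz)

theorem PW.deriv_ae {f f' : ℝ → ℝ} (hf : PW f f') : deriv f =ᵐ[mu] f' := by
  obtain ⟨h1, h2, s, hs, h3⟩ := hf
  exact ae_mu_off hs fun y hy => (h3 y hy).deriv

theorem PW.unique {f f' g' : ℝ → ℝ} (hf : PW f f') (hg : PW f g') : f' =ᵐ[mu] g' :=
  hf.deriv_ae.symm.trans hg.deriv_ae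

theorem PW.ftc {f f' : ℝ → ℝ} (hf : PW f f') {a b : ℝ} (ha : 0 ≤ a) (hab : a ≤ b) (hb : b ≤ 1) :
    ∫ y in a..b, f' y = f b - f a := by
  obtain ⟨h1, h2, s, hs, h3⟩ := hf
  refine MeasureTheory.integral_eq_of_hasDerivAt_off_countable_of_le f f' hab hs
    (h1.mono (Icc_subset_Icc ha hb)) (fun y hy => h3 y ⟨⟨ha.trans_lt hy.1.1, hy.1.2.trans_le hb⟩, hy.2⟩)
    (h2.ii' ha (hab.trans hb) (ha.trans hab) hb)

theorem PW.ftc01 {f f' : ℝ → ℝ} (hf : PW f f') : ∫ y, f' y ∂mu = f 1 - f 0 := by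
  rw [← int01, hf.ftc le_rfl zero_le_one le_rfl]

/-- integration by parts -/
theorem PW.parts {f f' g g' : ℝ → ℝ} (hf : PW f f') (hg : PW g g') :
    ip f' g = f 1 * g 1 - f 0 * g 0 - ip f g' := by
  have := (hf.mul hg).ftc01
  rw [MeasureTheory.integral_add (hf.bd'.mul hg.bd).integrable (hf.bd.mul hg.bd').integrable,
    ← ip_eq, ← ip_eq] at this
  linarith

/-- local Poincare/Sobolev bound -/
theorem PW.local_sq {f f' : ℝ → ℝ} (hf : PW f f') {a b : ℝ} (ha : 0 ≤ a) (hab : a ≤ b) (hb : b ≤ 1)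
    {y : ℝ} (hy : y ∈ Icc a b) : (f y - f a) ^ 2 ≤ (b - a) * ∫ z in a..b, f' z ^ 2 := by
  have hy1 : y ≤ 1 := hy.2.trans hb
  have h0y : 0 ≤ y := ha.trans hy.1
  rw [← hf.ftc ha hy.1 hy1]
  have h2 := hf.bd'.pow 2
  have hc : (∫ z in a..y, f' z) ^ 2 ≤ (∫ z in a..y, f' z ^ 2) * ∫ z in a..y, (1:ℝ) ^ 2 := by
    rw [intervalIntegral.integral_of_le hy.1, intervalIntegral.integral_of_le hy.1,
      intervalIntegral.integral_of_le hy.1]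
    have := cs_meas (μ := MeasureTheory.volume.restrict (Ioc a y)) (f := f') (g := fun _ => 1)
      ((h2.ii' ha (hab.trans hb) h0y hy1).1) (by simp)
      (by simp only [mul_one]; exact (hf.bd'.ii' ha (hab.trans hb) h0y hy1).1)
    simpa using this
  have h3 : ∫ z in a..y, f' z ^ 2 ≤ ∫ z in a..b, f' z ^ 2 := by
    apply intervalIntegral.integral_mono_interval le_rfl hy.1 hy.2
    · exact Filter.Eventually.of_forall fun z => sq_nonneg _
    · exact h2.ii' ha (hab.trans hb) (ha.trans hab) hb
  have h4 : 0 ≤ ∫ z in a..y, f' z ^ 2 := 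
    intervalIntegral.integral_nonneg hy.1 fun z _ => sq_nonneg _
  have h5 : ∫ z in a..y, (1:ℝ) ^ 2 = y - a := by simp
  rw [h5] at hc
  have h6 : y - a ≤ b - a := by linarith [hy.2]
  calc _ ≤ _ := hc
    _ ≤ (∫ z in a..b, f' z ^ 2) * (b - a) := by
      apply mul_le_mul h3 h6 (by linarith [hy.1]) (h4.trans h3)
    _ = _ := mul_comm _ _

theorem PW.sup0 {f f' : ℝ → ℝ} (hf : PW f f') (h0 : f 0 = 0) {y : ℝ} (hy : y ∈ Icc (0:ℝ) 1) :
    |f y| ≤ nrm f' := by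
  apply abs_le_of_sq_le_sq _ (nrm_nonneg _)
  have := hf.local_sq le_rfl zero_le_one le_rfl hy
  rw [h0] at this
  rw [nrm_sq_int, ← int01]
  simpa using this

theorem PW.sup {f f' : ℝ → ℝ} (hf : PW f f') {y : ℝ} (hy : y ∈ Icc (0:ℝ) 1) :
    |f y| ≤ nrm f + 2 * nrm f' := by
  have h1 : ∀ z ∈ Icc (0:ℝ) 1, |f z - f 0| ≤ nrm f' := fun z hz =>
    (hf.sub (PW.const (f 0))).sup0 (by simp) hz |>.trans (by simp)
  have h2 : |f 0| ≤ nrm f + nrm f' := by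
    have h3 := nrm_sub_le hf.bd (hf.bd.sub (Bd.const (f 0)))
    have h4 : nrm (fun y => f y - f 0) ≤ nrm f' := nrm_le_of_bound (hf.bd.sub (Bd.const (f 0)))
      (nrm_nonneg _) (ae_mu_of h1)
    simp only [sub_sub_cancel] at h3
    rw [nrm_const] at h3
    linarith
  have := abs_add_le (f y - f 0) (f 0)
  rw [sub_add_cancel] at this
  linarith [h1 y hy]

/-- smooth functions -/
theorem PW.of_hasDeriv {f f' : ℝ → ℝ}
    (h : ∀ y ∈ Icc (0:ℝ) 1, HasDerivWithinAt f (f' y) (Icc 0 1) y)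
    (hc : ContinuousOn f' (Icc 0 1)) : PW f f' :=
  ⟨fun y hy => (h y hy).continuousWithinAt, Bd.of_cont hc, ∅, countable_empty, fun y hy =>
    (h y (Ioo_subset_Icc_self hy.1)).hasDerivAt (Icc_mem_nhds hy.1.1 hy.1.2)⟩

theorem Bd.memLp {f : ℝ → ℝ} (hf : Bd f) : MeasureTheory.MemLp f 2 mu := by
  obtain ⟨h1, C, hC⟩ := hf
  exact MeasureTheory.MemLp.of_bound h1 C (by simpa using hC)

/-- finite dimensional space of bounded functions -/
structure FSp (S : Set (ℝ → ℝ)) : Prop where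
  zero : (fun _ => 0) ∈ S
  add : ∀ f ∈ S, ∀ g ∈ S, (fun y => f y + g y) ∈ S
  smul : ∀ (c : ℝ), ∀ f ∈ S, (fun y => c * f y) ∈ S
  bd : ∀ f ∈ S, Bd f
  fin : ∃ (ι : Type) (_ : Fintype ι) (b : ι → ℝ → ℝ), (∀ i, Bd (b i)) ∧
    ∀ f ∈ S, ∃ c : ι → ℝ, f =ᵐ[mu] fun y => ∑ i, c i * b i y

theorem FSp.sub {S : Set (ℝ → ℝ)} (hS : FSp S) : ∀ f ∈ S, ∀ g ∈ S, (fun y => f y - g y) ∈ S := by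
  intro f hf g hg
  have := hS.add f hf _ (hS.smul (-1) g hg)
  simpa [sub_eq_add_neg] using this

theorem FSp.sum {S : Set (ℝ → ℝ)} (hS : FSp S) {ι : Type} (s : Finset ι) (e : ι → ℝ → ℝ)
    (he : ∀ i, e i ∈ S) (c : ι → ℝ) : (fun y => ∑ i ∈ s, c i * e i y) ∈ S := by
  classical
  induction s using Finset.induction_on with
  | empty => simpa using hS.zero
  | insert a s ha ih =>
    simp only [Finset.sum_insert ha]
    exact hS.add _ (hS.smul _ _ (he a)) _ ih

/-- orthonormal basis -/
structure ONB (S : Set (ℝ → ℝ)) (n : ℕ) (e : Fin n → ℝ → ℝ) : Prop where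
  mem : ∀ i, e i ∈ S
  orth : ∀ i j, ip (e i) (e j) = if i = j then 1 else 0
  repr : ∀ f ∈ S, f =ᵐ[mu] fun y => ∑ i, ip f (e i) * e i y

theorem lp_inner {f g : ℝ → ℝ} {F G : MeasureTheory.Lp ℝ 2 mu} (hf : F =ᵐ[mu] f) (hg : G =ᵐ[mu] g) :
    inner ℝ F G = ip f g := by
  rw [MeasureTheory.L2.inner_def, ip_eq]
  apply MeasureTheory.integral_congr_ae
  filter_upwards [hf, hg] with y h1 h2
  rw [h1, h2]
  simp [mul_comm]

theorem FSp.exists_onb {S : Set (ℝ → ℝ)} (hS : FSp S) : ∃ (n : ℕ) (e : Fin n → ℝ → ℝ), ONB S n e := by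
  obtain ⟨ι, _, b, hb, hfin⟩ := hS.fin
  let V : Submodule ℝ (MeasureTheory.Lp ℝ 2 mu) :=
    { carrier := {F | ∃ f ∈ S, F =ᵐ[mu] f}
      zero_mem' := ⟨_, hS.zero, MeasureTheory.Lp.coeFn_zero _ _ _⟩
      add_mem' := by
        rintro F G ⟨f, hf, hF⟩ ⟨g, hg, hG⟩
        refine ⟨_, hS.add f hf g hg, (MeasureTheory.Lp.coeFn_add F G).trans ?_⟩
        filter_upwards [hF, hG] with y h1 h2
        simp [h1, h2]
      smul_mem' := by
        rintro c F ⟨f, hf, hF⟩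
        refine ⟨_, hS.smul c f hf, (MeasureTheory.Lp.coeFn_smul c F).trans ?_⟩
        filter_upwards [hF] with y h1
        simp [h1] }
  have hsum : ∀ (k : Type) [Fintype k] (c : k → ℝ) (B : k → MeasureTheory.Lp ℝ 2 mu) (b : k → ℝ → ℝ),
      (∀ i, B i =ᵐ[mu] b i) → (∑ i, c i • B i : MeasureTheory.Lp ℝ 2 mu) =ᵐ[mu] fun y => ∑ i, c i * b i y := by
    intro k _ c B b hB
    have h1 := MeasureTheory.Lp.coeFn_finsetSum (p := 2) (μ := mu) Finset.univ (fun i => c i • B i)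
    refine h1.trans ?_
    have h2 : ∀ᵐ y ∂mu, ∀ i, (B i) y = b i y := MeasureTheory.ae_all_iff.2 hB
    have h3 : ∀ᵐ y ∂mu, ∀ i, (c i • B i : MeasureTheory.Lp ℝ 2 mu) y = c i * (B i) y :=
      MeasureTheory.ae_all_iff.2 fun i => by
        filter_upwards [MeasureTheory.Lp.coeFn_smul (c i) (B i)] with y hy
        rw [hy]; simp
    filter_upwards [h2, h3] with y h4 h5
    simp [h4, h5]
  have hle : V ≤ Submodule.span ℝ (range fun i => (hb i).memLp.toLp (b i)) := by
    rintro F ⟨f, hf, hF⟩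
    obtain ⟨c, hc⟩ := hfin f hf
    have : F = ∑ i, c i • (hb i).memLp.toLp (b i) := by
      apply MeasureTheory.Lp.ext
      refine hF.trans (hc.trans (hsum _ _ _ _ fun i => ?_).symm)
      exact MeasureTheory.MemLp.coeFn_toLp _
    rw [this]
    exact Submodule.sum_mem _ fun i _ => Submodule.smul_mem _ _ (Submodule.subset_span ⟨i, rfl⟩)
  haveI : FiniteDimensional ℝ (Submodule.span ℝ (range fun i => (hb i).memLp.toLp (b i))) :=
    FiniteDimensional.span_of_finite ℝ (finite_range _)
  haveI : FiniteDimensional ℝ V := Submodule.finiteDimensional_of_le hle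
  let B := stdOrthonormalBasis ℝ V
  have hmem : ∀ i, ∃ f ∈ S, ((B i : V) : MeasureTheory.Lp ℝ 2 mu) =ᵐ[mu] f := fun i => (B i).2
  choose e he heB using hmem
  refine ⟨_, e, he, ?_, ?_⟩
  · intro i j
    rw [← lp_inner (heB i) (heB j)]
    have := orthonormal_iff_ite.1 B.orthonormal i j
    simpa using this
  · intro f hf
    let F : V := ⟨(hS.bd f hf).memLp.toLp f, f, hf, MeasureTheory.MemLp.coeFn_toLp _⟩
    have h1 := B.sum_repr' F
    have h2 : ((F : V) : MeasureTheory.Lp ℝ 2 mu) = ∑ i, ip f (e i) • ((B i : V) : MeasureTheory.Lp ℝ 2 mu) := by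
      conv_lhs => rw [← h1]
      rw [Submodule.coe_sum]
      refine Finset.sum_congr rfl fun i _ => ?_
      rw [Submodule.coe_smul, Submodule.coe_inner, real_inner_comm,
        lp_inner (MeasureTheory.MemLp.coeFn_toLp (hS.bd f hf).memLp) (heB i)]
    have h3 := hsum _ (fun i => ip f (e i)) _ _ heB
    rw [← h2] at h3
    exact (MeasureTheory.MemLp.coeFn_toLp (hS.bd f hf).memLp).symm.trans h3

/-- projection -/
def prj {n : ℕ} (e : Fin n → ℝ → ℝ) (f : ℝ → ℝ) : ℝ → ℝ := fun y => ∑ i, ip f (e i) * e i y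

section
variable {S : Set (ℝ → ℝ)} {n : ℕ} {e : Fin n → ℝ → ℝ}

theorem ONB.prj_mem (hS : FSp S) (he : ONB S n e) (f : ℝ → ℝ) : prj e f ∈ S :=
  hS.sum _ _ he.mem _

theorem ONB.ebd (hS : FSp S) (he : ONB S n e) (i : Fin n) : Bd (e i) := hS.bd _ (he.mem i)

theorem ONB.prj_bd (hS : FSp S) (he : ONB S n e) (f : ℝ → ℝ) : Bd (prj e f) :=
  hS.bd _ (he.prj_mem hS f)

/-- inner product of linear combinations with basis elements -/
theorem ONB.ip_comb (hS : FSp S) (he : ONB S n e) (c : Fin n → ℝ) (j : Fin n) :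
    ip (fun y => ∑ i, c i * e i y) (e j) = c j := by
  rw [ip_sum _ (fun i => (Bd.const _).mul (he.ebd hS i)) (he.ebd hS j)]
  simp [ip_smul, he.orth]

theorem ONB.orthog (hS : FSp S) (he : ONB S n e) {f : ℝ → ℝ} (hf : Bd f) {φ : ℝ → ℝ} (hφ : φ ∈ S) :
    ip (fun y => f y - prj e f y) φ = 0 := by
  have hb := he.ebd hS
  have h1 : ∀ j, ip (fun y => f y - prj e f y) (e j) = 0 := by
    intro j
    rw [ip_sub hf (he.prj_bd hS f) (hb j)]
    have := he.ip_comb hS (fun i => ip f (e i)) j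
    unfold prj
    rw [this, sub_self]
  rw [ip_congr Filter.EventuallyEq.rfl (he.repr φ hφ), ip_comm,
    ip_sum _ (fun i => (Bd.const _).mul (hb i)) (hf.sub (he.prj_bd hS f))]
  apply Finset.sum_eq_zero
  intro i _
  rw [ip_smul, ip_comm (e i) (fun y => f y - prj e f y), h1, mul_zero]

theorem ONB.best (hS : FSp S) (he : ONB S n e) {f : ℝ → ℝ} (hf : Bd f) {φ : ℝ → ℝ} (hφ : φ ∈ S) :
    nrm (fun y => f y - prj e f y) ≤ nrm (fun y => f y - φ y) := by
  have hp := he.prj_bd hS f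
  have hφb := hS.bd _ hφ
  have h1 : nrm (fun y => f y - prj e f y) ^ 2 = ip (fun y => f y - prj e f y) (fun y => f y - φ y) := by
    have h2 := he.orthog hS hf (hS.sub _ (he.prj_mem hS f) _ hφ)
    rw [nrm_sq]
    have h3 : (fun y => f y - φ y) = fun y => (f y - prj e f y) + (prj e f y - φ y) := by
      funext y; ring
    conv_rhs => rw [h3]
    rw [ip_add_r (hf.sub hp) (hp.sub hφb) (hf.sub hp), h2, add_zero]
  have h4 := (le_abs_self _).trans (ip_cs (hf.sub hp) (hf.sub hφb))
  rw [← h1, sq] at h4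
  by_cases h5 : nrm (fun y => f y - prj e f y) = 0
  · rw [h5]; exact nrm_nonneg _
  · exact le_of_mul_le_mul_left h4 (lt_of_le_of_ne (nrm_nonneg _) (Ne.symm h5))

theorem ONB.prj_nrm (hS : FSp S) (he : ONB S n e) {f : ℝ → ℝ} (hf : Bd f) :
    nrm (prj e f) ≤ nrm f := by
  have hp := he.prj_bd hS f
  have h1 : nrm (prj e f) ^ 2 = ip f (prj e f) := by
    have h2 := he.orthog hS hf (he.prj_mem hS f)
    rw [ip_sub hf hp hp] at h2
    rw [nrm_sq]; linarith
  have h4 := (le_abs_self _).trans (ip_cs hf hp)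
  rw [← h1, sq] at h4
  by_cases h5 : nrm (prj e f) = 0
  · rw [h5]; exact nrm_nonneg _
  · exact le_of_mul_le_mul_right h4 (lt_of_le_of_ne (nrm_nonneg _) (Ne.symm h5))

/-- Parseval -/
theorem ONB.nrm_comb (hS : FSp S) (he : ONB S n e) (c : Fin n → ℝ) :
    nrm (fun y => ∑ i, c i * e i y) ^ 2 = ∑ i, c i ^ 2 := by
  have hb := he.ebd hS
  rw [nrm_sq, ip_sum _ (fun i => (Bd.const _).mul (hb i)) (Bd.sum _ fun i => (Bd.const _).mul (hb i))]
  refine Finset.sum_congr rfl fun i _ => ?_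
  rw [ip_smul, ip_comm, he.ip_comb hS, sq]

end

theorem part_mono {N : ℕ} {x : ℕ → ℝ} (hx : IsPartition N x) {i j : ℕ} (hij : i ≤ j) (hj : j ≤ N) :
    x i ≤ x j := by
  induction j, hij using Nat.le_induction with
  | base => exact le_rfl
  | succ j hij ih => exact (ih (by omega)).trans (hx.2.2 j (by omega)).le

theorem part_nonneg {N : ℕ} {x : ℕ → ℝ} (hx : IsPartition N x) {j : ℕ} (hj : j ≤ N) : 0 ≤ x j := by
  rw [← hx.1]; exact part_mono hx (Nat.zero_le _) hj

theorem part_le_one {N : ℕ} {x : ℕ → ℝ} (hx : IsPartition N x) {j : ℕ} (hj : j ≤ N) : x j ≤ 1 := by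
  rw [← hx.2.1]; exact part_mono hx hj le_rfl

theorem part_Icc {N : ℕ} {x : ℕ → ℝ} (hx : IsPartition N x) {j : ℕ} (hj : j < N) :
    Icc (x j) (x (j+1)) ⊆ Icc 0 1 :=
  Icc_subset_Icc (part_nonneg hx hj.le) (part_le_one hx hj)

theorem part_find {N : ℕ} {x : ℕ → ℝ} (hx : IsPartition N x) {y : ℝ} (hy : y ∈ Ico (0:ℝ) 1) :
    ∃ j < N, y ∈ Ico (x j) (x (j+1)) := by
  classical
  have h : ∃ m, y < x m := ⟨N, by rw [hx.2.1]; exact hy.2⟩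
  have h1 := Nat.find_spec h
  have h2 : Nat.find h ≤ N := Nat.find_min' h (by rw [hx.2.1]; exact hy.2)
  have h3 : Nat.find h ≠ 0 := by
    intro h0
    rw [h0, hx.1] at h1
    exact absurd hy.1 (not_le.2 h1)
  obtain ⟨j, hj⟩ := Nat.exists_eq_succ_of_ne_zero h3
  refine ⟨j, by omega, not_lt.1 (Nat.find_min h (m := j) (by omega)), ?_⟩
  rw [hj] at h1; exact h1

/-- nodes of the partition -/
def nodes (N : ℕ) (x : ℕ → ℝ) : Set ℝ := x '' (Iic N)

theorem nodes_countable (N : ℕ) (x : ℕ → ℝ) : (nodes N x).Countable :=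
  ((finite_Iic N).image x).countable

theorem part_find' {N : ℕ} {x : ℕ → ℝ} (hx : IsPartition N x) {y : ℝ}
    (hy : y ∈ Ioo (0:ℝ) 1 \ nodes N x) : ∃ j < N, y ∈ Ioo (x j) (x (j+1)) := by
  obtain ⟨j, hj, h1⟩ := part_find hx (Ioo_subset_Ico_self hy.1)
  refine ⟨j, hj, lt_of_le_of_ne h1.1 ?_, h1.2⟩
  intro h
  exact hy.2 ⟨j, hj.le, h⟩

/-- elements are disjoint -/
theorem part_unique {N : ℕ} {x : ℕ → ℝ} (hx : IsPartition N x) {y : ℝ} {i j : ℕ} (hi : i < N)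
    (hj : j < N) (h1 : y ∈ Ioo (x i) (x (i+1))) (h2 : y ∈ Ioo (x j) (x (j+1))) : i = j := by
  rcases lt_trichotomy i j with h | h | h
  · have := part_mono hx (show i + 1 ≤ j by omega) hj.le
    linarith [h1.2, h2.1]
  · exact h
  · have := part_mono hx (show j + 1 ≤ i by omega) hi.le
    linarith [h2.2, h1.1]

/-- spline spaces: `Sp d 0` discontinuous piecewise polynomials -/
def Sp (N : ℕ) (x : ℕ → ℝ) (d : ℕ) : ℕ → Set (ℝ → ℝ)
  | 0 => {f | ∀ j < N, ∃ p : Polynomial ℝ, p.natDegree ≤ d ∧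
            ∀ y ∈ Ioo (x j) (x (j+1)), f y = Polynomial.eval y p}
  | s + 1 => Sh N (d + s + 2) s x

theorem Sp_zero_of (N : ℕ) (x : ℕ → ℝ) (d s : ℕ) {f : ℝ → ℝ} (hf : f ∈ Sp N x d s) :
    f ∈ Sp N x (d + s) 0 := by
  cases s with
  | zero => exact hf
  | succ s =>
    intro j hj
    obtain ⟨p, hp, h⟩ := hf.2 j hj
    exact ⟨p, by omega, fun y hy => h y (Ioo_subset_Icc_self hy)⟩

theorem Sp0_span {N : ℕ} {x : ℕ → ℝ} (hx : IsPartition N x) (d : ℕ) {f : ℝ → ℝ}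
    (hf : f ∈ Sp N x d 0) : ∃ c : Fin N × Fin (d+1) → ℝ, f =ᵐ[mu] fun y =>
      ∑ q, c q * (Ioo (x q.1) (x (q.1+1))).indicator (fun y => y ^ (q.2 : ℕ)) y := by
  choose p hp hfp using hf
  refine ⟨fun q => (p q.1 q.1.2).coeff q.2, ae_mu_off (nodes_countable N x) fun y hy => ?_⟩
  obtain ⟨j, hj, hyj⟩ := part_find' hx hy
  beta_reduce
  rw [hfp j hj y hyj, Fintype.sum_prod_type, Finset.sum_eq_single ⟨j, hj⟩]
  · simp only [indicator_of_mem hyj]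
    rw [Polynomial.eval_eq_sum_range' (n := d+1) (by have := hp j hj; omega), Finset.sum_range]
  · intro i _ hi
    have : y ∉ Ioo (x i) (x (i+1)) := fun h => hi (Fin.ext (part_unique hx i.2 hj h hyj))
    simp [indicator_of_notMem this]
  · intro h; exact absurd (Finset.mem_univ _) h

theorem ind_bd (a b : ℝ) (i : ℕ) : Bd ((Ioo a b).indicator (fun y => y ^ i)) := by
  refine ⟨?_, 1, ?_⟩
  · exact ((measurable_id.pow_const i).indicator measurableSet_Ioo).aestronglyMeasurable
  · refine ae_mu_of fun y hy => ?_
    by_cases h : y ∈ Ioo a b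
    · rw [indicator_of_mem h, abs_of_nonneg (pow_nonneg hy.1 _)]
      exact pow_le_one₀ hy.1 hy.2
    · rw [indicator_of_notMem h]; simp

theorem Sp0_bd {N : ℕ} {x : ℕ → ℝ} (hx : IsPartition N x) (d : ℕ) {f : ℝ → ℝ}
    (hf : f ∈ Sp N x d 0) : Bd f := by
  obtain ⟨c, hc⟩ := Sp0_span hx d hf
  exact (Bd.sum _ fun q => (Bd.const _).mul (ind_bd _ _ _)).congr hc.symm

theorem Sp_bd {N : ℕ} {x : ℕ → ℝ} (hx : IsPartition N x) (d s : ℕ) {f : ℝ → ℝ}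
    (hf : f ∈ Sp N x d s) : Bd f := Sp0_bd hx _ (Sp_zero_of N x d s hf)

theorem Sh_add {N r k : ℕ} {x : ℕ → ℝ} {f g : ℝ → ℝ} (hf : f ∈ Sh N r k x) (hg : g ∈ Sh N r k x) :
    (fun y => f y + g y) ∈ Sh N r k x := by
  refine ⟨hf.1.add hg.1, fun j hj => ?_⟩
  obtain ⟨p, hp, h⟩ := hf.2 j hj
  obtain ⟨q, hq, h'⟩ := hg.2 j hj
  exact ⟨p + q, (Polynomial.natDegree_add_le _ _).trans (max_le hp hq),
    fun y hy => by beta_reduce; rw [h y hy, h' y hy, Polynomial.eval_add]⟩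

theorem Sh_smul {N r k : ℕ} {x : ℕ → ℝ} {f : ℝ → ℝ} (c : ℝ) (hf : f ∈ Sh N r k x) :
    (fun y => c * f y) ∈ Sh N r k x := by
  refine ⟨contDiffOn_const.mul hf.1, fun j hj => ?_⟩
  obtain ⟨p, hp, h⟩ := hf.2 j hj
  exact ⟨Polynomial.C c * p, (Polynomial.natDegree_C_mul_le _ _).trans hp,
    fun y hy => by beta_reduce; rw [h y hy, Polynomial.eval_mul, Polynomial.eval_C]⟩

theorem Sh_const (N r k : ℕ) (x : ℕ → ℝ) (c : ℝ) : (fun _ => c) ∈ Sh N r k x :=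
  ⟨contDiffOn_const, fun j _ => ⟨Polynomial.C c, by simp, fun y _ => by simp⟩⟩

theorem Sp_const (N : ℕ) (x : ℕ → ℝ) (d s : ℕ) (c : ℝ) : (fun _ => c) ∈ Sp N x d s := by
  cases s with
  | zero => exact fun j _ => ⟨Polynomial.C c, by simp, fun y _ => by simp⟩
  | succ s => exact Sh_const _ _ _ _ _

theorem Sp_fsp {N : ℕ} {x : ℕ → ℝ} (hx : IsPartition N x) (d s : ℕ) : FSp (Sp N x d s) where
  zero := Sp_const _ _ _ _ _
  add := by
    intro f hf g hg
    cases s with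
    | zero =>
      intro j hj
      obtain ⟨p, hp, h⟩ := hf j hj
      obtain ⟨q, hq, h'⟩ := hg j hj
      exact ⟨p + q, (Polynomial.natDegree_add_le _ _).trans (max_le hp hq),
        fun y hy => by beta_reduce; rw [h y hy, h' y hy, Polynomial.eval_add]⟩
    | succ s => exact Sh_add hf hg
  smul := by
    intro c f hf
    cases s with
    | zero =>
      intro j hj
      obtain ⟨p, hp, h⟩ := hf j hj
      exact ⟨Polynomial.C c * p, (Polynomial.natDegree_C_mul_le _ _).trans hp,
        fun y hy => by beta_reduce; rw [h y hy, Polynomial.eval_mul, Polynomial.eval_C]⟩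
    | succ s => exact Sh_smul c hf
  bd := fun f hf => Sp_bd hx d s hf
  fin := ⟨_, inferInstance, _, fun q => ind_bd _ _ _, fun f hf => Sp0_span hx _ (Sp_zero_of N x d s hf)⟩

theorem Sh0_fsp {N : ℕ} {x : ℕ → ℝ} (hx : IsPartition N x) (d s : ℕ) :
    FSp (Sh0 N (d + s + 2) s x) where
  zero := ⟨Sh_const _ _ _ _ _, rfl, rfl⟩
  add := fun f hf g hg => ⟨Sh_add hf.1 hg.1, by simp [hf.2.1, hg.2.1], by simp [hf.2.2, hg.2.2]⟩
  smul := fun c f hf => ⟨Sh_smul c hf.1, by simp [hf.2.1], by simp [hf.2.2]⟩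
  bd := fun f hf => (Sp_fsp hx d (s+1)).bd f hf.1
  fin := by
    obtain ⟨ι, i, b, hb, h⟩ := (Sp_fsp hx d (s+1)).fin
    exact ⟨ι, i, b, hb, fun f hf => h f hf.1⟩

theorem poly_antideriv (p : Polynomial ℝ) (d : ℕ) (hp : p.natDegree ≤ d) :
    ∃ q : Polynomial ℝ, q.natDegree ≤ d + 1 ∧ Polynomial.derivative q = p := by
  refine ⟨∑ i ∈ Finset.range (d+1), Polynomial.C (p.coeff i / (i+1)) * Polynomial.X ^ (i+1), ?_, ?_⟩
  · apply Polynomial.natDegree_sum_le_of_forall_le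
    intro i hi
    refine (Polynomial.natDegree_C_mul_X_pow_le _ _).trans ?_
    have := Finset.mem_range.1 hi
    omega
  · rw [Polynomial.derivative_sum]
    conv_rhs => rw [p.as_sum_range' (d+1) (by omega)]
    refine Finset.sum_congr rfl fun i _ => ?_
    rw [Polynomial.derivative_C_mul_X_pow, ← Polynomial.C_mul_X_pow_eq_monomial]
    have : ((i:ℝ) + 1) ≠ 0 := by positivity
    push_cast
    rw [div_mul_cancel₀ _ this]

/-- derivative of a spline -/
theorem Sp_deriv {N : ℕ} {x : ℕ → ℝ} (hx : IsPartition N x) (d s : ℕ) {φ : ℝ → ℝ}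
    (hφ : φ ∈ Sp N x d (s+1)) : ∃ g ∈ Sp N x d s, PW φ g := by
  obtain ⟨h1, h2⟩ := hφ
  cases s with
  | zero =>
    have hg : deriv φ ∈ Sp N x d 0 := by
      intro j hj
      obtain ⟨p, hp, h⟩ := h2 j hj
      refine ⟨Polynomial.derivative p, (Polynomial.natDegree_derivative_le p).trans (by omega), ?_⟩
      intro y hy
      apply HasDerivAt.deriv
      refine (p.hasDerivAt y).congr_of_eventuallyEq ?_
      filter_upwards [Ioo_mem_nhds hy.1 hy.2] with z hz
      exact h z (Ioo_subset_Icc_self hz)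
    refine ⟨_, hg, h1.continuousOn, Sp0_bd hx d hg, nodes N x, nodes_countable N x, fun y hy => ?_⟩
    obtain ⟨j, hj, hyj⟩ := part_find' hx hy
    obtain ⟨p, hp, h⟩ := h2 j hj
    apply DifferentiableAt.hasDerivAt
    refine (p.differentiableAt (x := y)).congr_of_eventuallyEq ?_
    filter_upwards [Ioo_mem_nhds hyj.1 hyj.2] with z hz
    exact h z (Ioo_subset_Icc_self hz)
  | succ s =>
    have h3 := (contDiffOn_succ_iff_derivWithin (n := s) (uniqueDiffOn_Icc (zero_lt_one : (0:ℝ) < 1))).1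
      (by exact_mod_cast h1)
    have hd : ∀ y ∈ Icc (0:ℝ) 1, HasDerivWithinAt φ (derivWithin φ (Icc 0 1) y) (Icc 0 1) y :=
      fun y hy => (h3.1 y hy).hasDerivWithinAt
    refine ⟨derivWithin φ (Icc 0 1), ⟨h3.2.2, fun j hj => ?_⟩, PW.of_hasDeriv hd h3.2.2.continuousOn⟩
    obtain ⟨p, hp, h⟩ := h2 j hj
    refine ⟨Polynomial.derivative p, (Polynomial.natDegree_derivative_le p).trans (by omega), ?_⟩
    intro y hy
    have h4 := (hd y (part_Icc hx hj hy)).mono (part_Icc hx hj)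
    have h5 : HasDerivWithinAt φ (Polynomial.eval y (Polynomial.derivative p)) (Icc (x j) (x (j+1))) y :=
      (p.hasDerivWithinAt y _).congr h (h y hy)
    exact (uniqueDiffOn_Icc (hx.2.2 j hj) y hy).eq_deriv _ h4 h5

/-- antiderivative of a spline -/
theorem Sp_int {N : ℕ} {x : ℕ → ℝ} (hx : IsPartition N x) (d s : ℕ) {g : ℝ → ℝ}
    (hg : g ∈ Sp N x d s) (c : ℝ) : ∃ φ ∈ Sp N x d (s+1), PW φ g ∧ φ 0 = c := by
  have hb := Sp_bd hx d s hg
  let φ : ℝ → ℝ := fun y => c + ∫ z in (0:ℝ)..y, g z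
  have hφ0 : φ 0 = c := by simp [φ]
  have hpoly : ∀ j < N, ∃ p : Polynomial ℝ, p.natDegree ≤ d + s + 1 ∧ ∀ y ∈ Icc (x j) (x (j+1)),
      φ y = Polynomial.eval y p := by
    intro j hj
    obtain ⟨p, hp, h⟩ := Sp_zero_of N x d s hg j hj
    obtain ⟨q, hq, hqp⟩ := poly_antideriv p (d+s) hp
    refine ⟨q + Polynomial.C (φ (x j) - q.eval (x j)), ?_, ?_⟩
    · refine (Polynomial.natDegree_add_le _ _).trans (max_le hq (by simp))
    · intro y hy
      have h0 := part_nonneg hx hj.le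
      have h1 := part_le_one hx hj
      have h2 := hx.2.2 j hj
      have h3 : φ y - φ (x j) = ∫ z in x j..y, g z := by
        simp only [φ]
        rw [add_sub_add_left_eq_sub, intervalIntegral.integral_interval_sub_left]
        · exact hb.ii' le_rfl zero_le_one (h0.trans hy.1) (hy.2.trans h1)
        · exact hb.ii' le_rfl zero_le_one h0 (h2.le.trans h1)
      have h4 : ∫ z in x j..y, g z = ∫ z in x j..y, p.eval z := by
        apply intervalIntegral.integral_congr_ae
        rw [uIoc_of_le hy.1]
        have := (countable_singleton (x (j+1))).ae_notMem MeasureTheory.volume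
        filter_upwards [this] with z hz hz2
        exact h z ⟨hz2.1, lt_of_le_of_ne (hz2.2.trans hy.2) hz⟩
      have h5 : ∫ z in x j..y, p.eval z = q.eval y - q.eval (x j) := by
        apply intervalIntegral.integral_eq_sub_of_hasDerivAt
        · intro z _
          rw [← hqp]; exact q.hasDerivAt z
        · exact (p.continuous).intervalIntegrable _ _
      rw [Polynomial.eval_add, Polynomial.eval_C]
      linarith
  have hcont : ContinuousOn φ (Icc 0 1) := by
    apply continuousOn_const.add
    have := intervalIntegral.continuousOn_primitive_interval' (a := 0) (b₁ := 0) (b₂ := 1) hb.ii (by simp)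
    rwa [uIcc_of_le (zero_le_one : (0:ℝ) ≤ 1)] at this
  cases s with
  | zero =>
    refine ⟨φ, ⟨?_, hpoly⟩, ⟨hcont, hb, nodes N x, nodes_countable N x, fun y hy => ?_⟩, hφ0⟩
    · simpa using hcont
    · obtain ⟨j, hj, hyj⟩ := part_find' hx hy
      obtain ⟨p, hp, h⟩ := hg j hj
      have hev : g =ᶠ[nhds y] fun z => p.eval z := by
        filter_upwards [Ioo_mem_nhds hyj.1 hyj.2] with z hz
        exact h z hz
      have := intervalIntegral.integral_hasDerivAt_right (f := g) (a := 0) (b := y)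
        (hb.ii' le_rfl zero_le_one hy.1.1.le hy.1.2.le) ?_ ?_
      · exact this.const_add c
      · exact ⟨Ioc 0 1, Ioc_mem_nhds hy.1.1 hy.1.2, hb.1⟩
      · exact (p.continuous.continuousAt).congr hev.symm
  | succ s =>
    have hgc : ContDiffOn ℝ s g (Icc 0 1) := hg.1
    have hd : ∀ y ∈ Icc (0:ℝ) 1, HasDerivWithinAt φ (g y) (Icc 0 1) y := by
      intro y hy
      haveI : Fact (y ∈ Icc (0:ℝ) 1) := ⟨hy⟩
      have := intervalIntegral.integral_hasDerivWithinAt_right (f := g) (a := 0) (b := y)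
        (s := Icc 0 1) (t := Icc 0 1) (hb.ii' le_rfl zero_le_one hy.1 hy.2)
        (hgc.continuousOn.stronglyMeasurableAtFilter_nhdsWithin measurableSet_Icc y)
        (hgc.continuousOn y hy)
      exact this.const_add c
    refine ⟨φ, ⟨?_, hpoly⟩, PW.of_hasDeriv hd hgc.continuousOn, hφ0⟩
    have := (contDiffOn_succ_iff_derivWithin (f := φ) (n := s) (uniqueDiffOn_Icc (zero_lt_one : (0:ℝ) < 1))).2
      ⟨fun y hy => (hd y hy).differentiableWithinAt, by simp, hgc.congr fun y hy =>
        (hd y hy).derivWithin (uniqueDiffOn_Icc zero_lt_one y hy)⟩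
    exact_mod_cast this

theorem elem_sum {N : ℕ} {x : ℕ → ℝ} (hx : IsPartition N x) {f : ℝ → ℝ} (hf : Bd f) :
    ∫ y, f y ∂mu = ∑ j ∈ Finset.range N, ∫ y in x j..x (j+1), f y := by
  rw [intervalIntegral.sum_integral_adjacent_intervals, hx.1, hx.2.1, int01]
  intro j hj
  exact hf.ii' (part_nonneg hx hj.le) (part_le_one hx hj.le) (part_nonneg hx hj) (part_le_one hx hj)

theorem elem_le {N : ℕ} {x : ℕ → ℝ} (hx : IsPartition N x) {f g : ℝ → ℝ} (hf : Bd f) (hg : Bd g)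
    {K : ℝ} (h : ∀ j < N, ∫ y in x j..x (j+1), f y ^ 2 ≤ K ^ 2 * ∫ y in x j..x (j+1), g y ^ 2)
    (hK : 0 ≤ K) : nrm f ≤ K * nrm g := by
  apply le_of_sq_le_sq _ (mul_nonneg hK (nrm_nonneg _))
  rw [mul_pow, nrm_sq_int, nrm_sq_int, elem_sum hx (hf.pow 2), elem_sum hx (hg.pow 2), Finset.mul_sum]
  exact Finset.sum_le_sum fun j hj => h j (Finset.mem_range.1 hj)

theorem exists_pcw {N : ℕ} {x : ℕ → ℝ} (hx : IsPartition N x) (c : ℕ → ℝ → ℝ) :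
    ∃ w : ℝ → ℝ, ∀ j < N, ∀ y ∈ Ioo (x j) (x (j+1)), w y = c j y := by
  classical
  refine ⟨fun y => if h : ∃ j, j < N ∧ y ∈ Ioo (x j) (x (j+1)) then c h.choose y else 0, ?_⟩
  intro j hj y hy
  have h : ∃ j, j < N ∧ y ∈ Ioo (x j) (x (j+1)) := ⟨j, hj, hy⟩
  beta_reduce
  rw [dif_pos h, part_unique hx h.choose_spec.1 hj h.choose_spec.2 hy]

theorem mesh_pos {N : ℕ} {x : ℕ → ℝ} {h : ℝ} (hx : IsPartition N x) (hm : IsMeshSize N x h) : 0 < h := by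
  obtain ⟨i, hi, h1⟩ := hm.2
  linarith [hx.2.2 i hi]

theorem mesh_le_one {N : ℕ} {x : ℕ → ℝ} {h : ℝ} (hx : IsPartition N x) (hm : IsMeshSize N x h) :
    h ≤ 1 := by
  obtain ⟨i, hi, h1⟩ := hm.2
  linarith [part_nonneg hx hi.le, part_le_one hx hi]

theorem approx0 {N : ℕ} {x : ℕ → ℝ} {h : ℝ} (hx : IsPartition N x) (hm : IsMeshSize N x h) (d : ℕ)
    {W W' : ℝ → ℝ} (hW : PW W W') : ∃ w ∈ Sp N x d 0, nrm (fun y => W y - w y) ≤ h * nrm W' := by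
  obtain ⟨w, hw⟩ := exists_pcw hx (fun j _ => W (x j))
  have hmem : w ∈ Sp N x d 0 := fun j hj =>
    ⟨Polynomial.C (W (x j)), by simp, fun y hy => by simp [hw j hj y hy]⟩
  have hwb := Sp0_bd hx d hmem
  have hb : Bd (fun y => W y - w y) := hW.bd.sub hwb
  refine ⟨w, hmem, elem_le hx hb hW.bd' ?_ (mesh_pos hx hm).le⟩
  intro j hj
  have h0 := part_nonneg hx hj.le
  have h1 := part_le_one hx hj
  have h2 := hx.2.2 j hj
  have hI : 0 ≤ ∫ y in x j..x (j+1), W' y ^ 2 :=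
    intervalIntegral.integral_nonneg h2.le fun z _ => sq_nonneg _
  calc ∫ y in x j..x (j+1), (W y - w y) ^ 2
      ≤ ∫ y in x j..x (j+1), ((x (j+1) - x j) * ∫ z in x j..x (j+1), W' z ^ 2) := by
        apply intervalIntegral.integral_mono_on_of_le_Ioo h2.le
        · exact (hb.pow 2).ii' h0 (h2.le.trans h1) (h0.trans h2.le) h1
        · simp
        · intro y hy
          rw [hw j hj y hy]
          exact hW.local_sq h0 h2.le h1 (Ioo_subset_Icc_self hy)
    _ = (x (j+1) - x j) ^ 2 * ∫ z in x j..x (j+1), W' z ^ 2 := by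
        rw [intervalIntegral.integral_const, smul_eq_mul]; ring
    _ ≤ _ := by
        apply mul_le_mul_of_nonneg_right _ hI
        apply pow_le_pow_left₀ (by linarith) (hm.1 j hj)

/-- antiderivative of a continuous function -/
theorem PW.antideriv {f : ℝ → ℝ} (hf : ContinuousOn f (Icc 0 1)) : ∃ W, PW W f ∧ W 0 = 0 := by
  refine ⟨fun y => ∫ z in (0:ℝ)..y, f z, PW.of_hasDeriv ?_ hf, by simp⟩
  intro y hy
  haveI : Fact (y ∈ Icc (0:ℝ) 1) := ⟨hy⟩
  exact intervalIntegral.integral_hasDerivWithinAt_right (f := f) (a := 0) (b := y)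
    (s := Icc 0 1) (t := Icc 0 1) ((Bd.of_cont hf).ii' le_rfl zero_le_one hy.1 hy.2)
    (hf.stronglyMeasurableAtFilter_nhdsWithin measurableSet_Icc y) (hf y hy)

theorem quasi {N : ℕ} {x : ℕ → ℝ} {h : ℝ} (hx : IsPartition N x) (hm : IsMeshSize N x h) (d s : ℕ)
    (hAP : ∀ W W', PW W W' → ∃ w ∈ Sp N x d s, nrm (fun y => W y - w y) ≤ h * nrm W')
    {f f' : ℝ → ℝ} (hf : PW f f') :
    ∃ v ∈ Sp N x d (s+1), ∃ v' ∈ Sp N x d s, PW v v' ∧ v 0 = f 0 ∧ v 1 = f 1 ∧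
      (∀ g ∈ Sp N x d s, nrm (fun y => f' y - v' y) ≤ nrm (fun y => f' y - g y)) ∧
      nrm (fun y => f y - v y) ≤ h * nrm (fun y => f' y - v' y) := by
  have hS := Sp_fsp hx d s
  obtain ⟨n, e, he⟩ := hS.exists_onb
  have hmem := he.prj_mem hS f'
  obtain ⟨v, hv, hPW, hv0⟩ := Sp_int hx d s hmem (f 0)
  have horth : ∀ g ∈ Sp N x d s, ip (fun y => f' y - prj e f' y) g = 0 :=
    fun g hg => he.orthog hS hf.bd' hg
  have hE := hf.sub hPW
  have h1 : v 1 = f 1 := by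
    have h2 := horth _ (Sp_const N x d s 1)
    have h3 := hE.ftc01
    rw [ip_eq] at h2
    simp only [mul_one] at h2
    rw [h2, hv0] at h3
    linarith
  refine ⟨v, hv, _, hmem, hPW, hv0, h1, fun g hg => he.best hS hf.bd' hg, ?_⟩
  obtain ⟨W, hW, hW0⟩ := PW.antideriv hE.1
  obtain ⟨w, hw, hwW⟩ := hAP W _ hW
  have hwb := hS.bd w hw
  have h4 := hE.parts hW
  simp only [hv0, h1, sub_self, zero_mul, zero_sub] at h4
  have h5 : nrm (fun y => f y - v y) ^ 2 = - ip (fun y => f' y - prj e f' y) (fun y => W y - w y) := by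
    rw [ip_sub_r hW.bd hwb hE.bd', horth w hw, nrm_sq]
    linarith
  have h6 : nrm (fun y => f y - v y) ^ 2 ≤
      nrm (fun y => f' y - prj e f' y) * (h * nrm (fun y => f y - v y)) := by
    rw [h5]
    refine (neg_le_abs _).trans ((ip_cs hE.bd' (hW.bd.sub hwb)).trans ?_)
    exact mul_le_mul_of_nonneg_left hwW (nrm_nonneg _)
  by_cases h7 : nrm (fun y => f y - v y) = 0
  · rw [h7]; exact mul_nonneg (mesh_pos hx hm).le (nrm_nonneg _)
  · have h8 := lt_of_le_of_ne (nrm_nonneg _) (Ne.symm h7)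
    refine le_of_mul_le_mul_right ?_ h8
    rw [← sq]
    linarith

theorem approx_all {N : ℕ} {x : ℕ → ℝ} {h : ℝ} (hx : IsPartition N x) (hm : IsMeshSize N x h)
    (d s : ℕ) : ∀ W W', PW W W' → ∃ w ∈ Sp N x d s, nrm (fun y => W y - w y) ≤ h * nrm W' := by
  induction s with
  | zero => exact fun W W' hW => approx0 hx hm d hW
  | succ s ih =>
    intro W W' hW
    obtain ⟨v, hv, v', hv', -, -, -, h1, h2⟩ := quasi hx hm d s ih hW
    refine ⟨v, hv, h2.trans (mul_le_mul_of_nonneg_left ?_ (mesh_pos hx hm).le)⟩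
    have := h1 _ (Sp_const N x d s 0)
    simpa using this

/-- derivative of a smooth function -/
theorem PW.of_contDiffOn {f : ℝ → ℝ} {s : ℕ} (hf : ContDiffOn ℝ (s+1 : ℕ) f (Icc 0 1)) :
    PW f (derivWithin f (Icc 0 1)) ∧ ContDiffOn ℝ s (derivWithin f (Icc 0 1)) (Icc 0 1) := by
  have h3 := (contDiffOn_succ_iff_derivWithin (n := s) (uniqueDiffOn_Icc (zero_lt_one : (0:ℝ) < 1))).1
    (by exact_mod_cast hf)
  exact ⟨PW.of_hasDeriv (fun y hy => (h3.1 y hy).hasDerivWithinAt) h3.2.2.continuousOn, h3.2.2⟩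

theorem approx_smooth {N : ℕ} {x : ℕ → ℝ} {h : ℝ} (hx : IsPartition N x) (hm : IsMeshSize N x h)
    {M : ℝ} (hM : 0 ≤ M) (s : ℕ) : ∀ f : ℝ → ℝ, ContDiffOn ℝ (s+1 : ℕ) f (Icc 0 1) →
      (∀ y ∈ Icc (0:ℝ) 1, |iteratedDerivWithin (s+1) f (Icc 0 1) y| ≤ M) →
      ∃ v ∈ Sp N x 0 s, nrm (fun y => f y - v y) ≤ M * h ^ (s+1) := by
  have hh := (mesh_pos hx hm).le
  induction s with
  | zero =>
    intro f hf hb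
    have hP := (PW.of_contDiffOn hf).1
    obtain ⟨w, hw, h1⟩ := approx0 hx hm 0 hP
    refine ⟨w, hw, h1.trans ?_⟩
    have : nrm (derivWithin f (Icc 0 1)) ≤ M := nrm_le_of_bound hP.bd' hM (ae_mu_of fun y hy => by
      simpa [iteratedDerivWithin_one] using hb y hy)
    rw [mul_comm M]
    simpa using mul_le_mul_of_nonneg_left this hh
  | succ s ih =>
    intro f hf hb
    have hP := PW.of_contDiffOn hf
    obtain ⟨v, hv, v', hv', -, -, -, h1, h2⟩ := quasi hx hm 0 s (approx_all hx hm 0 s) hP.1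
    obtain ⟨g, hg, h3⟩ := ih _ hP.2 (fun y hy => by
      have := hb y hy
      rwa [iteratedDerivWithin_succ'] at this)
    refine ⟨v, hv, h2.trans ?_⟩
    have := mul_le_mul_of_nonneg_left ((h1 g hg).trans h3) hh
    rw [pow_succ' h (s+1)]
    linarith

theorem approx_smooth' {N : ℕ} {x : ℕ → ℝ} {h : ℝ} (hx : IsPartition N x) (hm : IsMeshSize N x h)
    {M : ℝ} (hM : 0 ≤ M) (s : ℕ) (f : ℝ → ℝ) (hf : ContDiffOn ℝ (s+2 : ℕ) f (Icc 0 1))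
    (hb : ∀ y ∈ Icc (0:ℝ) 1, |iteratedDerivWithin (s+2) f (Icc 0 1) y| ≤ M) :
    ∃ v ∈ Sp N x 0 (s+1), ∃ v', PW v v' ∧ v 0 = f 0 ∧ v 1 = f 1 ∧
      nrm (fun y => f y - v y) ≤ M * h ^ (s+2) ∧
      nrm (fun y => derivWithin f (Icc 0 1) y - v' y) ≤ M * h ^ (s+1) := by
  have hh := (mesh_pos hx hm).le
  have hP := PW.of_contDiffOn hf
  obtain ⟨v, hv, v', hv', h4, h5, h6, h1, h2⟩ := quasi hx hm 0 s (approx_all hx hm 0 s) hP.1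
  obtain ⟨g, hg, h3⟩ := approx_smooth hx hm hM s _ hP.2 (fun y hy => by
      have := hb y hy
      rwa [iteratedDerivWithin_succ'] at this)
  have h7 := (h1 g hg).trans h3
  refine ⟨v, hv, v', h4, h5, h6, h2.trans ?_, h7⟩
  have := mul_le_mul_of_nonneg_left h7 hh
  rw [pow_succ' h (s+1)]
  linarith

theorem poly_inv01 (D : ℕ) : ∃ C : ℝ, 1 ≤ C ∧ ∀ p : Polynomial ℝ, p.natDegree ≤ D →
    ∀ y ∈ Icc (0:ℝ) 1, p.eval y ^ 2 ≤ C * ∫ z in (0:ℝ)..1, p.eval z ^ 2 ∧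
      p.derivative.eval y ^ 2 ≤ C * ∫ z in (0:ℝ)..1, p.eval z ^ 2 := by
  let Q : (Fin (D+1) → ℝ) → ℝ → ℝ := fun c y => ∑ i, c i * y ^ (i:ℕ)
  let G : (Fin (D+1) → ℝ) → ℝ := fun c => ∫ z in (0:ℝ)..1, Q c z ^ 2
  have hGc : Continuous G := by
    apply intervalIntegral.continuous_parametric_intervalIntegral_of_continuous'
    simp only [Q, Function.uncurry_def]
    fun_prop
  have hQc : ∀ c, Continuous (Q c) := fun c => by simp only [Q]; fun_prop
  have hpos : ∀ c, c ≠ 0 → 0 < G c := by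
    intro c hc
    rw [lt_iff_le_and_ne]
    refine ⟨intervalIntegral.integral_nonneg zero_le_one fun z _ => sq_nonneg _, fun h0 => hc ?_⟩
    have hz : ∀ y ∈ Ioo (0:ℝ) 1, Q c y = 0 := by
      intro y hy
      by_contra hne
      have : 0 < G c := by
        apply intervalIntegral.integral_pos zero_lt_one ((hQc c).pow 2).continuousOn
          (fun z _ => sq_nonneg _)
        exact ⟨y, Ioo_subset_Icc_self hy, sq_pos_of_ne_zero hne⟩
      exact absurd h0 this.ne
    let P : Polynomial ℝ := ∑ i : Fin (D+1), Polynomial.C (c i) * Polynomial.X ^ (i:ℕ)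
    have hP : ∀ y, P.eval y = Q c y := fun y => by simp [P, Q, Polynomial.eval_finset_sum]
    have hP0 : P = 0 := by
      apply Polynomial.eq_zero_of_infinite_isRoot
      refine (Ioo_infinite (zero_lt_one : (0:ℝ) < 1)).mono fun y hy => ?_
      show P.eval y = 0
      rw [hP, hz y hy]
    funext i
    have : P.coeff i = c i := by
      simp only [P, Polynomial.finset_sum_coeff, Polynomial.coeff_C_mul, Polynomial.coeff_X_pow]
      rw [Finset.sum_eq_single i]
      · simp
      · intro b _ hb
        have : (i:ℕ) ≠ b := fun h => hb (Fin.ext h.symm)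
        simp [this]
      · simp
    rw [← this, hP0]; simp
  obtain ⟨m, hm, hmG⟩ : ∃ m, 0 < m ∧ ∀ c, m * ‖c‖ ^ 2 ≤ G c := by
    obtain ⟨c0, hc0, hmin⟩ := (isCompact_sphere (0 : Fin (D+1) → ℝ) 1).exists_isMinOn
      (NormedSpace.sphere_nonempty.2 zero_le_one) hGc.continuousOn
    have hc0' : c0 ≠ 0 := by
      rintro rfl
      simp at hc0
    refine ⟨G c0, hpos c0 hc0', fun c => ?_⟩
    by_cases hc : c = 0
    · subst hc
      simp only [norm_zero]
      rw [zero_pow two_ne_zero, mul_zero]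
      exact intervalIntegral.integral_nonneg zero_le_one fun z _ => sq_nonneg _
    · have hn : ‖c‖ ≠ 0 := norm_ne_zero_iff.2 hc
      have h1 : G (‖c‖⁻¹ • c) = (‖c‖⁻¹) ^ 2 * G c := by
        simp only [G, Q]
        rw [← intervalIntegral.integral_const_mul]
        congr 1
        funext z
        rw [← mul_pow, Finset.mul_sum]
        simp [mul_assoc]
      have h2 : G c0 ≤ G (‖c‖⁻¹ • c) := hmin (by simp [norm_smul, hn])
      rw [h1] at h2
      calc G c0 * ‖c‖ ^ 2 ≤ ((‖c‖⁻¹) ^ 2 * G c) * ‖c‖ ^ 2 :=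
            mul_le_mul_of_nonneg_right h2 (sq_nonneg _)
        _ = G c := by field_simp
  have hDm : 0 ≤ ((D+1:ℝ)^2)^2 / m := by positivity
  refine ⟨((D+1:ℝ)^2)^2 / m + 1, by linarith, ?_⟩
  intro p hp y hy
  let c : Fin (D+1) → ℝ := fun i => p.coeff i
  have hpQ : ∀ z, p.eval z = Q c z := fun z => by
    rw [Polynomial.eval_eq_sum_range' (n := D+1) (by omega), Finset.sum_range]
  have hinteg : ∫ z in (0:ℝ)..1, p.eval z ^ 2 = G c := by simp only [G, hpQ]
  have hci : ∀ i, |c i| ≤ ‖c‖ := fun i => norm_le_pi_norm c i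
  have hfin : ∀ v : ℝ, |v| ≤ (D+1:ℝ)^2 * ‖c‖ → v ^ 2 ≤ (((D+1:ℝ)^2)^2 / m + 1) * G c := by
    intro v hv
    have hG0 : 0 ≤ G c := le_trans (by positivity) (hmG c)
    have h1 : v ^ 2 ≤ ((D+1:ℝ)^2 * ‖c‖) ^ 2 := by
      rw [← sq_abs v]; exact pow_le_pow_left₀ (abs_nonneg _) hv 2
    calc v ^ 2 ≤ ((D+1:ℝ)^2)^2 * ‖c‖ ^ 2 := by rw [← mul_pow]; exact h1
      _ = (((D+1:ℝ)^2)^2 / m) * (m * ‖c‖ ^ 2) := by field_simp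
      _ ≤ (((D+1:ℝ)^2)^2 / m) * G c := mul_le_mul_of_nonneg_left (hmG c) (by positivity)
      _ ≤ _ := by nlinarith
  have hD0 : (0:ℝ) ≤ D := Nat.cast_nonneg D
  have hD : (1:ℝ) ≤ D + 1 := by linarith
  rw [hinteg]
  refine ⟨hfin _ ?_, hfin _ ?_⟩
  · rw [hpQ]
    calc |Q c y| ≤ ∑ i : Fin (D+1), |c i * y ^ (i:ℕ)| := Finset.abs_sum_le_sum_abs _ _
      _ ≤ ∑ i : Fin (D+1), ‖c‖ := by
          apply Finset.sum_le_sum; intro i _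
          rw [abs_mul, abs_of_nonneg (pow_nonneg hy.1 _)]
          calc _ ≤ ‖c‖ * 1 := mul_le_mul (hci i) (pow_le_one₀ hy.1 hy.2) (pow_nonneg hy.1 _) (norm_nonneg _)
            _ = _ := mul_one _
      _ = (D+1) * ‖c‖ := by simp
      _ ≤ _ := by
          apply mul_le_mul_of_nonneg_right _ (norm_nonneg _)
          nlinarith
  · have hd : p.derivative.eval y = ∑ i : Fin (D+1), c i * i * y ^ ((i:ℕ) - 1) := by
      conv_lhs => rw [p.as_sum_range_C_mul_X_pow' (n := D+1) (by omega)]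
      rw [Polynomial.derivative_sum, Polynomial.eval_finset_sum, Finset.sum_range]
      refine Finset.sum_congr rfl fun i _ => ?_
      simp only [Polynomial.derivative_C_mul_X_pow, Polynomial.eval_mul, Polynomial.eval_C,
        Polynomial.eval_pow, Polynomial.eval_X, c]
    rw [hd]
    calc |∑ i : Fin (D+1), c i * i * y ^ ((i:ℕ) - 1)|
        ≤ ∑ i : Fin (D+1), |c i * i * y ^ ((i:ℕ) - 1)| := Finset.abs_sum_le_sum_abs _ _
      _ ≤ ∑ i : Fin (D+1), (D+1) * ‖c‖ := by
          apply Finset.sum_le_sum; intro i _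
          rw [abs_mul, abs_mul, abs_of_nonneg (pow_nonneg hy.1 _), Nat.abs_cast]
          have hi : ((i:ℕ):ℝ) ≤ D + 1 := by exact_mod_cast i.2.le
          calc _ ≤ ‖c‖ * (D+1) * 1 := by
                apply mul_le_mul _ (pow_le_one₀ hy.1 hy.2) (pow_nonneg hy.1 _) (by positivity)
                exact mul_le_mul (hci i) hi (by positivity) (norm_nonneg _)
            _ = _ := by ring
      _ = (D+1)^2 * ‖c‖ := by simp; ring

theorem poly_inv (D : ℕ) : ∃ C : ℝ, 1 ≤ C ∧ ∀ p : Polynomial ℝ, p.natDegree ≤ D → ∀ a b : ℝ, a < b →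
    ∀ y ∈ Icc a b, (b - a) * p.eval y ^ 2 ≤ C * ∫ z in a..b, p.eval z ^ 2 ∧
      (b - a) ^ 3 * p.derivative.eval y ^ 2 ≤ C * ∫ z in a..b, p.eval z ^ 2 := by
  obtain ⟨C, hC, H⟩ := poly_inv01 D
  refine ⟨C, hC, fun p hp a b hab y hy => ?_⟩
  have hba : 0 < b - a := by linarith
  let q : Polynomial ℝ := p.comp (Polynomial.C (b-a) * Polynomial.X + Polynomial.C a)
  have hq : ∀ z, q.eval z = p.eval ((b-a) * z + a) := fun z => by simp [q, Polynomial.eval_comp]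
  have hq' : ∀ z, q.derivative.eval z = (b-a) * p.derivative.eval ((b-a) * z + a) := fun z => by
    simp [q, Polynomial.derivative_comp, Polynomial.eval_comp]
  have hdeg : q.natDegree ≤ D := by
    refine Polynomial.natDegree_comp_le.trans ?_
    calc _ ≤ p.natDegree * 1 := Nat.mul_le_mul_left _ Polynomial.natDegree_linear_le
      _ ≤ D := by omega
  have hinteg : ∫ z in (0:ℝ)..1, q.eval z ^ 2 = (b-a)⁻¹ * ∫ z in a..b, p.eval z ^ 2 := by
    simp only [hq]
    have := intervalIntegral.integral_comp_mul_add (a := 0) (b := 1) (fun z => p.eval z ^ 2) hba.ne' a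
    simpa using this
  have h0 : (y - a) / (b - a) ∈ Icc (0:ℝ) 1 :=
    ⟨div_nonneg (by linarith [hy.1]) hba.le, (div_le_one hba).2 (by linarith [hy.2])⟩
  have h1 := H q hdeg _ h0
  have h2 : (b-a) * ((y - a) / (b - a)) + a = y := by field_simp; ring
  rw [hq, hq', h2, hinteg] at h1
  have h3 : (b - a) * (C * ((b-a)⁻¹ * ∫ z in a..b, p.eval z ^ 2)) = C * ∫ z in a..b, p.eval z ^ 2 := by
    field_simp
  constructor
  · rw [← h3]; exact mul_le_mul_of_nonneg_left h1.1 hba.le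
  · rw [← h3]
    refine le_trans (le_of_eq ?_) (mul_le_mul_of_nonneg_left h1.2 hba.le)
    ring

theorem spl_inv (d s : ℕ) (γ : ℝ) (hγ : 1 ≤ γ) : ∃ K : ℝ, 1 ≤ K ∧ ∀ (N : ℕ) (x : ℕ → ℝ) (h : ℝ),
    IsPartition N x → IsMeshSize N x h → QuasiUniform N x h γ → ∀ φ ∈ Sp N x d (s+1), ∀ φ',
      PW φ φ' → h * nrm φ' ≤ K * nrm φ ∧ (∀ y ∈ Icc (0:ℝ) 1, h * φ y ^ 2 ≤ K * nrm φ ^ 2) ∧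
        ∀ᵐ y ∂mu, h ^ 3 * φ' y ^ 2 ≤ K * nrm φ ^ 2 := by
  obtain ⟨C, hC, H⟩ := poly_inv (d+s+1)
  have hg3 : 1 ≤ γ ^ 3 := one_le_pow₀ hγ
  have hK1 : 1 ≤ C * γ ^ 3 := by nlinarith
  refine ⟨C * γ ^ 3, hK1, ?_⟩
  intro N x h hx hm hq φ hφ φ' hP
  have hh := mesh_pos hx hm
  choose p hp hpe using hφ.2
  have hb2 := hP.bd.pow 2
  have hI : ∀ j (hj : j < N), ∫ z in x j..x (j+1), (p j hj).eval z ^ 2 = ∫ z in x j..x (j+1), φ z ^ 2 := by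
    intro j hj
    apply intervalIntegral.integral_congr
    intro z hz
    rw [uIcc_of_le (hx.2.2 j hj).le] at hz
    beta_reduce
    rw [hpe j hj z hz]
  have hIle : ∀ j < N, ∫ z in x j..x (j+1), φ z ^ 2 ≤ nrm φ ^ 2 := by
    intro j hj
    rw [nrm_sq_int, ← int01]
    apply intervalIntegral.integral_mono_interval (part_nonneg hx hj.le) (hx.2.2 j hj).le
      (part_le_one hx hj)
    · exact Filter.Eventually.of_forall fun z => sq_nonneg _
    · exact hb2.ii
  have hI0 : ∀ j < N, 0 ≤ ∫ z in x j..x (j+1), φ z ^ 2 := fun j hj =>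
    intervalIntegral.integral_nonneg (hx.2.2 j hj).le fun z _ => sq_nonneg _
  have hd : ∀ j (hj : j < N), ∀ y ∈ Ioo (x j) (x (j+1)), deriv φ y = (p j hj).derivative.eval y := by
    intro j hj y hy
    apply HasDerivAt.deriv
    refine ((p j hj).hasDerivAt y).congr_of_eventuallyEq ?_
    filter_upwards [Ioo_mem_nhds hy.1 hy.2] with z hz
    exact hpe j hj z (Ioo_subset_Icc_self hz)
  have hl : ∀ j < N, h ≤ γ * (x (j+1) - x j) := fun j hj => hq j hj
  have hder3 : ∀ j (hj : j < N), ∀ y ∈ Ioo (x j) (x (j+1)),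
      h ^ 3 * deriv φ y ^ 2 ≤ C * γ ^ 3 * ∫ z in x j..x (j+1), φ z ^ 2 := by
    intro j hj y hy
    have h1 := (H (p j hj) (hp j hj) _ _ (hx.2.2 j hj) y (Ioo_subset_Icc_self hy)).2
    rw [hI j hj, ← hd j hj y hy] at h1
    have h2 : h ^ 3 ≤ γ ^ 3 * (x (j+1) - x j) ^ 3 := by
      rw [← mul_pow]; exact pow_le_pow_left₀ hh.le (hl j hj) 3
    calc h ^ 3 * deriv φ y ^ 2 ≤ (γ ^ 3 * (x (j+1) - x j) ^ 3) * deriv φ y ^ 2 :=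
          mul_le_mul_of_nonneg_right h2 (sq_nonneg _)
      _ = γ ^ 3 * ((x (j+1) - x j) ^ 3 * deriv φ y ^ 2) := by ring
      _ ≤ γ ^ 3 * (C * ∫ z in x j..x (j+1), φ z ^ 2) := mul_le_mul_of_nonneg_left h1 (by positivity)
      _ = _ := by ring
  have hdb : Bd (deriv φ) := hP.bd'.congr hP.deriv_ae.symm
  refine ⟨?_, ?_, ?_⟩
  · rw [← nrm_congr hP.deriv_ae]
    have : nrm (deriv φ) ≤ (C * γ ^ 3 / h) * nrm φ := by
      apply elem_le hx hdb hP.bd _ (by positivity)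
      intro j hj
      have h0 := part_nonneg hx hj.le
      have h1 := part_le_one hx hj
      have h2 := hx.2.2 j hj
      have hℓ : 0 < x (j+1) - x j := by linarith
      calc ∫ y in x j..x (j+1), deriv φ y ^ 2
          ≤ ∫ y in x j..x (j+1), (C * ∫ z in x j..x (j+1), φ z ^ 2) / (x (j+1) - x j) ^ 3 := by
            apply intervalIntegral.integral_mono_on_of_le_Ioo h2.le
            · exact (hdb.pow 2).ii' h0 (h2.le.trans h1) (h0.trans h2.le) h1
            · simp
            · intro y hy
              have h3 := (H (p j hj) (hp j hj) _ _ (hx.2.2 j hj) y (Ioo_subset_Icc_self hy)).2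
              rw [hI j hj, ← hd j hj y hy] at h3
              rw [le_div_iff₀ (by positivity)]
              linarith
        _ = (C / (x (j+1) - x j) ^ 2) * ∫ z in x j..x (j+1), φ z ^ 2 := by
            rw [intervalIntegral.integral_const, smul_eq_mul]
            field_simp
        _ ≤ _ := by
            apply mul_le_mul_of_nonneg_right _ (hI0 j hj)
            rw [div_pow, div_le_div_iff₀ (by positivity) (by positivity)]
            have h4 : h ^ 2 ≤ γ ^ 2 * (x (j+1) - x j) ^ 2 := by
              rw [← mul_pow]; exact pow_le_pow_left₀ hh.le (hl j hj) 2
            have h5 : C * γ ^ 2 ≤ (C * γ ^ 3) ^ 2 := by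
              have a1 : γ ^ 2 ≤ γ ^ 6 := pow_le_pow_right₀ hγ (by norm_num)
              have a2 : C ≤ C ^ 2 := by nlinarith
              calc C * γ ^ 2 ≤ C ^ 2 * γ ^ 6 := mul_le_mul a2 a1 (by positivity) (by positivity)
                _ = _ := by ring
            calc C * h ^ 2 ≤ C * (γ ^ 2 * (x (j+1) - x j) ^ 2) :=
                  mul_le_mul_of_nonneg_left h4 (by linarith)
              _ = (C * γ ^ 2) * (x (j+1) - x j) ^ 2 := by ring
              _ ≤ _ := mul_le_mul_of_nonneg_right h5 (sq_nonneg _)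
    calc h * nrm (deriv φ) ≤ h * ((C * γ ^ 3 / h) * nrm φ) := mul_le_mul_of_nonneg_left this hh.le
      _ = _ := by field_simp
  · intro y hy
    obtain ⟨j, hj, hyj⟩ : ∃ j < N, y ∈ Icc (x j) (x (j+1)) := by
      by_cases h1 : y = 1
      · have hN : 0 < N := by
          rcases Nat.eq_zero_or_pos N with h0 | h0
          · have a := hx.1; have b := hx.2.1
            rw [h0, a] at b; norm_num at b
          · exact h0
        refine ⟨N - 1, by omega, ?_⟩
        have h2 : N - 1 + 1 = N := by omega
        rw [h2, hx.2.1, h1]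
        exact ⟨part_le_one hx (by omega), le_rfl⟩
      · obtain ⟨j, hj, h2⟩ := part_find hx ⟨hy.1, lt_of_le_of_ne hy.2 h1⟩
        exact ⟨j, hj, Ico_subset_Icc_self h2⟩
    have h1 := (H (p j hj) (hp j hj) _ _ (hx.2.2 j hj) y hyj).1
    rw [hI j hj, ← hpe j hj y hyj] at h1
    have h3 : γ ≤ γ ^ 3 := by nlinarith [sq_nonneg γ]
    calc h * φ y ^ 2 ≤ (γ * (x (j+1) - x j)) * φ y ^ 2 :=
          mul_le_mul_of_nonneg_right (hl j hj) (sq_nonneg _)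
      _ = γ * ((x (j+1) - x j) * φ y ^ 2) := by ring
      _ ≤ γ * (C * ∫ z in x j..x (j+1), φ z ^ 2) := mul_le_mul_of_nonneg_left h1 (by linarith)
      _ = (C * γ) * ∫ z in x j..x (j+1), φ z ^ 2 := by ring
      _ ≤ (C * γ ^ 3) * nrm φ ^ 2 := mul_le_mul (mul_le_mul_of_nonneg_left h3 (by linarith)) (hIle j hj)
          (hI0 j hj) (by linarith)
  · filter_upwards [hP.deriv_ae, ae_mu_off (p := fun y => h ^ 3 * deriv φ y ^ 2 ≤ C * γ ^ 3 * nrm φ ^ 2)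
      (nodes_countable N x) (fun y hy => by
        obtain ⟨j, hj, hyj⟩ := part_find' hx hy
        exact (hder3 j hj y hyj).trans (mul_le_mul_of_nonneg_left (hIle j hj) (by linarith)))] with y h1 h2
    rwa [← h1]

theorem superapprox (d : ℕ) (γ M : ℝ) (hγ : 1 ≤ γ) (hM : 0 ≤ M) (s : ℕ) : ∃ K : ℝ, 0 ≤ K ∧
    ∀ (N : ℕ) (x : ℕ → ℝ) (h : ℝ),
    IsPartition N x → IsMeshSize N x h → QuasiUniform N x h γ → ∀ ζ ζ' : ℝ → ℝ,
      (∀ y ∈ Icc (0:ℝ) 1, HasDerivWithinAt ζ (ζ' y) (Icc 0 1) y) → ContinuousOn ζ' (Icc 0 1) →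
      (∀ y ∈ Icc (0:ℝ) 1, |ζ y| ≤ M ∧ |ζ' y| ≤ M) → ∀ φ ∈ Sp N x d s,
      ∃ v ∈ Sp N x d s, nrm (fun y => ζ y * φ y - v y) ≤ K * h * nrm φ ∧
        (1 ≤ s → v 0 = ζ 0 * φ 0 ∧ v 1 = ζ 1 * φ 1) := by
  induction s with
  | zero =>
    refine ⟨M, hM, ?_⟩
    intro N x h hx hm hq ζ ζ' hζ hζc hb φ hφ
    have hh := mesh_pos hx hm
    have hZ := PW.of_hasDeriv hζ hζc
    obtain ⟨w, hw⟩ := exists_pcw hx (fun j y => ζ (x j) * φ y)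
    have hmem : w ∈ Sp N x d 0 := by
      intro j hj
      obtain ⟨p, hp, h1⟩ := hφ j hj
      refine ⟨Polynomial.C (ζ (x j)) * p, (Polynomial.natDegree_C_mul_le _ _).trans hp, fun y hy => ?_⟩
      rw [hw j hj y hy, h1 y hy]; simp
    have hφb := Sp0_bd hx d hφ
    have hwb := Sp0_bd hx d hmem
    refine ⟨w, hmem, ?_, by omega⟩
    rw [← abs_of_nonneg (mul_nonneg hM hh.le), ← nrm_smul]
    apply nrm_mono ((hZ.bd.mul hφb).sub hwb) ((Bd.const _).mul hφb)
    refine ae_mu_off (nodes_countable N x) fun y hy => ?_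
    obtain ⟨j, hj, hyj⟩ := part_find' hx hy
    rw [hw j hj y hyj, ← sub_mul, abs_mul, abs_mul, abs_of_nonneg (mul_nonneg hM hh.le)]
    apply mul_le_mul_of_nonneg_right _ (abs_nonneg _)
    have hxj : x j ∈ Icc (0:ℝ) 1 := ⟨part_nonneg hx hj.le, part_le_one hx hj.le⟩
    have := (convex_Icc (0:ℝ) 1).norm_image_sub_le_of_norm_hasDerivWithin_le (f := ζ) (f' := ζ') (C := M)
      hζ (fun z hz => (hb z hz).2) hxj (Ioo_subset_Icc_self hy.1)
    rw [Real.norm_eq_abs, Real.norm_eq_abs] at this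
    refine this.trans (mul_le_mul_of_nonneg_left ?_ hM)
    rw [abs_of_nonneg (by linarith [hyj.1])]
    linarith [hyj.2, hm.1 j hj]
  | succ s ih =>
    obtain ⟨K, hK, H⟩ := ih
    obtain ⟨L, hL, HL⟩ := spl_inv d s γ hγ
    refine ⟨M + K * L, by positivity, ?_⟩
    intro N x h hx hm hq ζ ζ' hζ hζc hb φ hφ
    have hh := mesh_pos hx hm
    have hZ := PW.of_hasDeriv hζ hζc
    obtain ⟨g, hg, hPg⟩ := Sp_deriv hx d s hφ
    obtain ⟨w, hw, h1, -⟩ := H N x h hx hm hq ζ ζ' hζ hζc hb g hg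
    have hwb := Sp_bd hx d s hw
    obtain ⟨v, hv, v', hv', hPv, hv0, hv1, hbest, herr⟩ := quasi hx hm d s (approx_all hx hm d s)
      (hZ.mul hPg)
    refine ⟨v, hv, ?_, fun _ => ⟨hv0, hv1⟩⟩
    have hφb := hPg.bd
    have hgb := hPg.bd'
    have h2 : nrm (fun y => (ζ' y * φ y + ζ y * g y) - w y) ≤ M * nrm φ + K * h * nrm g := by
      have e1 : (fun y => (ζ' y * φ y + ζ y * g y) - w y) =
        fun y => ζ' y * φ y + (ζ y * g y - w y) := by funext y; ring
      rw [e1]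
      refine (nrm_add_le (hZ.bd'.mul hφb) ((hZ.bd.mul hgb).sub hwb)).trans (add_le_add ?_ h1)
      exact nrm_mul_le hZ.bd' hφb hM (ae_mu_of fun y hy => (hb y hy).2)
    have h3 := (HL N x h hx hm hq φ hφ g hPg).1
    calc _ ≤ h * (M * nrm φ + K * h * nrm g) :=
          herr.trans (mul_le_mul_of_nonneg_left ((hbest w hw).trans h2) hh.le)
      _ = h * (M * nrm φ + K * (h * nrm g)) := by ring
      _ ≤ h * (M * nrm φ + K * (L * nrm φ)) := by
          apply mul_le_mul_of_nonneg_left _ hh.le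
          linarith [mul_le_mul_of_nonneg_left h3 hK]
      _ = _ := by ring

theorem Sp_sub (N : ℕ) (x : ℕ → ℝ) (d s : ℕ) : Sp N x 0 (d+s+1) ⊆ Sp N x d (s+1) := by
  intro f hf
  refine ⟨hf.1.of_le (by exact_mod_cast (Nat.le_add_left s d)), fun j hj => ?_⟩
  obtain ⟨p, hp, h⟩ := hf.2 j hj
  exact ⟨p, by omega, h⟩

theorem proj_err (d s : ℕ) (γ M : ℝ) (hγ : 1 ≤ γ) (hM : 0 ≤ M) : ∃ K : ℝ, 0 ≤ K ∧
    ∀ (N : ℕ) (x : ℕ → ℝ) (h : ℝ),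
    IsPartition N x → IsMeshSize N x h → QuasiUniform N x h γ → ∀ f : ℝ → ℝ,
      ContDiffOn ℝ (d+s+2 : ℕ) f (Icc 0 1) →
      (∀ y ∈ Icc (0:ℝ) 1, |iteratedDerivWithin (d+s+2) f (Icc 0 1) y| ≤ M) →
      ∀ S : Set (ℝ → ℝ), S ⊆ Sp N x d (s+1) → FSp S →
      (∀ v ∈ Sp N x d (s+1), v 0 = f 0 → v 1 = f 1 → v ∈ S) →
      ∀ (n : ℕ) (e : Fin n → ℝ → ℝ), ONB S n e → ∀ g', PW (prj e f) g' →
        nrm (fun y => f y - prj e f y) ≤ K * h ^ (d+s+2) ∧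
        nrm (fun y => derivWithin f (Icc 0 1) y - g' y) ≤ K * h ^ (d+s+1) := by
  obtain ⟨L, hL, HL⟩ := spl_inv d s γ hγ
  refine ⟨M + L * (2 * M), by positivity, ?_⟩
  intro N x h hx hm hq f hf hb S hSs hS hv n e he g' hg'
  have hh := mesh_pos hx hm
  obtain ⟨v, hv1, v', hPv, hv0, hv1', h1, h2⟩ := approx_smooth' hx hm hM (d+s) f hf hb
  have hvS : v ∈ S := hv v (Sp_sub N x d s hv1) hv0 hv1'
  have hP := (PW.of_contDiffOn hf).1
  have hpS := he.prj_mem hS f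
  have h3 := (he.best hS hP.bd hvS).trans h1
  have h4 : nrm (fun y => v y - prj e f y) ≤ 2 * M * h ^ (d+s+2) := by
    have := nrm_sub_le3 hPv.bd hP.bd hg'.bd
    rw [nrm_sub_comm v f] at this
    linarith
  have h5 := (HL N x h hx hm hq _ (hSs (hS.sub v hvS _ hpS)) _ (hPv.sub hg')).1
  have h6 : nrm (fun y => v' y - g' y) ≤ L * (2 * M) * h ^ (d+s+1) := by
    refine le_of_mul_le_mul_left ?_ hh
    calc _ ≤ L * (2 * M * h ^ (d+s+2)) := h5.trans (mul_le_mul_of_nonneg_left h4 (by linarith))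
      _ = _ := by ring
  constructor
  · refine h3.trans (mul_le_mul_of_nonneg_right ?_ (by positivity))
    have : 0 ≤ L * (2 * M) := by positivity
    linarith
  · have := nrm_sub_le3 hP.bd' hPv.bd' hg'.bd'
    calc _ ≤ M * h ^ (d+s+1) + L * (2 * M) * h ^ (d+s+1) := this.trans (add_le_add h2 h6)
      _ = _ := by ring

theorem omega_err (d s : ℕ) (γ M : ℝ) (hγ : 1 ≤ γ) (hM : 0 ≤ M) : ∃ K : ℝ, 0 ≤ K ∧
    ∀ (N : ℕ) (x : ℕ → ℝ) (h : ℝ),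
    IsPartition N x → IsMeshSize N x h → QuasiUniform N x h γ → ∀ ζ ζ' : ℝ → ℝ,
      (∀ y ∈ Icc (0:ℝ) 1, HasDerivWithinAt ζ (ζ' y) (Icc 0 1) y) → ContinuousOn ζ' (Icc 0 1) →
      (∀ y ∈ Icc (0:ℝ) 1, |ζ y| ≤ M ∧ |ζ' y| ≤ M) → ∀ φ ∈ Sh0 N (d+s+2) s x,
      ∀ (n : ℕ) (e : Fin n → ℝ → ℝ), ONB (Sh0 N (d+s+2) s x) n e →
      nrm (fun y => ζ y * φ y - prj e (fun y => ζ y * φ y) y) ≤ K * h * nrm φ := by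
  obtain ⟨K, hK, H⟩ := superapprox d γ M hγ hM (s+1)
  refine ⟨K, hK, ?_⟩
  intro N x h hx hm hq ζ ζ' hζ hζc hb φ hφ n e he
  obtain ⟨v, hv, h1, h2⟩ := H N x h hx hm hq ζ ζ' hζ hζc hb φ hφ.1
  have h3 := h2 (by omega)
  rw [hφ.2.1, hφ.2.2, mul_zero, mul_zero] at h3
  have hZ := PW.of_hasDeriv hζ hζc
  exact (he.best (Sh0_fsp hx d s) (hZ.bd.mul (Sp_bd hx d (s+1) hφ.1)) ⟨hv, h3⟩).trans h1

theorem t3 {c M a b : ℝ} (hc : |c| ≤ M) : 2 * (c * a * b) ≤ M * (a ^ 2 + b ^ 2) := by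
  have h1 : c * (2 * a * b) ≤ |c| * (a ^ 2 + b ^ 2) := by
    refine (le_abs_self _).trans ?_
    rw [abs_mul]
    refine mul_le_mul_of_nonneg_left ?_ (abs_nonneg _)
    exact abs_le.2 ⟨by nlinarith [sq_nonneg (a + b)], by nlinarith [sq_nonneg (a - b)]⟩
  nlinarith [mul_le_mul_of_nonneg_right hc (by positivity : 0 ≤ a ^ 2 + b ^ 2)]

theorem t3' {c M a b : ℝ} (hc : |c| ≤ M) : -(2 * (c * a * b)) ≤ M * (a ^ 2 + b ^ 2) := by
  have := t3 (c := -c) (M := M) (a := a) (b := b) (by rwa [abs_neg])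
  linarith

theorem abs_mul_le' {a b A B : ℝ} (ha : |a| ≤ A) (hb : |b| ≤ B) : |a * b| ≤ A * B := by
  rw [abs_mul]; exact mul_le_mul ha hb (abs_nonneg _) ((abs_nonneg _).trans ha)

theorem pointwise_energy {h M w w' u u' ηt ρ ρ' σ σ' θ θ' ξ ξ' z : ℝ} (hh : 0 < h) (hM : 1 ≤ M)
    (hw : |w| ≤ M) (hw' : |w'| ≤ M) (hu : |u| ≤ M) (hu' : |u'| ≤ M) (hηt : |ηt| ≤ M)
    (hρ : |ρ| ≤ M) (hσ : |σ| ≤ M) (hθ : |θ| ≤ 1) (hξ : |ξ| ≤ 1) (hξ' : |ξ'| ≤ 1) :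
    -2 * ((w' * (σ + ξ) + w * (σ' + ξ')) + (u' * (ρ + θ) + u * (ρ' + θ'))
        - ((ρ' + θ') * (σ + ξ) + (ρ + θ) * (σ' + ξ'))) * θ
      - 2 * ((ρ' + θ') + (u * (σ' + ξ') + u' * (σ + ξ)) - (σ + ξ) * (σ' + ξ')) * z + ηt * ξ ^ 2
    ≤ (-2 * (w' * ξ * θ + w * ξ' * θ + w * ξ * θ') - (u' * θ ^ 2 + 2 * u * θ * θ')
        + (σ' * θ ^ 2 + 2 * σ * θ * θ') + (ξ' * θ ^ 2 + 2 * ξ * θ * θ')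
        - (u' * w * ξ ^ 2 + u * w' * ξ ^ 2 + 2 * u * w * ξ * ξ'))
      + 20 * M ^ 2 * (θ ^ 2 + ξ ^ 2 + z ^ 2 + ρ ^ 2 + σ ^ 2 + ρ' ^ 2 + σ' ^ 2 + (h * θ') ^ 2
        + (h * ξ') ^ 2 + ((w * ξ - z) / h) ^ 2) := by
  have hM2 : M ≤ M ^ 2 := by nlinarith
  have hM0 : 0 ≤ M := by linarith
  have e1 := t3' (a := σ) (b := θ) hw'
  have e2 := t3' (a := σ') (b := θ) hw
  have e3 : 2 * (θ' * (w * ξ - z)) ≤ (h * θ') ^ 2 + ((w * ξ - z) / h) ^ 2 := by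
    have : θ' * (w * ξ - z) = (h * θ') * ((w * ξ - z) / h) := by field_simp
    rw [this]; nlinarith [sq_nonneg (h * θ' - (w * ξ - z) / h)]
  have e4 := t3' (a := ρ) (b := θ) hu'
  have e5 := t3' (a := ρ') (b := θ) hu
  have e6 := t3' (a := θ) (b := θ) hu'
  have e7 := t3 (a := ρ') (b := θ) hσ
  have e8 := t3 (a := σ') (b := θ) hρ
  have e9 := t3 (a := ρ') (b := θ) hξ
  have e10 := t3 (a := ρ) (b := θ) hξ'
  have e11 := t3 (a := σ') (b := θ) hθ
  have e12 := t3 (a := θ) (b := θ) hξ'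
  have e13 := t3' (c := 1) (M := 1) (a := ρ') (b := z) (by simp)
  have e14 := t3' (a := σ') (b := z) hu
  have e15 := t3' (a := σ) (b := z) hu'
  have e16 := t3 (a := ξ) (b := ξ) (abs_mul_le' hu' hw)
  have e17 := t3 (a := ξ) (b := ξ) (abs_mul_le' hu hw')
  have e18 : 2 * (u * (ξ' * (w * ξ - z))) ≤ M * ((h * ξ') ^ 2 + ((w * ξ - z) / h) ^ 2) := by
    have : u * (ξ' * (w * ξ - z)) = u * (h * ξ') * ((w * ξ - z) / h) := by field_simp
    rw [this]; exact t3 hu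
  have e19 := t3' (a := ξ) (b := z) hu'
  have e20 := t3 (a := σ') (b := z) hσ
  have e21 := t3 (a := σ) (b := z) hξ'
  have e22 := t3 (a := σ') (b := z) hξ
  have e23 := t3 (a := ξ) (b := z) hξ'
  have e24 := t3 (a := ξ) (b := ξ) hηt
  set A := (h * θ') ^ 2
  set B := (h * ξ') ^ 2
  set D := ((w * ξ - z) / h) ^ 2
  have hA : 0 ≤ A := sq_nonneg _
  have hB : 0 ≤ B := sq_nonneg _
  have hD : 0 ≤ D := sq_nonneg _
  have hS : ∀ q, 0 ≤ q → M * q ≤ M ^ 2 * q ∧ q ≤ M ^ 2 * q ∧ 0 ≤ M ^ 2 * q := fun q hq => 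
    ⟨mul_le_mul_of_nonneg_right hM2 hq, by nlinarith, by positivity⟩
  have f1 := hS (θ^2) (sq_nonneg _)
  have f2 := hS (ξ^2) (sq_nonneg _)
  have f3 := hS (z^2) (sq_nonneg _)
  have f4 := hS (ρ^2) (sq_nonneg _)
  have f5 := hS (σ^2) (sq_nonneg _)
  have f6 := hS (ρ'^2) (sq_nonneg _)
  have f7 := hS (σ'^2) (sq_nonneg _)
  have f8 := hS A hA
  have f9 := hS B hB
  have f10 := hS D hD
  obtain ⟨f11, f12, f13⟩ := f1
  obtain ⟨f21, f22, f23⟩ := f2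
  obtain ⟨f31, f32, f33⟩ := f3
  obtain ⟨f41, f42, f43⟩ := f4
  obtain ⟨f51, f52, f53⟩ := f5
  obtain ⟨f61, f62, f63⟩ := f6
  obtain ⟨f71, f72, f73⟩ := f7
  obtain ⟨f81, f82, f83⟩ := f8
  obtain ⟨f91, f92, f93⟩ := f9
  obtain ⟨fa1, fa2, fa3⟩ := f10
  linarith

/-- the energy integrand -/
def EnF (w w' u u' ηt ρ ρ' σ σ' θ θ' ξ ξ' z : ℝ → ℝ) : ℝ → ℝ := fun y =>
    -2 * ((w' y * (σ y + ξ y) + w y * (σ' y + ξ' y)) + (u' y * (ρ y + θ y) + u y * (ρ' y + θ' y))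
        - ((ρ' y + θ' y) * (σ y + ξ y) + (ρ y + θ y) * (σ' y + ξ' y))) * θ y
      - 2 * ((ρ' y + θ' y) + (u y * (σ' y + ξ' y) + u' y * (σ y + ξ y)) - (σ y + ξ y) * (σ' y + ξ' y)) * z y
      + ηt y * ξ y ^ 2

theorem energy_int {h M : ℝ} {w w' u u' ηt ρ ρ' σ σ' θ θ' ξ ξ' z : ℝ → ℝ} (hh : 0 < h) (hM : 1 ≤ M)
    (pw : PW w w') (pu : PW u u') (bηt : Bd ηt) (pρ : PW ρ ρ') (pσ : PW σ σ') (pθ : PW θ θ') (pξ : PW ξ ξ')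
    (bz : Bd z)
    (hw : ∀ᵐ y ∂mu, |w y| ≤ M) (hw' : ∀ᵐ y ∂mu, |w' y| ≤ M) (hu : ∀ᵐ y ∂mu, |u y| ≤ M)
    (hu' : ∀ᵐ y ∂mu, |u' y| ≤ M) (hηt : ∀ᵐ y ∂mu, |ηt y| ≤ M)
    (hρ : ∀ᵐ y ∂mu, |ρ y| ≤ M) (hσ : ∀ᵐ y ∂mu, |σ y| ≤ M) (hθ : ∀ᵐ y ∂mu, |θ y| ≤ 1)
    (hξ : ∀ᵐ y ∂mu, |ξ y| ≤ 1) (hξ' : ∀ᵐ y ∂mu, |ξ' y| ≤ 1)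
    (u0 : u 0 = 0) (u1 : u 1 = 0) (s0 : σ 0 = 0) (s1 : σ 1 = 0) (x0 : ξ 0 = 0) (x1 : ξ 1 = 0) :
    ∫ y, EnF w w' u u' ηt ρ ρ' σ σ' θ θ' ξ ξ' z y ∂mu ≤
      20 * M ^ 2 * (nrm θ ^ 2 + nrm ξ ^ 2 + nrm z ^ 2 + nrm ρ ^ 2 + nrm σ ^ 2 + nrm ρ' ^ 2 + nrm σ' ^ 2
        + (h * nrm θ') ^ 2 + (h * nrm ξ') ^ 2 + (nrm (fun y => w y * ξ y - z y) / h) ^ 2) := by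
  have bw := pw.bd
  have bw' := pw.bd'
  have bu := pu.bd
  have bu' := pu.bd'
  have bρ := pρ.bd
  have bρ' := pρ.bd'
  have bσ := pσ.bd
  have bσ' := pσ.bd'
  have bθ := pθ.bd
  have bθ' := pθ.bd'
  have bξ := pξ.bd
  have bξ' := pξ.bd'
  have hF : Bd (EnF w w' u u' ηt ρ ρ' σ σ' θ θ' ξ ξ' z) := by unfold EnF; fun_prop
  let D0 : ℝ → ℝ := fun y =>
     (-2 * (w' y * ξ y * θ y + w y * ξ' y * θ y + w y * ξ y * θ' y) - (u' y * θ y ^ 2 + 2 * u y * θ y * θ' y)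
        + (σ' y * θ y ^ 2 + 2 * σ y * θ y * θ' y) + (ξ' y * θ y ^ 2 + 2 * ξ y * θ y * θ' y)
        - (u' y * w y * ξ y ^ 2 + u y * w' y * ξ y ^ 2 + 2 * u y * w y * ξ y * ξ' y))
  have hD0 : Bd D0 := by show Bd (fun y => _); fun_prop
  have hD : ∫ y, D0 y ∂mu = 0 := by
    have p1 := (((pw.mul pξ).mul pθ).smul (-2)).sub (pu.mul (pθ.mul pθ))
    have p2 := (p1.add (pσ.mul (pθ.mul pθ))).add (pξ.mul (pθ.mul pθ))
    have p3 := (p2.sub ((pu.mul pw).mul (pξ.mul pξ))).ftc01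
    rw [u0, u1, s0, s1, x0, x1] at p3
    have : D0 = _ := rfl
    refine (MeasureTheory.integral_congr_ae (Filter.Eventually.of_forall fun y => ?_)).trans (p3.trans (by ring))
    show D0 y = _
    simp only [D0]
    ring
  let Q : ℝ → ℝ := fun y => (θ y ^ 2 + ξ y ^ 2 + z y ^ 2 + ρ y ^ 2 + σ y ^ 2 + ρ' y ^ 2 + σ' y ^ 2 + (h * θ' y) ^ 2
        + (h * ξ' y) ^ 2 + (h⁻¹ * (w y * ξ y - z y)) ^ 2)
  have hQ : ∫ y, Q y ∂mu = (nrm θ ^ 2 + nrm ξ ^ 2 + nrm z ^ 2 + nrm ρ ^ 2 + nrm σ ^ 2 + nrm ρ' ^ 2 + nrm σ' ^ 2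
        + (h * nrm θ') ^ 2 + (h * nrm ξ') ^ 2 + (nrm (fun y => w y * ξ y - z y) / h) ^ 2) := by
    simp only [Q]
    have j : ∀ (c : ℝ) (f : ℝ → ℝ), Bd f → ∫ y, (c * f y) ^ 2 ∂mu = (c * nrm f) ^ 2 := by
      intro c f hf
      simp only [mul_pow]
      rw [MeasureTheory.integral_const_mul, nrm_sq_int]
    have k : ∀ (f g : ℝ → ℝ) (a b : ℝ), Bd f → Bd g → ∫ y, f y ∂mu = a → ∫ y, g y ∂mu = b →
        ∫ y, (f y + g y) ∂mu = a + b := by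
      intro f g a b hf hg h1 h2
      rw [MeasureTheory.integral_add hf.integrable hg.integrable, h1, h2]
    have l : ∀ f : ℝ → ℝ, ∫ y, f y ^ 2 ∂mu = nrm f ^ 2 := fun f => (nrm_sq_int f).symm
    rw [div_eq_inv_mul]
    refine k _ _ _ _ (by fun_prop) (by fun_prop) ?_ (j h⁻¹ (fun y => w y * ξ y - z y) (by fun_prop))
    refine k _ _ _ _ (by fun_prop) (by fun_prop) ?_ (j _ _ bξ')
    refine k _ _ _ _ (by fun_prop) (by fun_prop) ?_ (j _ _ bθ')
    refine k _ _ _ _ (by fun_prop) (by fun_prop) ?_ (l _)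
    refine k _ _ _ _ (by fun_prop) (by fun_prop) ?_ (l _)
    refine k _ _ _ _ (by fun_prop) (by fun_prop) ?_ (l _)
    refine k _ _ _ _ (by fun_prop) (by fun_prop) ?_ (l _)
    refine k _ _ _ _ (by fun_prop) (by fun_prop) ?_ (l _)
    exact k _ _ _ _ (by fun_prop) (by fun_prop) (l _) (l _)
  have hQb : Bd Q := by show Bd (fun y => _); fun_prop
  calc ∫ y, EnF w w' u u' ηt ρ ρ' σ σ' θ θ' ξ ξ' z y ∂mu ≤ ∫ y, (D0 y + 20 * M ^ 2 * Q y) ∂mu := by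
        apply MeasureTheory.integral_mono_ae hF.integrable (Bd.integrable (by fun_prop))
        filter_upwards [hw, hw', hu, hu', hηt, hρ, hσ, hθ, hξ, hξ'] with y a1 a2 a3 a4 a5 a6 a7 a8 a9 a10
        have := pointwise_energy (ρ' := ρ' y) (σ' := σ' y) (θ' := θ' y) (z := z y) hh hM a1 a2 a3 a4 a5 a6 a7 a8 a9 a10
        rw [div_eq_inv_mul] at this
        exact this
    _ = _ := by
        rw [MeasureTheory.integral_add hD0.integrable (Bd.integrable (by fun_prop)),
          MeasureTheory.integral_const_mul, hD, hQ, zero_add]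

set_option maxHeartbeats 1600000 in
theorem energy_static (d s : ℕ) (γ M : ℝ) (hγ : 1 ≤ γ) (hM : 0 ≤ M) : ∃ C : ℝ, 1 ≤ C ∧
    ∀ (N : ℕ) (x : ℕ → ℝ) (h : ℝ),
    IsPartition N x → IsMeshSize N x h → QuasiUniform N x h γ →
    ∀ (n : ℕ) (e : Fin n → ℝ → ℝ), ONB (Sh N (d+s+2) s x) n e →
    ∀ (n0 : ℕ) (f : Fin n0 → ℝ → ℝ), ONB (Sh0 N (d+s+2) s x) n0 f →
    ∀ η u ηt : ℝ → ℝ, ContDiffOn ℝ (d+s+2 : ℕ) η (Icc 0 1) → ContDiffOn ℝ (d+s+2 : ℕ) u (Icc 0 1) →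
      ContinuousOn ηt (Icc 0 1) →
      (∀ i ≤ d+s+2, ∀ y ∈ Icc (0:ℝ) 1, |iteratedDerivWithin i η (Icc 0 1) y| ≤ M) →
      (∀ i ≤ d+s+2, ∀ y ∈ Icc (0:ℝ) 1, |iteratedDerivWithin i u (Icc 0 1) y| ≤ M) →
      (∀ y ∈ Icc (0:ℝ) 1, |ηt y| ≤ M) → u 0 = 0 → u 1 = 0 →
      ∀ gη gu, PW (prj e η) gη → PW (prj f u) gu →
      nrm (fun y => η y - prj e η y) ≤ C * h ^ (d+s+1) ∧ nrm (fun y => u y - prj f u y) ≤ C * h ^ (d+s+1) ∧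
      ∀ θ θ' ξ ξ', θ ∈ Sh N (d+s+2) s x → PW θ θ' → ξ ∈ Sh0 N (d+s+2) s x → PW ξ ξ' →
        C * (nrm θ ^ 2 + nrm ξ ^ 2) ≤ h ^ 3 →
        ∫ y, EnF (fun y => 1 + η y) (derivWithin η (Icc 0 1)) u (derivWithin u (Icc 0 1)) ηt
          (fun y => η y - prj e η y) (fun y => derivWithin η (Icc 0 1) y - gη y)
          (fun y => u y - prj f u y) (fun y => derivWithin u (Icc 0 1) y - gu y)
          θ θ' ξ ξ' (prj f (fun y => (1 + η y) * ξ y)) y ∂mu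
        ≤ C * (nrm θ ^ 2 + nrm ξ ^ 2 + (h ^ (d+s+1)) ^ 2) := by
  obtain ⟨K1, hK1, H1⟩ := spl_inv d s γ hγ
  obtain ⟨K2, hK2, H2⟩ := proj_err d s γ M hγ hM
  obtain ⟨K3, hK3, H3⟩ := omega_err d s γ (1 + M) hγ (by linarith)
  set M1 := 1 + M + 3 * K2 with hM1
  set L := 20 * M1 ^ 2 with hL
  set Q := 1 + M1 ^ 2 + 4 * K2 ^ 2 + K1 ^ 2 + K3 ^ 2 with hQ
  have hM11 : 1 ≤ M1 := by linarith
  have hL0 : 1 ≤ L := by nlinarith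
  have hQ1 : 1 ≤ Q := by nlinarith [sq_nonneg M1, sq_nonneg K2, sq_nonneg K1, sq_nonneg K3]
  have hLQ : 0 ≤ L * Q * 2 := by positivity
  refine ⟨L * Q * 2 + K1 + K2, by linarith, ?_⟩
  intro N x h hx hm hq n e he n0 f hf η u ηt cη cu cηt bη bu bηt u0 u1 gη gu pgη pgu
  have hh := mesh_pos hx hm
  have hh1 := mesh_le_one hx hm
  have fs : FSp (Sh N (d+s+2) s x) := Sp_fsp hx d (s+1)
  have fs0 := Sh0_fsp hx d s
  obtain ⟨pη, cη'⟩ := PW.of_contDiffOn (s := d+s+1) cη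
  obtain ⟨pu, cu'⟩ := PW.of_contDiffOn (s := d+s+1) cu
  obtain ⟨e1, e2⟩ := H2 N x h hx hm hq η cη (bη _ le_rfl) (Sh N (d+s+2) s x) (fun _ h => h) fs
    (fun v hv _ _ => hv) n e he gη pgη
  obtain ⟨e3, e4⟩ := H2 N x h hx hm hq u cu (bu _ le_rfl) (Sh0 N (d+s+2) s x) (fun _ h => h.1) fs0
    (fun v hv h0 h1 => ⟨hv, by rw [h0, u0], by rw [h1, u1]⟩) n0 f hf gu pgu
  set P := h ^ (d+s+1) with hP
  have hP0 : 0 < P := by positivity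
  have hP1 : P ≤ 1 := pow_le_one₀ hh.le hh1
  have hPP : h ^ (d+s+2) ≤ P := pow_le_pow_of_le_one hh.le hh1 (by omega)
  have e1' : nrm (fun y => η y - prj e η y) ≤ K2 * P := e1.trans (mul_le_mul_of_nonneg_left hPP hK2)
  have e3' : nrm (fun y => u y - prj f u y) ≤ K2 * P := e3.trans (mul_le_mul_of_nonneg_left hPP hK2)
  have hCK : K2 * P ≤ (L * Q * 2 + K1 + K2) * P := mul_le_mul_of_nonneg_right (by linarith) hP0.le
  refine ⟨e1'.trans hCK, e3'.trans hCK, ?_⟩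
  intro θ θ' ξ ξ' hθ pθ hξ pξ hsm
  have hKP : K2 * P ≤ K2 := mul_le_of_le_one_right hK2 hP1
  have nn := nrm_nonneg
  have hN : K1 * (nrm θ ^ 2 + nrm ξ ^ 2) ≤ h ^ 3 := by
    refine le_trans (mul_le_mul_of_nonneg_right ?_ (by positivity)) hsm
    linarith
  have h31 : h ^ 3 ≤ h := pow_le_of_le_one hh.le hh1 (by norm_num)
  obtain ⟨a1, a2, -⟩ := H1 N x h hx hm hq θ hθ θ' pθ
  obtain ⟨b1, b2, b3⟩ := H1 N x h hx hm hq ξ hξ.1 ξ' pξ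
  have hh3 : 0 < h ^ 3 := by positivity
  have sθ : ∀ y ∈ Icc (0:ℝ) 1, |θ y| ≤ 1 := by
    intro y hy
    have := a2 y hy
    apply abs_le_one_iff_mul_self_le_one.2
    rw [← sq]
    have k : 0 ≤ K1 * nrm ξ ^ 2 := by positivity
    exact le_of_mul_le_mul_left (by linarith) hh
  have sξ : ∀ y ∈ Icc (0:ℝ) 1, |ξ y| ≤ 1 := by
    intro y hy
    have := b2 y hy
    apply abs_le_one_iff_mul_self_le_one.2
    rw [← sq]
    have k : 0 ≤ K1 * nrm θ ^ 2 := by positivity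
    exact le_of_mul_le_mul_left (by linarith) hh
  have sξ' : ∀ᵐ y ∂mu, |ξ' y| ≤ 1 := by
    filter_upwards [b3] with y hy
    apply abs_le_one_iff_mul_self_le_one.2
    rw [← sq]
    have k : 0 ≤ K1 * nrm θ ^ 2 := by positivity
    exact le_of_mul_le_mul_left (by linarith) hh3
  have pρ := pη.sub pgη
  have pσ := pu.sub pgu
  have hpf := hf.prj_mem fs0 u
  have bη0 : ∀ y ∈ Icc (0:ℝ) 1, |η y| ≤ M := fun y hy => by simpa using bη 0 (by omega) y hy
  have bu0 : ∀ y ∈ Icc (0:ℝ) 1, |u y| ≤ M := fun y hy => by simpa using bu 0 (by omega) y hy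
  have bη1 : ∀ y ∈ Icc (0:ℝ) 1, |derivWithin η (Icc 0 1) y| ≤ M := fun y hy => by
    simpa [iteratedDerivWithin_one] using bη 1 (by omega) y hy
  have bu1 : ∀ y ∈ Icc (0:ℝ) 1, |derivWithin u (Icc 0 1) y| ≤ M := fun y hy => by
    simpa [iteratedDerivWithin_one] using bu 1 (by omega) y hy
  have bw : ∀ y ∈ Icc (0:ℝ) 1, |1 + η y| ≤ 1 + M := fun y hy => by
    refine (abs_add_le _ _).trans ?_
    have := bη0 y hy
    simp only [abs_one]; linarith
  have pw : PW (fun y => 1 + η y) (derivWithin η (Icc 0 1)) := by simpa using (PW.const 1).add pη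
  set z := prj f (fun y => (1 + η y) * ξ y) with hz
  have zb : Bd z := hf.prj_bd fs0 _
  have main := energy_int (ηt := ηt) hh hM11 pw pu (Bd.of_cont cηt) pρ pσ pθ pξ zb
    (ae_mu_of fun y hy => (bw y hy).trans (by linarith))
    (ae_mu_of fun y hy => (bη1 y hy).trans (by linarith))
    (ae_mu_of fun y hy => (bu0 y hy).trans (by linarith))
    (ae_mu_of fun y hy => (bu1 y hy).trans (by linarith))
    (ae_mu_of fun y hy => (bηt y hy).trans (by linarith))
    (ae_mu_of fun y hy => (pρ.sup hy).trans (by linarith))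
    (ae_mu_of fun y hy => (pσ.sup hy).trans (by linarith))
    (ae_mu_of sθ) (ae_mu_of sξ) sξ' u0 u1 (by simp [u0, hpf.2.1]) (by simp [u1, hpf.2.2]) hξ.2.1 hξ.2.2
  refine main.trans ?_
  have bξ := pξ.bd
  have bw0 := pw.bd
  have z1 : nrm z ≤ M1 * nrm ξ := by
    refine (hf.prj_nrm fs0 (by fun_prop)).trans ?_
    exact nrm_mul_le bw0 bξ (by linarith) (ae_mu_of fun y hy => (bw y hy).trans (by linarith))
  have z2 : nrm (fun y => (1 + η y) * ξ y - z y) ≤ K3 * h * nrm ξ := by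
    refine H3 N x h hx hm hq (fun y => 1 + η y) (derivWithin η (Icc 0 1)) ?_ cη'.continuousOn
      (fun y hy => ⟨bw y hy, (bη1 y hy).trans (by linarith)⟩) ξ hξ n0 f hf
    intro y hy
    exact ((cη.differentiableOn (by simp)) y hy).hasDerivWithinAt.const_add 1
  have z3 : nrm (fun y => (1 + η y) * ξ y - z y) / h ≤ K3 * nrm ξ := by
    rw [div_le_iff₀ hh]; linarith
  have q1 := pow_le_pow_left₀ (nn _) z1 2
  have q2 := pow_le_pow_left₀ (div_nonneg (nn _) hh.le) z3 2
  have q3 := pow_le_pow_left₀ (nn _) e1' 2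
  have q4 := pow_le_pow_left₀ (nn _) e3' 2
  have q5 := pow_le_pow_left₀ (nn _) e2 2
  have q6 := pow_le_pow_left₀ (nn _) e4 2
  have q7 := pow_le_pow_left₀ (mul_nonneg hh.le (nn _)) a1 2
  have q8 := pow_le_pow_left₀ (mul_nonneg hh.le (nn _)) b1 2
  rw [mul_pow] at q1 q2 q3 q4 q5 q6
  rw [mul_pow K1] at q7 q8
  refine le_trans (mul_le_mul_of_nonneg_left (c := 2 * Q * (nrm θ ^ 2 + nrm ξ ^ 2 + P ^ 2)) ?_ (zero_le_one.trans hL0)) ?_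
  · have k1 : 0 ≤ (nrm θ ^ 2) := sq_nonneg _
    have k2 : 0 ≤ (nrm ξ ^ 2) := sq_nonneg _
    have k3 : 0 ≤ P ^ 2 := sq_nonneg _
    have m1 : ∀ a, 0 ≤ a → 0 ≤ M1 ^ 2 * a ∧ 0 ≤ K2 ^ 2 * a ∧ 0 ≤ K1 ^ 2 * a ∧ 0 ≤ K3 ^ 2 * a := fun a ha =>
      ⟨by positivity, by positivity, by positivity, by positivity⟩
    have m2 := m1 _ k1
    have m3 := m1 _ k2
    have m4 := m1 _ k3
    rw [hQ]
    linarith [m2.1, m2.2.1, m2.2.2.1, m2.2.2.2, m3.1, m3.2.1, m3.2.2.1, m3.2.2.2, m4.1, m4.2.1, m4.2.2.1, m4.2.2.2]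
  · have : 0 ≤ (K1 + K2) * (nrm θ ^ 2 + nrm ξ ^ 2 + P ^ 2) := by positivity
    linarith

theorem ip_time_deriv {T : ℝ} {φ φt : ℝ → ℝ → ℝ}
    (hd : ∀ y ∈ Icc (0:ℝ) 1, ∀ t ∈ Icc (0:ℝ) T, HasDerivWithinAt (fun s => φ y s) (φt y t) (Icc 0 T) t)
    (hb : ∀ t ∈ Icc (0:ℝ) T, ContinuousOn (fun y => φ y t) (Icc 0 1))
    (hb' : ∀ t ∈ Icc (0:ℝ) T, ContinuousOn (fun y => φt y t) (Icc 0 1))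
    (hc : ContinuousOn (fun p : ℝ × ℝ => φt p.1 p.2) (Icc (0:ℝ) 1 ×ˢ Icc (0:ℝ) T))
    {g : ℝ → ℝ} (hg : Bd g) {t : ℝ} (ht : t ∈ Icc (0:ℝ) T) :
    HasDerivWithinAt (fun s => ip (fun y => φ y s) g) (ip (fun y => φt y t) g) (Icc 0 T) t := by
  rw [hasDerivWithinAt_iff_isLittleO, Asymptotics.isLittleO_iff]
  intro c hc0
  have huc := (isCompact_Icc.prod isCompact_Icc).uniformContinuousOn_of_continuous hc
  rw [Metric.uniformContinuousOn_iff] at huc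
  have hc1 : 0 < c / (1 + nrm g) := div_pos hc0 (by linarith [nrm_nonneg g])
  obtain ⟨δ, hδ, H⟩ := huc _ hc1
  have hbt := Bd.of_cont (hb t ht)
  have hbt' := Bd.of_cont (hb' t ht)
  filter_upwards [self_mem_nhdsWithin, mem_nhdsWithin_of_mem_nhds (Metric.ball_mem_nhds t hδ)] with s hs hsb
  have hbs := Bd.of_cont (hb s hs)
  have key : ∀ y ∈ Icc (0:ℝ) 1, |φ y s - φ y t - (s - t) * φt y t| ≤ c / (1 + nrm g) * |s - t| := by
    intro y hy
    have := Convex.norm_image_sub_le_of_norm_hasDerivWithin_le (𝕜 := ℝ) (f := fun s => φ y s - s * φt y t)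
      (f' := fun s => φt y s - φt y t) (s := Icc 0 T ∩ Metric.ball t δ) (x := t) (y := s) (C := c / (1 + nrm g))
      (fun r hr => by
        have := ((hd y hy r hr.1).sub ((hasDerivWithinAt_id r _).mul_const (φt y t)))
        exact (this.congr_deriv (by simp)).mono inter_subset_left)
      (fun r hr => by
        have := H (y, r) ⟨hy, hr.1⟩ (y, t) ⟨hy, ht⟩ (by
          have := hr.2
          simpa [Prod.dist_eq, hδ] using this)
        rw [Real.dist_eq] at this
        exact this.le)
      ((convex_Icc 0 T).inter (convex_ball t δ)) ⟨ht, Metric.mem_ball_self hδ⟩ ⟨hs, hsb⟩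
    simp only [Real.norm_eq_abs] at this
    convert this using 2
    ring
  have e : ip (fun y => φ y s) g - ip (fun y => φ y t) g - (s - t) • ip (fun y => φt y t) g
      = ip (fun y => φ y s - φ y t - (s - t) * φt y t) g := by
    rw [ip_sub (by fun_prop) (by fun_prop) hg, ip_sub (by fun_prop) (by fun_prop) hg, ip_smul, smul_eq_mul]
  rw [e, Real.norm_eq_abs, Real.norm_eq_abs]
  refine (ip_cs (by fun_prop) hg).trans ?_
  have h1 := nrm_le_of_bound (f := fun y => φ y s - φ y t - (s - t) * φt y t) (by fun_prop)
    (by positivity) (ae_mu_of key)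
  have h2 := nrm_nonneg g
  refine (mul_le_mul_of_nonneg_right h1 h2).trans ?_
  have h3 : c / (1 + nrm g) * nrm g ≤ c := by
    rw [div_mul_eq_mul_div, div_le_iff₀ (by linarith)]; nlinarith
  nlinarith [abs_nonneg (s - t)]

theorem lip_ball {ι : Type} [Fintype ι] {V : (ι → ℝ) → (ι → ℝ)} (hV : ContDiff ℝ 1 V) (R : ℝ) :
    ∃ K, LipschitzOnWith K V (Metric.closedBall 0 R) :=
  LocallyLipschitzOn.exists_lipschitzOnWith_of_compact (isCompact_closedBall _ _)
    (hV.locallyLipschitz.locallyLipschitzOn)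

/-- truncation -/
def clp {ι : Type} (R : ℝ) (v : ι → ℝ) : ι → ℝ := fun i => max (-R) (min R (v i))

theorem clp_id {ι : Type} {R : ℝ} {v : ι → ℝ} (h : ∀ i, |v i| ≤ R) : clp R v = v := by
  funext i
  have := abs_le.1 (h i)
  rw [clp, min_eq_right this.2, max_eq_right this.1]

theorem clp_mem {ι : Type} [Fintype ι] {R : ℝ} (hR : 0 ≤ R) (v : ι → ℝ) : clp R v ∈ Metric.closedBall 0 R := by
  rw [mem_closedBall_zero_iff, pi_norm_le_iff_of_nonneg hR]
  intro i
  rw [Real.norm_eq_abs, abs_le]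
  exact ⟨le_max_left _ _, max_le (by linarith) (min_le_left _ _)⟩

theorem clp_lip {ι : Type} [Fintype ι] (R : ℝ) : LipschitzWith 1 (clp R : (ι → ℝ) → ι → ℝ) := by
  apply LipschitzWith.of_dist_le_mul
  intro v w
  rw [NNReal.coe_one, one_mul, dist_pi_le_iff dist_nonneg]
  intro i
  refine le_trans ?_ (dist_le_pi_dist v w i)
  rw [Real.dist_eq, Real.dist_eq]
  simp only [clp]
  have h1 := abs_max_sub_max_le_abs (min R (v i)) (min R (w i)) (-R)
  have h2 := abs_min_sub_min_le_max R (v i) R (w i)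
  rw [max_comm (-R), max_comm (-R)]
  refine h1.trans (h2.trans ?_)
  simp

theorem clamped_ode {ι : Type} [Fintype ι] {V : (ι → ℝ) → (ι → ℝ)} (hV : ContDiff ℝ 1 V) {R : ℝ}
    (hR : 0 ≤ R) {T : ℝ} (hT : 0 < T) (v0 : ι → ℝ) :
    ∃ v : ℝ → ι → ℝ, v 0 = v0 ∧ ∀ t ∈ Icc (0:ℝ) T, HasDerivWithinAt v (V (clp R (v t))) (Icc 0 T) t := by
  obtain ⟨K, hK⟩ := lip_ball hV R
  obtain ⟨L, hL⟩ := (isCompact_closedBall (0 : ι → ℝ) R).exists_bound_of_continuousOn hV.continuous.continuousOn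
  have hL0 : 0 ≤ L := (norm_nonneg _).trans (hL 0 (Metric.mem_closedBall_self hR))
  have hlip : LipschitzWith (K * 1) (fun v => V (clp R v)) := by
    rw [← lipschitzOnWith_univ]
    exact hK.comp (clp_lip R).lipschitzOnWith (fun v _ => clp_mem hR v)
  have : IsPicardLindelof (fun _ v => V (clp R v)) (⟨0, le_rfl, hT.le⟩ : Icc (0:ℝ) T) v0 (L * T).toNNReal 0
      L.toNNReal (K * 1) :=
    { lipschitzOnWith := fun t _ => hlip.lipschitzOnWith
      continuousOn := fun _ _ => continuousOn_const
      norm_le := fun t _ v _ => by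
        rw [Real.coe_toNNReal _ hL0]
        exact hL _ (clp_mem hR v)
      mul_max_le := by
        rw [Real.coe_toNNReal _ hL0, Real.coe_toNNReal _ (by positivity)]
        simp [hT.le] }
  exact this.exists_eq_forall_mem_Icc_hasDerivWithinAt₀

theorem right_deriv {E : Type*} [NormedAddCommGroup E] [NormedSpace ℝ E] {T t : ℝ} {f : ℝ → E} {f' : E}
    (h : HasDerivWithinAt f f' (Icc 0 T) t) (ht : t ∈ Ico 0 T) : HasDerivWithinAt f f' (Ici t) t :=
  h.mono_of_mem_nhdsWithin (Icc_mem_nhdsGE_of_mem ht)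

theorem ode_unique {ι : Type} [Fintype ι] {V : (ι → ℝ) → (ι → ℝ)} (hV : ContDiff ℝ 1 V) {T : ℝ}
    {v w : ℝ → ι → ℝ} (h0 : v 0 = w 0)
    (hv : ∀ t ∈ Icc (0:ℝ) T, HasDerivWithinAt v (V (v t)) (Icc 0 T) t)
    (hw : ∀ t ∈ Icc (0:ℝ) T, HasDerivWithinAt w (V (w t)) (Icc 0 T) t) : EqOn v w (Icc 0 T) := by
  have cv : ContinuousOn v (Icc 0 T) := fun t ht => (hv t ht).continuousWithinAt
  have cw : ContinuousOn w (Icc 0 T) := fun t ht => (hw t ht).continuousWithinAt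
  obtain ⟨R1, h1⟩ := isCompact_Icc.exists_bound_of_continuousOn cv
  obtain ⟨R2, h2⟩ := isCompact_Icc.exists_bound_of_continuousOn cw
  obtain ⟨K, hK⟩ := lip_ball hV (max R1 R2)
  have hI : ∀ t ∈ Ico (0:ℝ) T, t ∈ Icc (0:ℝ) T := fun t ht => Ico_subset_Icc_self ht
  refine ODE_solution_unique_of_mem_Icc_right (v := fun _ => V) (s := fun _ => Metric.closedBall 0 (max R1 R2))
    (fun t _ => hK) cv (fun t ht => right_deriv (hv t (hI t ht)) ht) ?_ cw
    (fun t ht => right_deriv (hw t (hI t ht)) ht) ?_ h0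
  · exact fun t ht => mem_closedBall_zero_iff.2 ((h1 t (hI t ht)).trans (le_max_left _ _))
  · exact fun t ht => mem_closedBall_zero_iff.2 ((h2 t (hI t ht)).trans (le_max_right _ _))

/-- linear combination -/
def cmb {n : ℕ} (e : Fin n → ℝ → ℝ) (c : Fin n → ℝ) : ℝ → ℝ := fun y => ∑ i, c i * e i y

theorem cmb_bd {n : ℕ} {e : Fin n → ℝ → ℝ} (he : ∀ i, Bd (e i)) (c : Fin n → ℝ) : Bd (cmb e c) := by
  unfold cmb
  exact Bd.sum _ fun i => (Bd.const _).mul (he i)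

theorem cmb_pw {n : ℕ} {e e' : Fin n → ℝ → ℝ} (he : ∀ i, PW (e i) (e' i)) (c : Fin n → ℝ) :
    PW (cmb e c) (cmb e' c) := by
  unfold cmb
  exact PW.sum _ fun i => (he i).smul _

theorem cmb_sub {n : ℕ} (e : Fin n → ℝ → ℝ) (c d : Fin n → ℝ) (y : ℝ) :
    cmb e (fun i => c i - d i) y = cmb e c y - cmb e d y := by
  simp [cmb, sub_mul, Finset.sum_sub_distrib]

theorem ip_cmb {n : ℕ} {e : Fin n → ℝ → ℝ} (he : ∀ i, Bd (e i)) (c : Fin n → ℝ) {g : ℝ → ℝ} (hg : Bd g) :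
    ip (cmb e c) g = ∑ i, c i * ip (e i) g := by
  unfold cmb
  rw [ip_sum _ (fun i => (Bd.const _).mul (he i)) hg]
  simp only [ip_smul]

theorem ip_cmb_r {n : ℕ} {e : Fin n → ℝ → ℝ} (he : ∀ i, Bd (e i)) (c : Fin n → ℝ) {g : ℝ → ℝ} (hg : Bd g) :
    ip g (cmb e c) = ∑ i, c i * ip g (e i) := by
  rw [ip_comm, ip_cmb he c hg]
  simp only [ip_comm g]

theorem ip_cmb2 {n m : ℕ} {e : Fin n → ℝ → ℝ} {f : Fin m → ℝ → ℝ} (he : ∀ i, Bd (e i)) (hf : ∀ i, Bd (f i))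
    (c : Fin n → ℝ) (d : Fin m → ℝ) {g : ℝ → ℝ} (hg : Bd g) :
    ip (fun y => cmb e c y * cmb f d y) g = ∑ i, ∑ j, c i * d j * ip (fun y => e i y * f j y) g := by
  have h1 : (fun y => cmb e c y * cmb f d y) = fun y => ∑ i, c i * (e i y * cmb f d y) := by
    funext y
    simp only [cmb, Finset.sum_mul]
    simp only [mul_assoc]
  have hfd := cmb_bd hf d
  rw [h1, ip_sum _ (fun i => (Bd.const _).mul ((he i).mul hfd)) hg]
  refine Finset.sum_congr rfl fun i _ => ?_
  rw [ip_smul]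
  have h2 : (fun y => e i y * cmb f d y) = fun y => ∑ j, d j * (e i y * f j y) := by
    funext y
    simp only [cmb, Finset.mul_sum]
    exact Finset.sum_congr rfl fun j _ => by ring
  rw [h2, ip_sum _ (fun j => (Bd.const _).mul ((he i).mul (hf j))) hg, Finset.mul_sum]
  refine Finset.sum_congr rfl fun j _ => ?_
  rw [ip_smul, mul_assoc]

/-- first component of the Galerkin vector field -/
def VFA {n n0 : ℕ} (e e' : Fin n → ℝ → ℝ) (f f' : Fin n0 → ℝ → ℝ) (a : Fin n → ℝ) (b : Fin n0 → ℝ) (i : Fin n) : ℝ :=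
  - ip (fun y => cmb f' b y + (cmb e' a y * cmb f b y + cmb e a y * cmb f' b y)) (e i)

/-- second component of the Galerkin vector field -/
def VFB {n n0 : ℕ} (e' : Fin n → ℝ → ℝ) (f f' : Fin n0 → ℝ → ℝ) (a : Fin n → ℝ) (b : Fin n0 → ℝ) (l : Fin n0) : ℝ :=
  - ip (fun y => cmb e' a y + cmb f b y * cmb f' b y) (f l)

/-- Galerkin vector field -/
def VF {n n0 : ℕ} (e e' : Fin n → ℝ → ℝ) (f f' : Fin n0 → ℝ → ℝ) (v : Fin n ⊕ Fin n0 → ℝ) : Fin n ⊕ Fin n0 → ℝ :=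
  Sum.elim (VFA e e' f f' (fun i => v (Sum.inl i)) (fun l => v (Sum.inr l)))
    (VFB e' f f' (fun i => v (Sum.inl i)) (fun l => v (Sum.inr l)))

theorem VF_contDiff {n n0 : ℕ} {e e' : Fin n → ℝ → ℝ} {f f' : Fin n0 → ℝ → ℝ} (he : ∀ i, Bd (e i))
    (he' : ∀ i, Bd (e' i)) (hf : ∀ i, Bd (f i)) (hf' : ∀ i, Bd (f' i)) : ContDiff ℝ 1 (VF e e' f f') := by
  rw [contDiff_pi]
  rintro (i | l)
  · have : (fun v => VF e e' f f' v (Sum.inl i)) = fun v : Fin n ⊕ Fin n0 → ℝ =>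
        -((∑ l, v (Sum.inr l) * ip (f' l) (e i)) +
          ((∑ j, ∑ l, v (Sum.inl j) * v (Sum.inr l) * ip (fun y => e' j y * f l y) (e i)) +
           (∑ j, ∑ l, v (Sum.inl j) * v (Sum.inr l) * ip (fun y => e j y * f' l y) (e i)))) := by
      funext v
      simp only [VF, Sum.elim_inl, VFA]
      have h1 := cmb_bd hf' (fun l => v (Sum.inr l))
      have h2 := cmb_bd he' (fun l => v (Sum.inl l))
      have h3 := cmb_bd hf (fun l => v (Sum.inr l))
      have h4 := cmb_bd he (fun l => v (Sum.inl l))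
      rw [ip_add (by fun_prop) (by fun_prop) (he i), ip_add (by fun_prop) (by fun_prop) (he i),
        ip_cmb hf' _ (he i), ip_cmb2 he' hf _ _ (he i), ip_cmb2 he hf' _ _ (he i)]
    rw [this]
    fun_prop
  · have : (fun v => VF e e' f f' v (Sum.inr l)) = fun v : Fin n ⊕ Fin n0 → ℝ =>
        -((∑ j, v (Sum.inl j) * ip (e' j) (f l)) +
          (∑ j, ∑ m, v (Sum.inr j) * v (Sum.inr m) * ip (fun y => f j y * f' m y) (f l))) := by
      funext v
      simp only [VF, Sum.elim_inr, VFB]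
      have h1 := cmb_bd hf' (fun l => v (Sum.inr l))
      have h2 := cmb_bd he' (fun l => v (Sum.inl l))
      have h3 := cmb_bd hf (fun l => v (Sum.inr l))
      rw [ip_add (by fun_prop) (by fun_prop) (hf l), ip_cmb he' _ (hf l), ip_cmb2 hf hf' _ _ (hf l)]
    rw [this]
    fun_prop

/-- the derivative of the energy -/
theorem YD_eq {n n0 : ℕ} {e e' : Fin n → ℝ → ℝ} {f f' : Fin n0 → ℝ → ℝ} (pe : ∀ i, PW (e i) (e' i))
    (pf : ∀ i, PW (f i) (f' i)) {η u η' u' ηt ut : ℝ → ℝ} (pη : PW η η') (pu : PW u u') (bηt : Bd ηt) (but : Bd ut)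
    (pde1 : ∀ y ∈ Icc (0:ℝ) 1, ηt y + u' y + (η' y * u y + η y * u' y) = 0)
    (pde2 : ∀ y ∈ Icc (0:ℝ) 1, ut y + η' y + u y * u' y = 0)
    (a : Fin n → ℝ) (b : Fin n0 → ℝ) (α αd : Fin n → ℝ) (β βd : Fin n0 → ℝ)
    (hα : α = fun i => ip η (e i) - a i) (hβ : β = fun l => ip u (f l) - b l)
    (hαd : αd = fun i => ip ηt (e i) - VFA e e' f f' a b i)
    (hβd : βd = fun l => ip ut (f l) - VFB e' f f' a b l) :
    (∑ i, 2 * α i * αd i) + ∑ l, ∑ m, ((βd l * β m + β l * βd m) * ip (fun y => f l y * f m y) (fun y => 1 + η y)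
      + β l * β m * ip (fun y => f l y * f m y) ηt)
    = ∫ y, EnF (fun y => 1 + η y) η' u u' ηt
          (fun y => η y - prj e η y) (fun y => η' y - cmb e' (fun i => ip η (e i)) y)
          (fun y => u y - prj f u y) (fun y => u' y - cmb f' (fun l => ip u (f l)) y)
          (cmb e α) (cmb e' α) (cmb f β) (cmb f' β) (prj f (fun y => (1 + η y) * cmb f β y)) y ∂mu := by
  have be := fun i => (pe i).bd
  have be' := fun i => (pe i).bd'
  have bf := fun i => (pf i).bd
  have bf' := fun i => (pf i).bd'
  have bη := pη.bd
  have bη' := pη.bd'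
  have bu := pu.bd
  have bu' := pu.bd'
  have ba := cmb_bd be a
  have ba' := cmb_bd be' a
  have bb := cmb_bd bf b
  have bb' := cmb_bd bf' b
  have bα := cmb_bd be α
  have bβ := cmb_bd bf β
  have bw : Bd (fun y => 1 + η y) := by fun_prop
  set z := prj f (fun y => (1 + η y) * cmb f β y) with hz
  have bz : Bd z := cmb_bd bf _
  let G1 : ℝ → ℝ := fun y => ηt y + (cmb f' b y + (cmb e' a y * cmb f b y + cmb e a y * cmb f' b y))
  let G2 : ℝ → ℝ := fun y => ut y + (cmb e' a y + cmb f b y * cmb f' b y)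
  have bG1 : Bd G1 := by show Bd (fun y => _); fun_prop
  have bG2 : Bd G2 := by show Bd (fun y => _); fun_prop
  have e1 : ∀ i, αd i = ip G1 (e i) := by
    intro i
    simp only [hαd, VFA, G1]
    rw [sub_neg_eq_add]; exact (ip_add bηt (by fun_prop) (be i)).symm
  have e2 : ∀ i, βd i = ip G2 (f i) := by
    intro i
    simp only [hβd, VFB, G2]
    rw [sub_neg_eq_add]; exact (ip_add but (by fun_prop) (bf i)).symm
  have s1 : ∑ i, 2 * α i * αd i = 2 * ip G1 (cmb e α) := by
    rw [ip_cmb_r be α bG1, Finset.mul_sum]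
    exact Finset.sum_congr rfl fun i _ => by rw [e1]; ring
  have s2 : ∀ l, ∑ m, β m * ip (fun y => f l y * f m y) (fun y => 1 + η y) = ip (fun y => (1 + η y) * cmb f β y) (f l) := by
    intro l
    have bl := bf l
    have h1 : ip (fun y => (1 + η y) * cmb f β y) (f l) = ip (fun y => (1 + η y) * f l y) (cmb f β) := by
      rw [ip_eq, ip_eq]; congr 1; funext y; ring
    rw [h1, ip_cmb_r bf β (by fun_prop)]
    refine Finset.sum_congr rfl fun m _ => ?_
    congr 1
    rw [ip_eq, ip_eq]; congr 1; funext y; ring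
  have s3 : ∑ l, ∑ m, βd l * β m * ip (fun y => f l y * f m y) (fun y => 1 + η y) = ip G2 z := by
    have : ip G2 z = _ := ip_cmb_r bf (fun l => ip (fun y => (1 + η y) * cmb f β y) (f l)) bG2
    rw [this]
    refine Finset.sum_congr rfl fun l _ => ?_
    rw [← s2 l, ← e2, Finset.sum_mul]
    exact Finset.sum_congr rfl fun m _ => by ring
  have s4 : ∑ l, ∑ m, β l * βd m * ip (fun y => f l y * f m y) (fun y => 1 + η y) = ip G2 z := by
    rw [Finset.sum_comm, ← s3]
    refine Finset.sum_congr rfl fun l _ => Finset.sum_congr rfl fun m _ => ?_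
    have : (fun y => f m y * f l y) = fun y => f l y * f m y := by funext y; ring
    rw [this]; ring
  have s5 := ip_cmb2 bf bf β β bηt
  have s6 : (∑ l, ∑ m, ((βd l * β m + β l * βd m) * ip (fun y => f l y * f m y) (fun y => 1 + η y)
      + β l * β m * ip (fun y => f l y * f m y) ηt)) = ip G2 z + ip G2 z + ip (fun y => cmb f β y * cmb f β y) ηt := by
    rw [s5]
    nth_rewrite 1 [← s3]
    rw [← s4]
    simp only [← Finset.sum_add_distrib]
    exact Finset.sum_congr rfl fun l _ => Finset.sum_congr rfl fun m _ => by ring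
  rw [s1, s6, ip_eq, ip_eq, ip_eq]
  have i1 : MeasureTheory.Integrable (fun y => G1 y * cmb e α y) mu := Bd.integrable (by fun_prop)
  have i2 : MeasureTheory.Integrable (fun y => G2 y * z y) mu := Bd.integrable (by fun_prop)
  have i3 : MeasureTheory.Integrable (fun y => cmb f β y * cmb f β y * ηt y) mu := Bd.integrable (by fun_prop)
  have i4 : MeasureTheory.Integrable (fun y => 2 * (G1 y * cmb e α y)) mu := i1.const_mul 2
  have i5 : MeasureTheory.Integrable (fun y => (G2 y * z y + G2 y * z y)) mu := i2.add i2
  have i6 : MeasureTheory.Integrable (fun y => (G2 y * z y + G2 y * z y) + cmb f β y * cmb f β y * ηt y) mu := i5.add i3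
  rw [← MeasureTheory.integral_const_mul, ← MeasureTheory.integral_add i2 i2,
    ← MeasureTheory.integral_add i5 i3, ← MeasureTheory.integral_add i4 i6]
  apply MeasureTheory.integral_congr_ae
  apply ae_mu_of
  intro y hy
  have p1 := pde1 y hy
  have p2 := pde2 y hy
  have c1 : ∀ y, cmb e a y = prj e η y - cmb e α y := fun y => by
    rw [hα, cmb_sub]; simp [prj, cmb]
  have c2 : ∀ y, cmb f b y = prj f u y - cmb f β y := fun y => by
    rw [hβ, cmb_sub]; simp [prj, cmb]
  have c3 : cmb e' a y = cmb e' (fun i => ip η (e i)) y - cmb e' α y := by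
    rw [hα, cmb_sub]; simp
  have c4 : cmb f' b y = cmb f' (fun i => ip u (f i)) y - cmb f' β y := by
    rw [hβ, cmb_sub]; simp
  simp only [G1, G2, EnF]
  rw [c1, c2, c3, c4]
  have q1 : ηt y = -(u' y + (η' y * u y + η y * u' y)) := by linarith
  have q2 : ut y = -(η' y + u y * u' y) := by linarith
  rw [q2]
  linear_combination (2 * cmb e α y) * p1

theorem Y_hasDeriv {n n0 : ℕ} {α : ℝ → Fin n → ℝ} {αd : Fin n → ℝ} {β : ℝ → Fin n0 → ℝ} {βd : Fin n0 → ℝ}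
    {W : ℝ → Fin n0 → Fin n0 → ℝ} {Wd : Fin n0 → Fin n0 → ℝ} {S : Set ℝ} {t : ℝ}
    (hα : ∀ i, HasDerivWithinAt (fun s => α s i) (αd i) S t)
    (hβ : ∀ i, HasDerivWithinAt (fun s => β s i) (βd i) S t)
    (hW : ∀ l m, HasDerivWithinAt (fun s => W s l m) (Wd l m) S t) :
    HasDerivWithinAt (fun s => (∑ i, α s i ^ 2) + ∑ l, ∑ m, β s l * β s m * W s l m)
      ((∑ i, 2 * α t i * αd i) + ∑ l, ∑ m, ((βd l * β t m + β t l * βd m) * W t l m + β t l * β t m * Wd l m)) S t := by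
  refine HasDerivWithinAt.fun_add (HasDerivWithinAt.fun_sum fun i _ => ?_)
    (HasDerivWithinAt.fun_sum fun l _ => HasDerivWithinAt.fun_sum fun m _ => ?_)
  · exact ((hα i).fun_pow 2).congr_deriv (by simp)
  · exact ((hβ l).fun_mul (hβ m)).fun_mul (hW l m)

theorem Y_low {S S0 : Set (ℝ → ℝ)} (hS : FSp S) (hS0 : FSp S0) {n n0 : ℕ} {e : Fin n → ℝ → ℝ} {f : Fin n0 → ℝ → ℝ}
    (he : ONB S n e) (hf : ONB S0 n0 f) (α : Fin n → ℝ) (β : Fin n0 → ℝ) {w : ℝ → ℝ} (bw : Bd w)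
    {w0 : ℝ} (h1 : w0 ≤ 1) (hw : ∀ y ∈ Icc (0:ℝ) 1, w0 ≤ w y) :
    w0 * (nrm (cmb e α) ^ 2 + nrm (cmb f β) ^ 2) ≤
      (∑ i, α i ^ 2) + ∑ l, ∑ m, β l * β m * ip (fun y => f l y * f m y) w := by
  have bf := hf.ebd hS0
  rw [← ip_cmb2 bf bf β β bw]
  have e1 : nrm (cmb e α) ^ 2 = ∑ i, α i ^ 2 := he.nrm_comb hS α
  rw [← e1, mul_add]
  have bβ := cmb_bd bf β
  apply add_le_add
  · nlinarith [sq_nonneg (nrm (cmb e α))]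
  · rw [nrm_sq_int, ip_eq, ← MeasureTheory.integral_const_mul]
    apply MeasureTheory.integral_mono_ae (Bd.integrable (by fun_prop)) (Bd.integrable (by fun_prop))
    apply ae_mu_of
    intro y hy
    have := mul_le_mul_of_nonneg_left (hw y hy) (mul_self_nonneg (cmb f β y))
    beta_reduce
    linarith [sq (cmb f β y)]

theorem onb_nrm {S : Set (ℝ → ℝ)} {n : ℕ} {e : Fin n → ℝ → ℝ} (he : ONB S n e) (i : Fin n) : nrm (e i) = 1 := by
  have h1 : nrm (e i) ^ 2 = 1 := by rw [nrm_sq, he.orth]; simp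
  nlinarith [nrm_nonneg (e i)]

theorem coef_le {S : Set (ℝ → ℝ)} (hS : FSp S) {n : ℕ} {e : Fin n → ℝ → ℝ} (he : ONB S n e) {η : ℝ → ℝ} (bη : Bd η)
    {M : ℝ} (hM : 0 ≤ M) (hb : ∀ y ∈ Icc (0:ℝ) 1, |η y| ≤ M) (a : Fin n → ℝ)
    (h : nrm (cmb e (fun i => ip η (e i) - a i)) ^ 2 ≤ 1) (i : Fin n) : |a i| ≤ M + 1 := by
  have e1 : nrm (cmb e (fun i => ip η (e i) - a i)) ^ 2 = ∑ i, (ip η (e i) - a i) ^ 2 := he.nrm_comb hS _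
  have h1 : (ip η (e i) - a i) ^ 2 ≤ 1 := by
    refine le_trans ?_ (e1 ▸ h)
    exact Finset.single_le_sum (f := fun i => (ip η (e i) - a i) ^ 2) (fun j _ => sq_nonneg _) (Finset.mem_univ i)
  have h2 : |ip η (e i) - a i| ≤ 1 := abs_le_one_iff_mul_self_le_one.2 (by rwa [← sq])
  have h3 : |ip η (e i)| ≤ M := by
    refine (ip_cs bη (he.ebd hS i)).trans ?_
    rw [onb_nrm he, mul_one]
    exact nrm_le_of_bound bη hM (ae_mu_of hb)
  rw [abs_le] at *
  constructor <;> linarith [h2.1, h2.2, h3.1, h3.2]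

theorem exists_low {T : ℝ} (hT : 0 < T) {η : ℝ → ℝ → ℝ}
    (hc : ContinuousOn (fun p : ℝ × ℝ => η p.1 p.2) (Icc (0:ℝ) 1 ×ˢ Icc (0:ℝ) T))
    (hpos : ∀ y ∈ Icc (0:ℝ) 1, ∀ t ∈ Icc (0:ℝ) T, 0 < 1 + η y t) :
    ∃ w0 : ℝ, 0 < w0 ∧ w0 ≤ 1 ∧ ∀ y ∈ Icc (0:ℝ) 1, ∀ t ∈ Icc (0:ℝ) T, w0 ≤ 1 + η y t := by
  obtain ⟨p, hp, h⟩ := (isCompact_Icc.prod isCompact_Icc).exists_isMinOn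
    (⟨(0, 0), ⟨le_rfl, zero_le_one⟩, ⟨le_rfl, hT.le⟩⟩ : (Icc (0:ℝ) 1 ×ˢ Icc (0:ℝ) T).Nonempty) hc
  have := hpos p.1 hp.1 p.2 hp.2
  refine ⟨min 1 (1 + η p.1 p.2), lt_min one_pos this, min_le_left _ _, fun y hy t ht => ?_⟩
  have h2 := h (show (y, t) ∈ _ from ⟨hy, ht⟩)
  have h3 : η p.1 p.2 ≤ η y t := h2
  exact (min_le_right _ _).trans (by linarith)

theorem boot {T ε Λ K C w0 : ℝ} (hC : 0 < C) (hw0 : 0 < w0) (hε : 0 < ε) (hΛ : Λ = C / w0 + C + 1)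
    (hK : ε * Real.exp (Λ * T) ≤ K) {Y Yd : ℝ → ℝ} (h0 : Y 0 = 0)
    (hY : ∀ t ∈ Icc (0:ℝ) T, HasDerivWithinAt Y (Yd t) (Icc 0 T) t)
    (hb : ∀ t ∈ Icc (0:ℝ) T, Y t ≤ K → Yd t ≤ C * (Y t / w0 + ε)) :
    ∀ t ∈ Icc (0:ℝ) T, Y t ≤ ε * Real.exp (Λ * T) := by
  have hΛ0 : 0 < Λ := by rw [hΛ]; positivity
  have hmono : ∀ t, t ≤ T → ε * Real.exp (Λ * t) ≤ ε * Real.exp (Λ * T) := fun t ht =>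
    mul_le_mul_of_nonneg_left (Real.exp_le_exp.2 (mul_le_mul_of_nonneg_left ht hΛ0.le)) hε.le
  have key := image_le_of_deriv_right_lt_deriv_boundary (f := Y) (f' := Yd) (a := 0) (b := T)
    (B := fun t => ε * Real.exp (Λ * t)) (B' := fun t => Λ * (ε * Real.exp (Λ * t)))
    (fun t ht => (hY t ht).continuousWithinAt) (fun t ht => right_deriv (hY t (Ico_subset_Icc_self ht)) ht)
    (by rw [h0]; positivity)
    (fun t => by
      have h1 : HasDerivAt (fun t => Λ * t) Λ t := by simpa using (hasDerivAt_id t).const_mul Λ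
      exact ((h1.exp).const_mul ε).congr_deriv (by ring))
    (fun t ht he => by
      have he' : Y t = ε * Real.exp (Λ * t) := he
      have h1 := hb t (Ico_subset_Icc_self ht) (by rw [he']; exact (hmono t ht.2.le).trans hK)
      have h2 : ε ≤ Y t := by
        rw [he']
        have : 1 ≤ Real.exp (Λ * t) := Real.one_le_exp (mul_nonneg hΛ0.le ht.1)
        nlinarith
      have h3 : C * ε ≤ C * Y t := mul_le_mul_of_nonneg_left h2 hC.le
      show Yd t < Λ * (ε * Real.exp (Λ * t))
      rw [← he', hΛ]
      have h4 : (C / w0 + C + 1) * Y t = C * (Y t / w0) + C * Y t + Y t := by field_simp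
      rw [h4]
      linarith [mul_add C (Y t / w0) ε])
  intro t ht
  exact (key ht).trans (hmono t ht.2)

theorem sw_pde {T : ℝ} {r : ℕ} (hr : 1 ≤ r) {ηs us : ℕ → ℝ → ℝ → ℝ}
    (hηsm : SmoothChain T r 1 ηs) (husm : SmoothChain T r 1 us)
    (hsol : SW T (ηs 0) (us 0) (ηs 1) (us 1)) {t : ℝ} (ht : t ∈ Icc (0:ℝ) T) :
    (∀ y ∈ Icc (0:ℝ) 1, ηs 1 y t + derivWithin (fun z => us 0 z t) (Icc 0 1) y +
      (derivWithin (fun z => ηs 0 z t) (Icc 0 1) y * us 0 y t + ηs 0 y t * derivWithin (fun z => us 0 z t) (Icc 0 1) y) = 0) ∧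
    (∀ y ∈ Icc (0:ℝ) 1, us 1 y t + derivWithin (fun z => ηs 0 z t) (Icc 0 1) y +
      us 0 y t * derivWithin (fun z => us 0 z t) (Icc 0 1) y = 0) := by
  refine ⟨fun y hy => ?_, fun y hy => (hsol.1 y hy t ht).2⟩
  have h1 := (hsol.1 y hy t ht).1
  have hr' : (r : WithTop ℕ∞) ≠ 0 := by
    have : r ≠ 0 := by omega
    exact_mod_cast this
  have d1 := ((hηsm.2.1 0 (by norm_num) t ht).differentiableOn hr') y hy
  have d2 := ((husm.2.1 0 (by norm_num) t ht).differentiableOn hr') y hy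
  rw [derivWithin_fun_mul d1 d2] at h1
  exact h1

theorem mesh_boot {T : ℝ} (hT : 0 < T) {d s N : ℕ} {x : ℕ → ℝ} {h M C w0 Λ : ℝ} (hx : IsPartition N x)
    (hh : 0 < h) (hh1 : h ≤ 1) (hM : 0 ≤ M) (hC : 1 ≤ C) (hw0 : 0 < w0) (hw1 : w0 ≤ 1)
    (hΛ : Λ = C / w0 + C + 1) (hsmall : (h ^ (d+s+1)) ^ 2 * Real.exp (Λ * T) ≤ w0 / C * h ^ 3)
    {ηs us : ℕ → ℝ → ℝ → ℝ}
    (hηsm : SmoothChain T (d+s+2) 1 ηs) (husm : SmoothChain T (d+s+2) 1 us)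
    (hsol : SW T (ηs 0) (us 0) (ηs 1) (us 1))
    (hlow : ∀ y ∈ Icc (0:ℝ) 1, ∀ t ∈ Icc (0:ℝ) T, w0 ≤ 1 + ηs 0 y t)
    (hreg : ∀ t ∈ Icc 0 T, ∀ i ≤ d+s+2, ∀ y ∈ Icc (0:ℝ) 1,
      |iteratedDerivWithin i (fun z => ηs 0 z t) (Icc 0 1) y| ≤ M ∧
      |iteratedDerivWithin i (fun z => us 0 z t) (Icc 0 1) y| ≤ M)
    (hηt : ∀ t ∈ Icc 0 T, ∀ y ∈ Icc (0:ℝ) 1, |ηs 1 y t| ≤ M)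
    {n n0 : ℕ} {e e' : Fin n → ℝ → ℝ} {f f' : Fin n0 → ℝ → ℝ} (he : ONB (Sh N (d+s+2) s x) n e)
    (hf : ONB (Sh0 N (d+s+2) s x) n0 f)
    (pe : ∀ i, PW (e i) (e' i)) (pf : ∀ i, PW (f i) (f' i))
    (hE : ∀ η u ηt : ℝ → ℝ, ContDiffOn ℝ (d+s+2 : ℕ) η (Icc 0 1) → ContDiffOn ℝ (d+s+2 : ℕ) u (Icc 0 1) →
      ContinuousOn ηt (Icc 0 1) →
      (∀ i ≤ d+s+2, ∀ y ∈ Icc (0:ℝ) 1, |iteratedDerivWithin i η (Icc 0 1) y| ≤ M) →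
      (∀ i ≤ d+s+2, ∀ y ∈ Icc (0:ℝ) 1, |iteratedDerivWithin i u (Icc 0 1) y| ≤ M) →
      (∀ y ∈ Icc (0:ℝ) 1, |ηt y| ≤ M) → u 0 = 0 → u 1 = 0 →
      ∀ gη gu, PW (prj e η) gη → PW (prj f u) gu →
      nrm (fun y => η y - prj e η y) ≤ C * h ^ (d+s+1) ∧ nrm (fun y => u y - prj f u y) ≤ C * h ^ (d+s+1) ∧
      ∀ θ θ' ξ ξ', θ ∈ Sh N (d+s+2) s x → PW θ θ' → ξ ∈ Sh0 N (d+s+2) s x → PW ξ ξ' →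
        C * (nrm θ ^ 2 + nrm ξ ^ 2) ≤ h ^ 3 →
        ∫ y, EnF (fun y => 1 + η y) (derivWithin η (Icc 0 1)) u (derivWithin u (Icc 0 1)) ηt
          (fun y => η y - prj e η y) (fun y => derivWithin η (Icc 0 1) y - gη y)
          (fun y => u y - prj f u y) (fun y => derivWithin u (Icc 0 1) y - gu y)
          θ θ' ξ ξ' (prj f (fun y => (1 + η y) * ξ y)) y ∂mu
        ≤ C * (nrm θ ^ 2 + nrm ξ ^ 2 + (h ^ (d+s+1)) ^ 2)) :
    ∃ v : ℝ → (Fin n ⊕ Fin n0 → ℝ),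
      v 0 = Sum.elim (fun i => ip (fun y => ηs 0 y 0) (e i)) (fun l => ip (fun y => us 0 y 0) (f l)) ∧
      ∀ t ∈ Icc (0:ℝ) T, HasDerivWithinAt v (VF e e' f f' (v t)) (Icc 0 T) t ∧
        nrm (fun y => ηs 0 y t - cmb e (fun i => v t (Sum.inl i)) y) +
          nrm (fun y => us 0 y t - cmb f (fun i => v t (Sum.inr i)) y)
        ≤ 2 * (C + Real.sqrt (Real.exp (Λ * T) / w0)) * h ^ (d+s+1) := by
  have fs : FSp (Sh N (d+s+2) s x) := Sp_fsp hx d (s+1)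
  have fs0 : FSp (Sh0 N (d+s+2) s x) := Sh0_fsp hx d s
  have be := fun i => (pe i).bd
  have be' := fun i => (pe i).bd'
  have bf := fun i => (pf i).bd
  have bf' := fun i => (pf i).bd'
  have hC0 : 0 < C := by linarith
  obtain ⟨v, hv0, hv⟩ := clamped_ode (VF_contDiff be be' bf bf') (R := M + 1) (by linarith) hT
    (Sum.elim (fun i => ip (fun y => ηs 0 y 0) (e i)) (fun l => ip (fun y => us 0 y 0) (f l)))
  have cη : ∀ j ≤ 1, ∀ t ∈ Icc (0:ℝ) T, ContinuousOn (fun y => ηs j y t) (Icc 0 1) :=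
    fun j hj t ht => (hηsm.2.1 j hj t ht).continuousOn
  have cu : ∀ j ≤ 1, ∀ t ∈ Icc (0:ℝ) T, ContinuousOn (fun y => us j y t) (Icc 0 1) :=
    fun j hj t ht => (husm.2.1 j hj t ht).continuousOn
  have bη : ∀ j ≤ 1, ∀ t ∈ Icc (0:ℝ) T, Bd (fun y => ηs j y t) := fun j hj t ht => Bd.of_cont (cη j hj t ht)
  have bu : ∀ j ≤ 1, ∀ t ∈ Icc (0:ℝ) T, Bd (fun y => us j y t) := fun j hj t ht => Bd.of_cont (cu j hj t ht)
  set α : ℝ → Fin n → ℝ := fun t i => ip (fun y => ηs 0 y t) (e i) - v t (Sum.inl i) with hα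
  set β : ℝ → Fin n0 → ℝ := fun t i => ip (fun y => us 0 y t) (f i) - v t (Sum.inr i) with hβ
  set W : ℝ → Fin n0 → Fin n0 → ℝ := fun t l m => ip (fun y => f l y * f m y) (fun y => 1 + ηs 0 y t) with hW
  set Wd : ℝ → Fin n0 → Fin n0 → ℝ := fun t l m => ip (fun y => f l y * f m y) (fun y => ηs 1 y t) with hWd
  set αd : ℝ → Fin n → ℝ := fun t i => ip (fun y => ηs 1 y t) (e i) - VF e e' f f' (clp (M+1) (v t)) (Sum.inl i) with hαd
  set βd : ℝ → Fin n0 → ℝ := fun t i => ip (fun y => us 1 y t) (f i) - VF e e' f f' (clp (M+1) (v t)) (Sum.inr i) with hβd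
  set Y : ℝ → ℝ := fun s => (∑ i, α s i ^ 2) + ∑ l, ∑ m, β s l * β s m * W s l m with hY
  have Yder : ∀ t ∈ Icc (0:ℝ) T, HasDerivWithinAt Y
      ((∑ i, 2 * α t i * αd t i) + ∑ l, ∑ m, ((βd t l * β t m + β t l * βd t m) * W t l m + β t l * β t m * Wd t l m))
      (Icc 0 T) t := by
    intro t ht
    have hvc := hasDerivWithinAt_pi.1 (hv t ht)
    refine Y_hasDeriv (fun i => ?_) (fun i => ?_) (fun l m => ?_)
    · exact (ip_time_deriv (φ := ηs 0) (φt := ηs 1) (hηsm.1 0 (by norm_num)) (cη 0 (by norm_num)) (cη 1 le_rfl)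
        (hηsm.2.2 1 le_rfl) (be i) ht).fun_sub (hvc (Sum.inl i))
    · exact (ip_time_deriv (φ := us 0) (φt := us 1) (husm.1 0 (by norm_num)) (cu 0 (by norm_num)) (cu 1 le_rfl)
        (husm.2.2 1 le_rfl) (bf i) ht).fun_sub (hvc (Sum.inr i))
    · have := ip_time_deriv (φ := fun y t => 1 + ηs 0 y t) (φt := ηs 1)
        (fun y hy t ht => (hηsm.1 0 (by norm_num) y hy t ht).const_add 1)
        (fun t ht => continuousOn_const.add (cη 0 (by norm_num) t ht)) (cη 1 le_rfl)
        (hηsm.2.2 1 le_rfl) ((bf l).mul (bf m)) ht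
      simp only [ip_comm _ (fun y => f l y * f m y)] at this
      exact this
  have Ylow : ∀ t ∈ Icc (0:ℝ) T, w0 * (nrm (cmb e (α t)) ^ 2 + nrm (cmb f (β t)) ^ 2) ≤ Y t := by
    intro t ht
    have b1 := bη 0 (by norm_num) t ht
    exact Y_low fs fs0 he hf (α t) (β t) (w := fun y => 1 + ηs 0 y t) (by fun_prop) hw1 (fun y hy => hlow y hy t ht)
  have stat : ∀ t ∈ Icc (0:ℝ) T, _ := fun t ht =>
    hE (fun y => ηs 0 y t) (fun y => us 0 y t) (fun y => ηs 1 y t) (hηsm.2.1 0 (by norm_num) t ht)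
      (husm.2.1 0 (by norm_num) t ht) (cη 1 le_rfl t ht) (fun i hi y hy => (hreg t ht i hi y hy).1)
      (fun i hi y hy => (hreg t ht i hi y hy).2) (hηt t ht) (hsol.2 t ht).1 (hsol.2 t ht).2
      (cmb e' (fun i => ip (fun y => ηs 0 y t) (e i))) (cmb f' (fun i => ip (fun y => us 0 y t) (f i)))
      (cmb_pw pe _) (cmb_pw pf _)
  have sml : ∀ t ∈ Icc (0:ℝ) T, Y t ≤ w0 / C * h ^ 3 →
      C * (nrm (cmb e (α t)) ^ 2 + nrm (cmb f (β t)) ^ 2) ≤ h ^ 3 := by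
    intro t ht hle
    have h1 := (Ylow t ht).trans hle
    have h2 : w0 * (C * (nrm (cmb e (α t)) ^ 2 + nrm (cmb f (β t)) ^ 2)) ≤ w0 * h ^ 3 := by
      have h3 := mul_le_mul_of_nonneg_left h1 hC0.le
      have h4 : C * (w0 / C * h ^ 3) = w0 * h ^ 3 := by field_simp
      linarith
    exact le_of_mul_le_mul_left h2 hw0
  have hcl : ∀ t ∈ Icc (0:ℝ) T, Y t ≤ w0 / C * h ^ 3 → clp (M+1) (v t) = v t := by
    intro t ht hle
    have h1 := sml t ht hle
    have h2 : h ^ 3 ≤ 1 := pow_le_one₀ hh.le hh1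
    have q1 := sq_nonneg (nrm (cmb e (α t)))
    have q2 := sq_nonneg (nrm (cmb f (β t)))
    have h3 : nrm (cmb e (α t)) ^ 2 + nrm (cmb f (β t)) ^ 2 ≤ 1 := by nlinarith
    apply clp_id
    rintro (i | i)
    · refine coef_le fs he (bη 0 (by norm_num) t ht) hM (fun y hy => ?_) (fun i => v t (Sum.inl i)) ?_ i
      · simpa using (hreg t ht 0 (by omega) y hy).1
      · exact le_trans (by linarith) h3
    · refine coef_le fs0 hf (bu 0 (by norm_num) t ht) hM (fun y hy => ?_) (fun i => v t (Sum.inr i)) ?_ i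
      · simpa using (hreg t ht 0 (by omega) y hy).2
      · exact le_trans (by linarith) h3
  have Ybd : ∀ t ∈ Icc (0:ℝ) T, Y t ≤ (h ^ (d+s+1)) ^ 2 * Real.exp (Λ * T) := by
    refine boot hC0 hw0 (by positivity) hΛ hsmall ?_ Yder ?_
    · simp [hY, hα, hβ, hv0]
    · intro t ht hle
      have hc := hcl t ht hle
      obtain ⟨p1, p2⟩ := sw_pde (by omega) hηsm husm hsol ht
      have pη := (PW.of_contDiffOn (s := d+s+1) (hηsm.2.1 0 (by norm_num) t ht)).1
      have pu := (PW.of_contDiffOn (s := d+s+1) (husm.2.1 0 (by norm_num) t ht)).1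
      have e1 := YD_eq pe pf pη pu (bη 1 le_rfl t ht) (bu 1 le_rfl t ht) p1 p2
        (fun i => v t (Sum.inl i)) (fun i => v t (Sum.inr i)) (α t) (αd t) (β t) (βd t) rfl rfl
        (by simp only [hαd]; rw [hc]; rfl) (by simp only [hβd]; rw [hc]; rfl)
      refine e1.le.trans (((stat t ht).2.2 (cmb e (α t)) (cmb e' (α t)) (cmb f (β t)) (cmb f' (β t))
        (fs.sum _ _ he.mem _) (cmb_pw pe _) (fs0.sum _ _ hf.mem _) (cmb_pw pf _) (sml t ht hle)).trans ?_)
      refine mul_le_mul_of_nonneg_left ?_ hC0.le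
      have := Ylow t ht
      have h2 : nrm (cmb e (α t)) ^ 2 + nrm (cmb f (β t)) ^ 2 ≤ Y t / w0 := by
        rw [le_div_iff₀ hw0]; linarith
      linarith
  refine ⟨v, hv0, fun t ht => ⟨?_, ?_⟩⟩
  · have := hv t ht
    rwa [hcl t ht ((Ybd t ht).trans hsmall)] at this
  · obtain ⟨s1, s2, -⟩ := stat t ht
    set X := Real.sqrt (Real.exp (Λ * T) / w0) with hX
    have hX2 : X ^ 2 = Real.exp (Λ * T) / w0 := Real.sq_sqrt (by positivity)
    have h1 : nrm (cmb e (α t)) ^ 2 + nrm (cmb f (β t)) ^ 2 ≤ (X * h ^ (d+s+1)) ^ 2 := by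
      rw [mul_pow, hX2]
      have := (Ylow t ht).trans (Ybd t ht)
      rw [div_mul_eq_mul_div, le_div_iff₀ hw0]
      linarith
    have hXh : 0 ≤ X * h ^ (d+s+1) := by positivity
    have q1 := sq_nonneg (nrm (cmb e (α t)))
    have q2 := sq_nonneg (nrm (cmb f (β t)))
    have n1 : nrm (cmb e (α t)) ≤ X * h ^ (d+s+1) := abs_le_of_sq_le_sq' (by linarith) hXh |>.2
    have n2 : nrm (cmb f (β t)) ≤ X * h ^ (d+s+1) := abs_le_of_sq_le_sq' (by linarith) hXh |>.2
    have b1 := bη 0 (by norm_num) t ht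
    have b2 := bu 0 (by norm_num) t ht
    have b3 := he.prj_bd fs (fun y => ηs 0 y t)
    have b4 := hf.prj_bd fs0 (fun y => us 0 y t)
    have b5 := cmb_bd be (α t)
    have b6 := cmb_bd bf (β t)
    have t1 : nrm (fun y => ηs 0 y t - cmb e (fun i => v t (Sum.inl i)) y) ≤
        nrm (fun y => ηs 0 y t - prj e (fun y => ηs 0 y t) y) + nrm (cmb e (α t)) := by
      refine le_trans (le_of_eq ?_) (nrm_add_le (f := fun y => ηs 0 y t - prj e (fun y => ηs 0 y t) y) (g := cmb e (α t)) (by fun_prop) b5)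
      congr 1
      funext y
      have : cmb e (α t) y = cmb e (fun i => ip (fun y => ηs 0 y t) (e i)) y - cmb e (fun i => v t (Sum.inl i)) y :=
        cmb_sub _ _ _ _
      rw [this]
      simp only [prj, cmb]
      ring
    have t2 : nrm (fun y => us 0 y t - cmb f (fun i => v t (Sum.inr i)) y) ≤
        nrm (fun y => us 0 y t - prj f (fun y => us 0 y t) y) + nrm (cmb f (β t)) := by
      refine le_trans (le_of_eq ?_) (nrm_add_le (f := fun y => us 0 y t - prj f (fun y => us 0 y t) y) (g := cmb f (β t)) (by fun_prop) b6)
      congr 1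
      funext y
      have : cmb f (β t) y = cmb f (fun i => ip (fun y => us 0 y t) (f i)) y - cmb f (fun i => v t (Sum.inr i)) y :=
        cmb_sub _ _ _ _
      rw [this]
      simp only [prj, cmb]
      ring
    have : 2 * (C + X) * h ^ (d+s+1) = C * h ^ (d+s+1) + X * h ^ (d+s+1) + (C * h ^ (d+s+1) + X * h ^ (d+s+1)) := by ring
    rw [this]
    linarith

theorem eqOn_of_ae {f g : ℝ → ℝ} (h : f =ᵐ[mu] g) (hf : ContinuousOn f (Icc 0 1)) (hg : ContinuousOn g (Icc 0 1)) :
    EqOn f g (Icc 0 1) := by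
  apply MeasureTheory.Measure.eqOn_Icc_of_ae_eq (μ := MeasureTheory.volume) (zero_ne_one) _ hf hg
  rw [← MeasureTheory.Measure.restrict_congr_set MeasureTheory.Ioc_ae_eq_Icc]
  exact h

theorem cmb_cont {n : ℕ} {e : Fin n → ℝ → ℝ} (he : ∀ i, ContinuousOn (e i) (Icc 0 1)) (c : Fin n → ℝ) :
    ContinuousOn (cmb e c) (Icc 0 1) := by
  unfold cmb
  exact continuousOn_finset_sum _ fun i _ => continuousOn_const.mul (he i)

theorem ONB.repr_pt {S : Set (ℝ → ℝ)} {n : ℕ} {e : Fin n → ℝ → ℝ} (he : ONB S n e)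
    (hc : ∀ g ∈ S, ContinuousOn g (Icc 0 1)) {g : ℝ → ℝ} (hg : g ∈ S) {y : ℝ} (hy : y ∈ Icc (0:ℝ) 1) :
    g y = cmb e (fun i => ip g (e i)) y :=
  eqOn_of_ae (he.repr g hg) (hc g hg) (cmb_cont (fun i => hc _ (he.mem i)) _) hy

theorem coef_deriv {S : Set (ℝ → ℝ)} (hS : FSp S) {n : ℕ} {e : Fin n → ℝ → ℝ} (he : ONB S n e)
    (hc : ∀ g ∈ S, ContinuousOn g (Icc 0 1)) {T : ℝ} {φ dφ : ℝ → ℝ → ℝ} (hφ : ∀ t ∈ Icc (0:ℝ) T, φ t ∈ S)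
    (hdφ : ∀ t ∈ Icc (0:ℝ) T, dφ t ∈ S) {t : ℝ} (ht : t ∈ Icc (0:ℝ) T)
    (hd : ∀ y ∈ Icc (0:ℝ) 1, HasDerivWithinAt (fun s => φ s y) (dφ t y) (Icc 0 T) t) (i : Fin n) :
    HasDerivWithinAt (fun s => ip (φ s) (e i)) (ip (dφ t) (e i)) (Icc 0 T) t := by
  let V : Submodule ℝ (Fin n → ℝ) :=
    { carrier := {c | HasDerivWithinAt (fun s => ∑ i, ip (φ s) (e i) * c i) (∑ i, ip (dφ t) (e i) * c i) (Icc 0 T) t}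
      zero_mem' := by
        simp only [mem_setOf_eq, Pi.zero_apply, mul_zero, Finset.sum_const_zero]
        exact hasDerivWithinAt_const _ _ _
      add_mem' := by
        intro a b ha hb
        simp only [mem_setOf_eq, Pi.add_apply, mul_add, Finset.sum_add_distrib] at *
        exact ha.fun_add hb
      smul_mem' := by
        intro c a ha
        simp only [mem_setOf_eq, Pi.smul_apply, smul_eq_mul, mul_left_comm _ c, ← Finset.mul_sum] at *
        exact ha.const_mul c }
  have hVe : ∀ y ∈ Icc (0:ℝ) 1, (fun j => e j y) ∈ V := by
    intro y hy
    show HasDerivWithinAt (fun s => ∑ i, ip (φ s) (e i) * e i y) (∑ i, ip (dφ t) (e i) * e i y) (Icc 0 T) t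
    have h1 : dφ t y = ∑ i, ip (dφ t) (e i) * e i y := he.repr_pt hc (hdφ t ht) hy
    rw [← h1]
    exact (hd y hy).congr (fun s hs => (he.repr_pt hc (hφ s hs) hy).symm) (he.repr_pt hc (hφ t ht) hy).symm
  have hV : V = ⊤ := by
    by_contra hne
    obtain ⟨F, hF0, hF⟩ := Submodule.exists_le_ker_of_lt_top V (lt_top_iff_ne_top.2 hne)
    apply hF0
    have hFc : ∀ c : Fin n → ℝ, F c = ∑ i, F (Pi.single i 1) * c i := by
      intro c
      rw [LinearMap.pi_apply_eq_sum_univ F c]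
      refine Finset.sum_congr rfl fun i _ => ?_
      rw [smul_eq_mul, mul_comm]
      congr 2
      funext j
      simp [Pi.single_apply, eq_comm]
    have hz : nrm (fun y => ∑ i, F (Pi.single i 1) * e i y) ^ 2 = 0 := by
      rw [nrm_sq_int]
      rw [MeasureTheory.integral_eq_zero_of_ae]
      refine ae_mu_of fun y hy => ?_
      have := hF (hVe y hy)
      rw [LinearMap.mem_ker, hFc] at this
      simp [this]
    rw [he.nrm_comb hS, Finset.sum_eq_zero_iff_of_nonneg (fun i _ => sq_nonneg _)] at hz
    ext i
    have := hz i (Finset.mem_univ i)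
    simpa using this
  have hi : (Pi.single i 1 : Fin n → ℝ) ∈ V := by rw [hV]; trivial
  have hi' : HasDerivWithinAt (fun s => ∑ j, ip (φ s) (e j) * (Pi.single i 1 : Fin n → ℝ) j)
    (∑ j, ip (dφ t) (e j) * (Pi.single i 1 : Fin n → ℝ) j) (Icc 0 T) t := hi
  simpa [Pi.single_apply] using hi'

theorem weakA {n n0 : ℕ} {e e' : Fin n → ℝ → ℝ} {f f' : Fin n0 → ℝ → ℝ}
    (pe : ∀ i, PW (e i) (e' i)) (pf : ∀ i, PW (f i) (f' i)) {a : Fin n → ℝ} {b : Fin n0 → ℝ} {g w φ : ℝ → ℝ}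
    (hg : ∀ y ∈ Icc (0:ℝ) 1, g y = cmb e a y) (hw : ∀ y ∈ Icc (0:ℝ) 1, w y = cmb f b y) (bφ : Bd φ) :
    ip (deriv w) φ + ip (deriv (fun y => g y * w y)) φ =
      ip (fun y => cmb f' b y + (cmb e' a y * cmb f b y + cmb e a y * cmb f' b y)) φ := by
  have p1 := cmb_pw pe a
  have p2 := cmb_pw pf b
  have b1 := p1.bd
  have b2 := p2.bd
  have b1' := p1.bd'
  have b2' := p2.bd'
  have q2 : PW w (cmb f' b) := p2.congr hw
  have q3 : PW (fun y => g y * w y) (fun y => cmb e' a y * cmb f b y + cmb e a y * cmb f' b y) :=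
    (p1.mul p2).congr (fun y hy => by rw [hg y hy, hw y hy])
  rw [ip_congr q2.deriv_ae (Filter.EventuallyEq.refl _ φ), ip_congr q3.deriv_ae (Filter.EventuallyEq.refl _ φ)]
  exact (ip_add b2' q3.bd' bφ).symm

theorem weakB {n n0 : ℕ} {e e' : Fin n → ℝ → ℝ} {f f' : Fin n0 → ℝ → ℝ}
    (pe : ∀ i, PW (e i) (e' i)) (pf : ∀ i, PW (f i) (f' i)) {a : Fin n → ℝ} {b : Fin n0 → ℝ} {g w φ : ℝ → ℝ}
    (hg : ∀ y ∈ Icc (0:ℝ) 1, g y = cmb e a y) (hw : ∀ y ∈ Icc (0:ℝ) 1, w y = cmb f b y) (bφ : Bd φ) :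
    ip (deriv g) φ + ip (fun y => w y * deriv w y) φ =
      ip (fun y => cmb e' a y + cmb f b y * cmb f' b y) φ := by
  have p1 := cmb_pw pe a
  have p2 := cmb_pw pf b
  have b1 := p1.bd
  have b2 := p2.bd
  have b1' := p1.bd'
  have b2' := p2.bd'
  have q1 : PW g (cmb e' a) := p1.congr hg
  have q2 : PW w (cmb f' b) := p2.congr hw
  have h3 : (fun y => w y * deriv w y) =ᵐ[mu] fun y => cmb f b y * cmb f' b y := by
    filter_upwards [q2.deriv_ae, ae_mu_of hw] with y h1 h2
    rw [h1, h2]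
  rw [ip_congr q1.deriv_ae (Filter.EventuallyEq.refl _ φ), ip_congr h3 (Filter.EventuallyEq.refl _ φ)]
  exact (ip_add b1' (by fun_prop) bφ).symm

/-- testing against the basis suffices -/
theorem test_all {S : Set (ℝ → ℝ)} (hS : FSp S) {n : ℕ} {e : Fin n → ℝ → ℝ} (he : ONB S n e) {G : ℝ → ℝ} (bG : Bd G)
    {φ : ℝ → ℝ} (hφ : φ ∈ S) : ip (cmb e (fun i => - ip G (e i))) φ + ip G φ = 0 := by
  have be := he.ebd hS
  have h1 : φ =ᵐ[mu] cmb e (fun i => ip φ (e i)) := he.repr φ hφ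
  rw [ip_congr (Filter.EventuallyEq.refl _ _) h1, ip_congr (Filter.EventuallyEq.refl _ G) h1,
    ip_cmb_r be _ (cmb_bd be _), ip_cmb_r be _ bG, ← Finset.sum_add_distrib]
  refine Finset.sum_eq_zero fun i _ => ?_
  have : ip (cmb e (fun i => - ip G (e i))) (e i) = - ip G (e i) := he.ip_comb hS _ i
  rw [this]
  ring

theorem cmb_hasDeriv {n : ℕ} (e : Fin n → ℝ → ℝ) {a : ℝ → Fin n → ℝ} {ad : Fin n → ℝ} {s : Set ℝ} {t : ℝ}
    (h : ∀ i, HasDerivWithinAt (fun t => a t i) (ad i) s t) (y : ℝ) :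
    HasDerivWithinAt (fun t => cmb e (a t) y) (cmb e ad y) s t := by
  unfold cmb
  exact HasDerivWithinAt.fun_sum fun i _ => (h i).mul_const _

theorem galerkin_of_ode {T : ℝ} {d s N : ℕ} {x : ℕ → ℝ} (hx : IsPartition N x)
    {n n0 : ℕ} {e e' : Fin n → ℝ → ℝ} {f f' : Fin n0 → ℝ → ℝ} (he : ONB (Sh N (d+s+2) s x) n e)
    (hf : ONB (Sh0 N (d+s+2) s x) n0 f)
    (pe : ∀ i, PW (e i) (e' i)) (pf : ∀ i, PW (f i) (f' i)) {v : ℝ → (Fin n ⊕ Fin n0 → ℝ)}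
    (hv : ∀ t ∈ Icc (0:ℝ) T, HasDerivWithinAt v (VF e e' f f' (v t)) (Icc 0 T) t) :
    SolvesSWGalerkin N (d+s+2) s x T (fun t => cmb e (fun i => v t (Sum.inl i))) (fun t => cmb f (fun i => v t (Sum.inr i)))
      (fun t => cmb e (fun i => VF e e' f f' (v t) (Sum.inl i))) (fun t => cmb f (fun i => VF e e' f f' (v t) (Sum.inr i))) := by
  have fs : FSp (Sh N (d+s+2) s x) := Sp_fsp hx d (s+1)
  have fs0 : FSp (Sh0 N (d+s+2) s x) := Sh0_fsp hx d s
  have be := fun i => (pe i).bd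
  have be' := fun i => (pe i).bd'
  have bf := fun i => (pf i).bd
  have bf' := fun i => (pf i).bd'
  have cv : ContinuousOn v (Icc 0 T) := fun t ht => (hv t ht).continuousWithinAt
  have cV : ContinuousOn (fun t => VF e e' f f' (v t)) (Icc 0 T) :=
    (VF_contDiff be be' bf bf').continuous.comp_continuousOn cv
  have cVi := continuousOn_pi.1 cV
  refine ⟨fun t ht => ⟨fs.sum _ _ he.mem _, fs0.sum _ _ hf.mem _, fs.sum _ _ he.mem _, fs0.sum _ _ hf.mem _⟩,
    fun y hy t ht => ?_, fun y hy => ?_, fun t ht => ⟨fun φ hφ => ?_, fun χ hχ => ?_⟩⟩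
  · have h := hasDerivWithinAt_pi.1 (hv t ht)
    exact ⟨cmb_hasDeriv e (fun i => h (Sum.inl i)) y, cmb_hasDeriv f (fun i => h (Sum.inr i)) y⟩
  · unfold cmb
    exact ⟨continuousOn_finset_sum _ fun i _ => (cVi (Sum.inl i)).mul continuousOn_const,
      continuousOn_finset_sum _ fun i _ => (cVi (Sum.inr i)).mul continuousOn_const⟩
  · rw [add_assoc, weakA pe pf (fun y _ => rfl) (fun y _ => rfl) (fs.bd _ hφ)]
    have b1 := cmb_bd be (fun i => v t (Sum.inl i))
    have b2 := cmb_bd be' (fun i => v t (Sum.inl i))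
    have b3 := cmb_bd bf (fun i => v t (Sum.inr i))
    have b4 := cmb_bd bf' (fun i => v t (Sum.inr i))
    exact test_all fs he (by fun_prop) hφ
  · rw [add_assoc, weakB pe pf (fun y _ => rfl) (fun y _ => rfl) (fs0.bd _ hχ)]
    have b2 := cmb_bd be' (fun i => v t (Sum.inl i))
    have b3 := cmb_bd bf (fun i => v t (Sum.inr i))
    have b4 := cmb_bd bf' (fun i => v t (Sum.inr i))
    exact test_all fs0 hf (by fun_prop) hχ

theorem ode_of_galerkin {T : ℝ} {d s N : ℕ} {x : ℕ → ℝ} (hx : IsPartition N x)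
    {n n0 : ℕ} {e e' : Fin n → ℝ → ℝ} {f f' : Fin n0 → ℝ → ℝ} (he : ONB (Sh N (d+s+2) s x) n e)
    (hf : ONB (Sh0 N (d+s+2) s x) n0 f)
    (pe : ∀ i, PW (e i) (e' i)) (pf : ∀ i, PW (f i) (f' i)) {ηh uh dηh duh : ℝ → ℝ → ℝ}
    (hG : SolvesSWGalerkin N (d+s+2) s x T ηh uh dηh duh) {t : ℝ} (ht : t ∈ Icc (0:ℝ) T) :
    HasDerivWithinAt (fun t => Sum.elim (fun i => ip (ηh t) (e i)) (fun l => ip (uh t) (f l)))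
      (VF e e' f f' (Sum.elim (fun i => ip (ηh t) (e i)) (fun l => ip (uh t) (f l)))) (Icc 0 T) t := by
  have fs : FSp (Sh N (d+s+2) s x) := Sp_fsp hx d (s+1)
  have fs0 : FSp (Sh0 N (d+s+2) s x) := Sh0_fsp hx d s
  have hc : ∀ g ∈ Sh N (d+s+2) s x, ContinuousOn g (Icc 0 1) := fun g hg => hg.1.continuousOn
  have hc0 : ∀ g ∈ Sh0 N (d+s+2) s x, ContinuousOn g (Icc 0 1) := fun g hg => hg.1.1.continuousOn
  obtain ⟨g1, g2, g3, g4⟩ := hG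
  have hη : ∀ y ∈ Icc (0:ℝ) 1, ηh t y = cmb e (fun i => ip (ηh t) (e i)) y :=
    fun y hy => he.repr_pt hc (g1 t ht).1 hy
  have hu : ∀ y ∈ Icc (0:ℝ) 1, uh t y = cmb f (fun i => ip (uh t) (f i)) y :=
    fun y hy => hf.repr_pt hc0 (g1 t ht).2.1 hy
  rw [hasDerivWithinAt_pi]
  rintro (i | i)
  · have h1 := coef_deriv fs he hc (fun t ht => (g1 t ht).1) (fun t ht => (g1 t ht).2.2.1) ht
      (fun y hy => (g2 y hy t ht).1) i
    have h2 := (g4 t ht).1 (e i) (he.mem i)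
    rw [add_assoc, weakA pe pf hη hu (he.ebd fs i)] at h2
    refine h1.congr_deriv ?_
    simp only [VF, Sum.elim_inl, Sum.elim_inr, VFA]
    linarith
  · have h1 := coef_deriv fs0 hf hc0 (fun t ht => (g1 t ht).2.1) (fun t ht => (g1 t ht).2.2.2) ht
      (fun y hy => (g2 y hy t ht).2) i
    have h2 := (g4 t ht).2 (f i) (hf.mem i)
    rw [add_assoc, weakB pe pf hη hu (hf.ebd fs0 i)] at h2
    refine h1.congr_deriv ?_
    simp only [VF, Sum.elim_inl, Sum.elim_inr, VFB]
    linarith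

theorem proj_coef {S : Set (ℝ → ℝ)} (hS : FSp S) {n : ℕ} {e : Fin n → ℝ → ℝ} (he : ONB S n e) {g p : ℝ → ℝ}
    (bg : Bd g) (hp : IsL2ProjOn S g p) (i : Fin n) : ip p (e i) = ip g (e i) := by
  have h := hp.2 (e i) (he.mem i)
  rw [ip_sub bg (hS.bd _ hp.1) (he.ebd hS i)] at h
  linarith

theorem galerkin_unique {T : ℝ} (hT : 0 < T) {d s N : ℕ} {x : ℕ → ℝ} (hx : IsPartition N x)
    {η0 u0 : ℝ → ℝ} (bη : Bd η0) (bu : Bd u0) {ηh uh dηh duh ηh' uh' dηh' duh' : ℝ → ℝ → ℝ}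
    (hG : SolvesSWGalerkin N (d+s+2) s x T ηh uh dηh duh)
    (p1 : IsL2ProjOn (Sh N (d+s+2) s x) η0 (ηh 0)) (p2 : IsL2ProjOn (Sh0 N (d+s+2) s x) u0 (uh 0))
    (hG' : SolvesSWGalerkin N (d+s+2) s x T ηh' uh' dηh' duh')
    (p1' : IsL2ProjOn (Sh N (d+s+2) s x) η0 (ηh' 0)) (p2' : IsL2ProjOn (Sh0 N (d+s+2) s x) u0 (uh' 0))
    {n n0 : ℕ} {e e' : Fin n → ℝ → ℝ} {f f' : Fin n0 → ℝ → ℝ} (he : ONB (Sh N (d+s+2) s x) n e)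
    (hf : ONB (Sh0 N (d+s+2) s x) n0 f)
    (pe : ∀ i, PW (e i) (e' i)) (pf : ∀ i, PW (f i) (f' i)) :
    ∀ t ∈ Icc (0:ℝ) T, ∀ y ∈ Icc (0:ℝ) 1, ηh t y = ηh' t y ∧ uh t y = uh' t y := by
  have fs : FSp (Sh N (d+s+2) s x) := Sp_fsp hx d (s+1)
  have fs0 : FSp (Sh0 N (d+s+2) s x) := Sh0_fsp hx d s
  have hc : ∀ g ∈ Sh N (d+s+2) s x, ContinuousOn g (Icc 0 1) := fun g hg => hg.1.continuousOn
  have hc0 : ∀ g ∈ Sh0 N (d+s+2) s x, ContinuousOn g (Icc 0 1) := fun g hg => hg.1.1.continuousOn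
  have key := ode_unique (VF_contDiff (fun i => (pe i).bd) (fun i => (pe i).bd') (fun i => (pf i).bd) (fun i => (pf i).bd'))
    (v := fun t => Sum.elim (fun i => ip (ηh t) (e i)) (fun l => ip (uh t) (f l)))
    (w := fun t => Sum.elim (fun i => ip (ηh' t) (e i)) (fun l => ip (uh' t) (f l))) (T := T) (by
      funext j
      rcases j with i | i
      · simp only [Sum.elim_inl]; rw [proj_coef fs he bη p1, proj_coef fs he bη p1']
      · simp only [Sum.elim_inr]; rw [proj_coef fs0 hf bu p2, proj_coef fs0 hf bu p2'])
    (fun t ht => ode_of_galerkin hx he hf pe pf hG ht) (fun t ht => ode_of_galerkin hx he hf pe pf hG' ht)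
  intro t ht y hy
  have hk := key ht
  constructor
  · rw [he.repr_pt hc (hG.1 t ht).1 hy, he.repr_pt hc (hG'.1 t ht).1 hy]
    have : (fun i => ip (ηh t) (e i)) = fun i => ip (ηh' t) (e i) := by
      funext i
      exact congrFun hk (Sum.inl i)
    rw [this]
  · rw [hf.repr_pt hc0 (hG.1 t ht).2.1 hy, hf.repr_pt hc0 (hG'.1 t ht).2.1 hy]
    have : (fun i => ip (uh t) (f i)) = fun i => ip (uh' t) (f i) := by
      funext i
      exact congrFun hk (Sum.inr i)
    rw [this]

theorem stmt_aux (d s : ℕ) (hds : 1 ≤ d + s)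
    (γ T : ℝ) (hγ : 1 ≤ γ) (hT : 0 < T)
    (ηs us : ℕ → ℝ → ℝ → ℝ)
    (hηsm : SmoothChain T (d+s+2) 1 ηs) (husm : SmoothChain T (d+s+2) 1 us)
    (hsol : SW T (ηs 0) (us 0) (ηs 1) (us 1))
    (hpos : ∀ y ∈ Icc (0:ℝ) 1, ∀ t ∈ Icc (0:ℝ) T, 0 < 1 + ηs 0 y t) :
    ∃ h₀ : ℝ, 0 < h₀ ∧ ∃ C : ℝ, ∀ (N : ℕ) (x : ℕ → ℝ) (h : ℝ),
      IsPartition N x → IsMeshSize N x h → QuasiUniform N x h γ → h ≤ h₀ →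
      (∃ ηh uh dηh duh : ℝ → ℝ → ℝ,
        SolvesSWGalerkin N (d+s+2) s x T ηh uh dηh duh ∧
        IsL2ProjOn (Sh N (d+s+2) s x) (fun y => ηs 0 y 0) (ηh 0) ∧
        IsL2ProjOn (Sh0 N (d+s+2) s x) (fun y => us 0 y 0) (uh 0) ∧
        ∀ t ∈ Icc (0:ℝ) T,
          nrm (fun y => ηs 0 y t - ηh t y) + nrm (fun y => us 0 y t - uh t y)
            ≤ C * h ^ (d+s+1)) ∧
      (∀ ηh uh dηh duh ηh' uh' dηh' duh' : ℝ → ℝ → ℝ,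
        SolvesSWGalerkin N (d+s+2) s x T ηh uh dηh duh →
        IsL2ProjOn (Sh N (d+s+2) s x) (fun y => ηs 0 y 0) (ηh 0) →
        IsL2ProjOn (Sh0 N (d+s+2) s x) (fun y => us 0 y 0) (uh 0) →
        SolvesSWGalerkin N (d+s+2) s x T ηh' uh' dηh' duh' →
        IsL2ProjOn (Sh N (d+s+2) s x) (fun y => ηs 0 y 0) (ηh' 0) →
        IsL2ProjOn (Sh0 N (d+s+2) s x) (fun y => us 0 y 0) (uh' 0) →
        ∀ t ∈ Icc (0:ℝ) T, ∀ y ∈ Icc (0:ℝ) 1,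
          ηh t y = ηh' t y ∧ uh t y = uh' t y) := by
  obtain ⟨M1, hM1, hreg1⟩ := reg_final (d+s+2) (by omega) T hT ηs us hηsm husm hsol hpos
  obtain ⟨M2, hM2⟩ := (isCompact_Icc.prod isCompact_Icc).exists_bound_of_continuousOn (hηsm.2.2 1 le_rfl)
  obtain ⟨w0, hw0, hw1, hlow⟩ := exists_low hT (hηsm.2.2 0 (by norm_num)) hpos
  obtain ⟨M, hM, hle1, hle2⟩ : ∃ M : ℝ, 0 ≤ M ∧ M1 ≤ M ∧ M2 ≤ M :=
    ⟨max M1 M2, hM1.trans (le_max_left _ _), le_max_left _ _, le_max_right _ _⟩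
  obtain ⟨C, hC, hE⟩ := energy_static d s γ M hγ hM
  have hC0 : 0 < C := by linarith
  obtain ⟨Λ, hΛ⟩ : ∃ Λ, Λ = C / w0 + C + 1 := ⟨_, rfl⟩
  refine ⟨w0 / C * Real.exp (-(Λ * T)), by positivity, 2 * (C + Real.sqrt (Real.exp (Λ * T) / w0)), ?_⟩
  intro N x h hx hm hq hh0
  have hh := mesh_pos hx hm
  have hh1 := mesh_le_one hx hm
  have fs : FSp (Sh N (d+s+2) s x) := Sp_fsp hx d (s+1)
  have fs0 : FSp (Sh0 N (d+s+2) s x) := Sh0_fsp hx d s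
  obtain ⟨n, e, he⟩ := fs.exists_onb
  obtain ⟨n0, f, hf⟩ := fs0.exists_onb
  have hpe : ∀ i, ∃ g, PW (e i) g := fun i => by
    obtain ⟨g, -, hg⟩ := Sp_deriv hx d s (he.mem i)
    exact ⟨g, hg⟩
  have hpf : ∀ i, ∃ g, PW (f i) g := fun i => by
    obtain ⟨g, -, hg⟩ := Sp_deriv hx d s (hf.mem i).1
    exact ⟨g, hg⟩
  choose e' pe using hpe
  choose f' pf using hpf
  have h00 : (0:ℝ) ∈ Icc (0:ℝ) T := ⟨le_rfl, hT.le⟩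
  have bη : Bd (fun y => ηs 0 y 0) := Bd.of_cont (hηsm.2.1 0 (by norm_num) 0 h00).continuousOn
  have bu : Bd (fun y => us 0 y 0) := Bd.of_cont (husm.2.1 0 (by norm_num) 0 h00).continuousOn
  have hsmall : (h ^ (d+s+1)) ^ 2 * Real.exp (Λ * T) ≤ w0 / C * h ^ 3 := by
    have a1 : (h ^ (d+s+1)) ^ 2 ≤ h ^ 4 := by
      rw [← pow_mul]
      exact pow_le_pow_of_le_one hh.le hh1 (by omega)
    have a2 : h * Real.exp (Λ * T) ≤ w0 / C := by
      have := mul_le_mul_of_nonneg_right hh0 (Real.exp_pos (Λ * T)).le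
      rwa [mul_assoc, ← Real.exp_add, neg_add_cancel, Real.exp_zero, mul_one] at this
    calc (h ^ (d+s+1)) ^ 2 * Real.exp (Λ * T) ≤ h ^ 4 * Real.exp (Λ * T) :=
          mul_le_mul_of_nonneg_right a1 (Real.exp_pos _).le
      _ = h * Real.exp (Λ * T) * h ^ 3 := by ring
      _ ≤ w0 / C * h ^ 3 := mul_le_mul_of_nonneg_right a2 (by positivity)
  constructor
  · obtain ⟨v, hv0, hv⟩ := mesh_boot hT hx hh hh1 hM hC hw0 hw1 hΛ hsmall hηsm husm hsol hlow
      (fun t ht i hi y hy => ⟨(hreg1 t ht i hi y hy).1.trans hle1, (hreg1 t ht i hi y hy).2.trans hle1⟩)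
      (fun t ht y hy => (hM2 (y, t) ⟨hy, ht⟩).trans hle2) he hf pe pf (hE N x h hx hm hq n e he n0 f hf)
    refine ⟨_, _, _, _, galerkin_of_ode hx he hf pe pf (fun t ht => (hv t ht).1), ?_, ?_, fun t ht => (hv t ht).2⟩
    · simp only [hv0, Sum.elim_inl]
      exact ⟨he.prj_mem fs _, fun χ hχ => he.orthog fs bη hχ⟩
    · simp only [hv0, Sum.elim_inr]
      exact ⟨hf.prj_mem fs0 _, fun χ hχ => hf.orthog fs0 bu hχ⟩
  · intro ηh uh dηh duh ηh' uh' dηh' duh' g1 g2 g3 g4 g5 g6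
    exact galerkin_unique hT hx bη bu g1 g2 g3 g4 g5 g6 he hf pe pf

theorem stmt_final (r k : ℕ) (hr : 3 ≤ r) (hk : k ≤ r - 2) : ∃ d, 1 ≤ d + k ∧ r = d + k + 2 :=
  ⟨r - 2 - k, by omega, by omega⟩

/-- **Error estimate for the semidiscrete Galerkin method for (SW), quasiuniform
meshes, r ≥ 3**: for h small enough, existence, uniqueness, and the `O(h^{r-1})`
L²-error bound. -/
theorem stmt_3 (r k : ℕ) (hr : 3 ≤ r) (hk : k ≤ r - 2)
    (γ T : ℝ) (hγ : 1 ≤ γ) (hT : 0 < T)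
    (ηs us : ℕ → ℝ → ℝ → ℝ)
    (hηsm : SmoothChain T r 1 ηs) (husm : SmoothChain T r 1 us)
    (hsol : SW T (ηs 0) (us 0) (ηs 1) (us 1))
    (hpos : ∀ y ∈ Icc (0:ℝ) 1, ∀ t ∈ Icc (0:ℝ) T, 0 < 1 + ηs 0 y t) :
    ∃ h₀ : ℝ, 0 < h₀ ∧ ∃ C : ℝ, ∀ (N : ℕ) (x : ℕ → ℝ) (h : ℝ),
      IsPartition N x → IsMeshSize N x h → QuasiUniform N x h γ → h ≤ h₀ →
      (∃ ηh uh dηh duh : ℝ → ℝ → ℝ,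
        SolvesSWGalerkin N r k x T ηh uh dηh duh ∧
        IsL2ProjOn (Sh N r k x) (fun y => ηs 0 y 0) (ηh 0) ∧
        IsL2ProjOn (Sh0 N r k x) (fun y => us 0 y 0) (uh 0) ∧
        ∀ t ∈ Icc (0:ℝ) T,
          nrm (fun y => ηs 0 y t - ηh t y) + nrm (fun y => us 0 y t - uh t y)
            ≤ C * h ^ (r - 1)) ∧
      (∀ ηh uh dηh duh ηh' uh' dηh' duh' : ℝ → ℝ → ℝ,
        SolvesSWGalerkin N r k x T ηh uh dηh duh →
        IsL2ProjOn (Sh N r k x) (fun y => ηs 0 y 0) (ηh 0) →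
        IsL2ProjOn (Sh0 N r k x) (fun y => us 0 y 0) (uh 0) →
        SolvesSWGalerkin N r k x T ηh' uh' dηh' duh' →
        IsL2ProjOn (Sh N r k x) (fun y => ηs 0 y 0) (ηh' 0) →
        IsL2ProjOn (Sh0 N r k x) (fun y => us 0 y 0) (uh' 0) →
        ∀ t ∈ Icc (0:ℝ) T, ∀ y ∈ Icc (0:ℝ) 1,
          ηh t y = ηh' t y ∧ uh t y = uh' t y) := by
  obtain ⟨d, hd, rfl⟩ := stmt_final r k hr hk
  exact stmt_aux d k hd γ T hγ hT ηs us hηsm husm hsol hpos
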